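/- Let χ be a Dirichlet character of modulus q and conductor q* > 1. Let q₁ be the maximal cubefree unitary divisor of q* (the largest divisor q₁ of q* such that q₁ is cubefree and gcd(q₁, q*/q₁) = 1), set q₂ = q*/q₁, and let q₀ = ∏_{p prime, p ∣ q, p ∤ q*} p. Then for every r ∈ ℕ and every ε > 0 there is a constant C depending only on r and ε such that for all M, N ∈ ℕ: |∑_{n=M+1}^{M+N} χ(n)| ≤ C · q₀^ε · q₁^{(r+1)/(4r²)+ε} · q₂^{1/r} · N^{1−1/r}. -/

import Mathlib

namespace Burgess
open Polynomial

lemma pow_sub_dvd_hasseDeriv {R : Type*} [CommRing R] (f : R[X]) (s : ℕ) :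
    ∀ (l : ℕ) (P : R[X]), f ^ s ∣ P → f ^ (s - l) ∣ hasseDeriv l P := by
  induction s with
  | zero => intro l P _; simp
  | succ s ih =>
    rintro l P ⟨P', rfl⟩
    rw [pow_succ', mul_assoc, hasseDeriv_mul]
    refine Finset.dvd_sum fun ij hij => ?_
    rw [Finset.HasAntidiagonal.mem_antidiagonal] at hij
    have h := ih ij.2 (f ^ s * P') (Dvd.intro _ rfl)
    rcases Nat.eq_zero_or_pos ij.1 with h0 | h0
    · rw [h0, hasseDeriv_zero']
      refine dvd_trans (pow_dvd_pow f (show s + 1 - l ≤ 1 + (s - ij.2) by omega)) ?_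
      rw [pow_add, pow_one]
      exact mul_dvd_mul_left f h
    · exact dvd_mul_of_dvd_right (dvd_trans (pow_dvd_pow f (by omega)) h) _

/-- Dividing the Hasse derivatives of `f ^ s * P` by their forced power of `f` is linear in `P`. -/
lemma exists_linearMap_hasseDeriv_pow_mul {K : Type*} [Field K] {f : K[X]} (hf : f ≠ 0)
    (s l : ℕ) : ∃ H : K[X] →ₗ[K] K[X], ∀ P, hasseDeriv l (f ^ s * P) = f ^ (s - l) * H P := by
  choose h hh using fun P : K[X] =>
    pow_sub_dvd_hasseDeriv f s l (f ^ s * P) (Dvd.intro _ rfl)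
  have hne : f ^ (s - l) ≠ 0 := pow_ne_zero _ hf
  refine ⟨{ toFun := h, map_add' := fun P P' => ?_, map_smul' := fun c P => ?_ }, hh⟩
  · apply mul_left_cancel₀ hne
    rw [← hh, mul_add, map_add, hh, hh, mul_add]
  · apply mul_left_cancel₀ hne
    rw [← hh, mul_smul_comm, map_smul, hh, RingHom.id_apply, mul_smul_comm]

lemma natDegree_lt_of_hasseDeriv_pow_mul {K : Type*} [Field K] {f P h : K[X]} (hf : f ≠ 0)
    {s l g : ℕ} (hg : 0 < g) (hP : P.degree < g)
    (hh : hasseDeriv l (f ^ s * P) = f ^ (s - l) * h) :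
    h.natDegree < g + l * f.natDegree := by
  by_cases h0 : h = 0
  · subst h0; simp [hg]
  have h1 := congrArg natDegree hh
  rw [natDegree_mul (pow_ne_zero _ hf) h0, natDegree_pow] at h1
  have h2 := natDegree_hasseDeriv_le (f ^ s * P) l
  have h3 : (f ^ s * P).natDegree ≤ s * f.natDegree + P.natDegree :=
    natDegree_mul_le.trans (by rw [natDegree_pow])
  have h4 : P.natDegree < g := by
    by_cases hP0 : P = 0
    · subst hP0; simpa using hg
    · exact (natDegree_lt_iff_degree_lt hP0).2 hP
  have h5 : s * f.natDegree ≤ (s - l) * f.natDegree + l * f.natDegree := by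
    rw [← add_mul]; exact Nat.mul_le_mul_right _ (by omega)
  omega

/-- Below order `q`, the Taylor coefficients at `x` do not see that a factor `X ^ (q * k)` is not
constant. -/
lemma coeff_taylor_mul_X_pow_card {K : Type*} [Field K] [Fintype K] (P : K[X]) (x : K) (k l : ℕ)
    (hl : l < Fintype.card K) :
    (taylor x (P * X ^ (Fintype.card K * k))).coeff l = (hasseDeriv l P).eval x * x ^ k := by
  obtain ⟨p, hp⟩ := CharP.exists K
  obtain ⟨n, hprime, hn⟩ := FiniteField.card K p
  have := Fact.mk hprime
  have h1 : taylor x (X ^ (Fintype.card K * k) : K[X])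
      = (X ^ Fintype.card K + C x) ^ k := by
    rw [taylor_X_pow, pow_mul]
    congr 1
    conv_lhs => rw [hn, add_pow_char_pow, ← hn, ← C_pow, FiniteField.pow_card]
  have h2 : X ^ Fintype.card K ∣ (X ^ Fintype.card K + C x) ^ k - (C x ^ k : K[X]) := by
    refine dvd_trans ?_ (sub_dvd_pow_sub_pow _ _ k)
    simp
  obtain ⟨v, hv⟩ := h2
  rw [taylor_mul, h1, sub_eq_iff_eq_add.1 hv, mul_add, coeff_add, mul_left_comm,
    coeff_X_pow_mul', if_neg (by omega), zero_add, ← C_pow, coeff_mul_C, taylor_coeff]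

lemma X_sub_C_pow_dvd_of_taylor_coeff {K : Type*} [Field K] (P : K[X]) (x : K) (M : ℕ)
    (h : ∀ l < M, (taylor x P).coeff l = 0) : (X - C x) ^ M ∣ P := by
  have h1 : X ^ M ∣ taylor x P := X_pow_dvd_iff.2 h
  obtain ⟨u, hu⟩ := h1
  refine ⟨taylor (-x) u, ?_⟩
  have := congrArg (taylor (-x)) hu
  rw [taylor_taylor, neg_add_cancel, taylor_zero, taylor_mul, taylor_X_pow] at this
  rw [this, C_neg, sub_eq_add_neg]

/-- A combination `∑ r_i f₁^{s_i} X^{t_i}` with widely spaced `t_i` cannot vanish. -/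
lemma sum_mul_pow_ne_zero {K : Type*} [Field K] {f : K[X]} (hf1 : ¬ X ∣ f) {g D : ℕ}
    (r : ℕ → K[X]) (hr : ∀ i, (r i).degree < g) (s t : ℕ → ℕ)
    (ht : ∀ i j, i < j → t i + g ≤ t j) (hne : ∃ i < D, r i ≠ 0) :
    ∑ i ∈ Finset.range D, r i * f ^ s i * X ^ t i ≠ 0 := by
  classical
  intro h0
  obtain ⟨hi, hri⟩ := Nat.find_spec hne
  have hmin : ∀ j < Nat.find hne, r j = 0 := fun j hj => by
    have := Nat.find_min hne hj
    push Not at this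
    exact this (hj.trans hi)
  set i := Nat.find hne
  have hdvd : X ^ (t i + g) ∣ r i * f ^ s i * X ^ t i := by
    rw [← Finset.add_sum_erase _ _ (Finset.mem_range.2 hi)] at h0
    rw [eq_neg_of_add_eq_zero_left h0, dvd_neg]
    refine Finset.dvd_sum fun j hj => ?_
    rw [Finset.mem_erase, Finset.mem_range] at hj
    rcases lt_or_gt_of_ne hj.1 with h | h
    · rw [hmin j h]; simp
    · exact dvd_mul_of_dvd_right (pow_dvd_pow _ (ht _ _ h)) _
  rw [pow_add, mul_comm] at hdvd
  have h2 : X ^ g ∣ r i * f ^ s i :=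
    (mul_dvd_mul_iff_right (pow_ne_zero (t i) X_ne_zero)).1 (by simpa [mul_comm] using hdvd)
  have h3 : X ^ g ∣ r i := by
    refine IsCoprime.dvd_of_dvd_mul_right ?_ h2
    apply IsCoprime.pow
    exact (irreducible_X.coprime_iff_not_dvd).2 hf1
  have := degree_le_of_dvd h3 hri
  rw [degree_X_pow] at this
  exact absurd (hr i) (not_lt.2 this)

/-- Stepanov's method, before the choice of parameters. -/
lemma stepanov_raw {K : Type*} [Field K] [Fintype K] [DecidableEq K] {f₁ : K[X]} (hX : ¬ X ∣ f₁)
    {g d m M k : ℕ} (hQ : Fintype.card K = g * d + 1) (hd : 0 < d) (hg : 0 < g)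
    (hm : (X * f₁).natDegree = m) (hM : M ≤ Fintype.card K)
    (hcount : M * (g + M * m + k) < d * k * g) (a : K) :
    M * (Finset.univ.filter fun x : K => ((X * f₁).eval x) ^ g = a).card
      ≤ M * m + g + g * d * m + Fintype.card K * k := by
  set f : K[X] := X * f₁ with hfdef
  have hf1 : f₁ ≠ 0 := by rintro rfl; simp at hX
  have hf : f ≠ 0 := mul_ne_zero X_ne_zero hf1
  have hk : 0 < k := by
    rcases Nat.eq_zero_or_pos k with h | h
    · subst h; simp at hcount
    · exact h
  choose H hH using fun s l => exists_linearMap_hasseDeriv_pow_mul hf s l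
  let s : ℕ → ℕ := fun i => M + g * (i % d)
  let E := g + M * m + k
  let rr : (Fin (d * k) → Fin g → K) → ℕ → K[X] := fun v i =>
    if h : i < d * k then ((degreeLTEquiv K g).symm (v ⟨i, h⟩) : K[X]) else 0
  have hrdeg : ∀ v i, (rr v i).degree < g := by
    intro v i
    simp only [rr]
    split_ifs with h
    · exact mem_degreeLT.1 ((degreeLTEquiv K g).symm (v ⟨i, h⟩)).2
    · simp [bot_lt_iff_ne_bot]
  have hradd : ∀ v w i, rr (v + w) i = rr v i + rr w i := by
    intro v w i
    simp only [rr]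
    split_ifs with h
    · simp
    · simp
  have hrsmul : ∀ (c : K) v i, rr (c • v) i = c • rr v i := by
    intro c v i
    simp only [rr]
    split_ifs with h
    · simp
    · simp
  let G : ℕ → (Fin (d * k) → Fin g → K) → K[X] := fun l v =>
    ∑ i ∈ Finset.range (d * k), C (a ^ (i % d)) * X ^ (i / d) * H (s i) l (rr v i)
  have hGadd : ∀ l v w, G l (v + w) = G l v + G l w := by
    intro l v w
    simp only [G, hradd, map_add, mul_add, Finset.sum_add_distrib]
  have hGsmul : ∀ l (c : K) v, G l (c • v) = c • G l v := by
    intro l c v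
    simp only [G, hrsmul, map_smul, Finset.smul_sum, mul_smul_comm]
  let φ : (Fin (d * k) → Fin g → K) →ₗ[K] (Fin M → Fin E → K) :=
    { toFun := fun v l n => (G l v).coeff n
      map_add' := fun v w => by ext l n; simp [hGadd]
      map_smul' := fun c v => by ext l n; simp [hGsmul] }
  have hker : LinearMap.ker φ ≠ ⊥ := by
    apply LinearMap.ker_ne_bot_of_finrank_lt
    simpa [E, Module.finrank_pi_fintype] using hcount
  obtain ⟨v, hv, hv0⟩ := Submodule.exists_mem_ne_zero_of_ne_bot hker
  have hGdeg : ∀ l < M, (G l v).natDegree < E := by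
    intro l hl
    rw [Nat.lt_iff_le_pred (by positivity)]
    refine natDegree_sum_le_of_forall_le _ _ fun i hi => ?_
    have hi : i < d * k := Finset.mem_range.1 hi
    have h1 := natDegree_lt_of_hasseDeriv_pow_mul hf hg (hrdeg v i) (hH (s i) l (rr v i))
    have h2 : i / d < k := Nat.div_lt_of_lt_mul hi
    have h3 : l * f.natDegree ≤ M * m := by
      rw [hm]; exact Nat.mul_le_mul_right _ hl.le
    have h4 : (C (a ^ (i % d)) * X ^ (i / d) * H (s i) l (rr v i)).natDegree
        ≤ i / d + (H (s i) l (rr v i)).natDegree :=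
      natDegree_mul_le.trans (Nat.add_le_add_right (natDegree_C_mul_X_pow_le _ _) _)
    omega
  have hG0 : ∀ l < M, G l v = 0 := by
    intro l hl
    ext n
    by_cases hn : n < E
    · have := congrFun (congrFun (LinearMap.mem_ker.1 hv) ⟨l, hl⟩) ⟨n, hn⟩
      simpa [φ] using this
    · rw [coeff_eq_zero_of_natDegree_lt ((hGdeg l hl).trans_le (not_lt.1 hn)), coeff_zero]
  let R : K[X] := ∑ i ∈ Finset.range (d * k), f ^ s i * rr v i * X ^ (Fintype.card K * (i / d))
  have hRne : R ≠ 0 := by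
    have hex : ∃ i < d * k, rr v i ≠ 0 := by
      by_contra! hcon
      apply hv0
      ext i n
      have h1 := hcon i i.2
      simp only [rr, dif_pos i.2, Fin.eta] at h1
      have h2 : (degreeLTEquiv K g).symm (v i) = 0 := Subtype.ext h1
      rw [LinearEquiv.map_eq_zero_iff] at h2
      rw [h2]; rfl
    have h1 := sum_mul_pow_ne_zero hX (D := d * k) (rr v) (hrdeg v) (fun i => g * (i % d))
      (fun i => g * i + i / d) (fun i j hij => by
        have h1 : g * i + g ≤ g * j := by
          rw [← Nat.mul_succ]; exact Nat.mul_le_mul_left _ hij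
        have h2 : i / d ≤ j / d := Nat.div_le_div_right hij.le
        omega) hex
    have h2 : R = f ^ M * ∑ i ∈ Finset.range (d * k),
        rr v i * f₁ ^ (g * (i % d)) * X ^ (g * i + i / d) := by
      rw [Finset.mul_sum]
      refine Finset.sum_congr rfl fun i _ => ?_
      have h3 : g * i + i / d = g * (i % d) + Fintype.card K * (i / d) := by
        rw [hQ]
        conv_lhs => rw [← Nat.mod_add_div i d]
        rw [Nat.add_mul_div_left _ _ hd, Nat.div_eq_of_lt (Nat.mod_lt _ hd)]
        ring
      rw [h3]
      simp only [s, hfdef, mul_pow, pow_add]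
      ring
    rw [h2]
    exact mul_ne_zero (pow_ne_zero _ hf) h1
  have hRdvd : ∀ x : K, f.eval x ^ g = a → (X - C x) ^ M ∣ R := by
    intro x hx
    refine X_sub_C_pow_dvd_of_taylor_coeff R x M fun l hl => ?_
    have h1 : (taylor x R).coeff l = f.eval x ^ (M - l) * (G l v).eval x := by
      simp only [R, G, map_sum, finsetSum_coeff, eval_finsetSum, Finset.mul_sum]
      refine Finset.sum_congr rfl fun i _ => ?_
      rw [coeff_taylor_mul_X_pow_card _ _ _ _ (hl.trans_le hM), hH, show s i - l = (M - l) + g * (i % d) by simp only [s]; omega]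
      simp only [eval_mul, eval_pow, eval_C, eval_X, pow_add, pow_mul, hx]
      ring
    rw [h1, hG0 l hl]; simp
  have hprod : (∏ x ∈ Finset.univ.filter (fun x : K => f.eval x ^ g = a), (X - C x) ^ M) ∣ R := by
    refine Finset.prod_dvd_of_coprime ?_ fun x hx => hRdvd x (Finset.mem_filter.1 hx).2
    intro x _ y _ hxy
    exact (pairwise_coprime_X_sub_C Function.injective_id hxy).pow
  have hdeg := natDegree_le_of_dvd hprod hRne
  rw [natDegree_prod _ _ (fun x _ => pow_ne_zero _ (X_sub_C_ne_zero x))] at hdeg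
  simp only [natDegree_pow, natDegree_X_sub_C, mul_one, Finset.sum_const, smul_eq_mul] at hdeg
  rw [mul_comm]
  refine hdeg.trans (natDegree_sum_le_of_forall_le _ _ fun i hi => ?_)
  have hi : i < d * k := Finset.mem_range.1 hi
  have h2 : i / d ≤ k := (Nat.div_lt_of_lt_mul hi).le
  have h3 : i % d ≤ d := (Nat.mod_lt _ hd).le
  have h4 : (rr v i).natDegree ≤ g := natDegree_le_of_degree_le (hrdeg v i).le
  have h5 : s i * m ≤ M * m + g * d * m := by
    simp only [s]; rw [add_mul]
    gcongr
  refine natDegree_mul_le.trans ?_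
  rw [natDegree_X_pow]
  have h6 : (f ^ s i * rr v i).natDegree ≤ s i * m + g :=
    natDegree_mul_le.trans (by rw [natDegree_pow, hm]; omega)
  have h7 : Fintype.card K * (i / d) ≤ Fintype.card K * k := Nat.mul_le_mul_left _ h2
  omega

end Burgess

namespace Burgess
open Polynomial

lemma stepanov_bound {K : Type*} [Field K] [Fintype K] [DecidableEq K] {f₁ : K[X]}
    (hX : ¬ X ∣ f₁) {g d m : ℕ} (hQ : Fintype.card K = g * d + 1) (hd : 0 < d)
    (hm : (X * f₁).natDegree = m) (a : K) :
    ((Finset.univ.filter fun x : K => ((X * f₁).eval x) ^ g = a).card : ℝ)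
      ≤ (Fintype.card K : ℝ) / d + (5 * m + 8) * √(Fintype.card K) := by
  set Q := Fintype.card K with hQdef
  set S := Finset.univ.filter fun x : K => ((X * f₁).eval x) ^ g = a
  have hQ1 : 1 < Q := Fintype.one_lt_card
  have hg : 0 < g := by
    rcases Nat.eq_zero_or_pos g with h | h
    · subst h; omega
    · exact h
  have hs0 : 0 ≤ √(Q : ℝ) := Real.sqrt_nonneg _
  have hss : √(Q : ℝ) * √(Q : ℝ) = Q := Real.mul_self_sqrt (Nat.cast_nonneg _)
  have hdR : (0 : ℝ) < d := by exact_mod_cast hd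
  have hQd : (0 : ℝ) ≤ (Q : ℝ) / d := by positivity
  have hm0 : (0 : ℝ) ≤ m := Nat.cast_nonneg _
  set M := Nat.sqrt Q with hMdef
  have hMs : √(Q : ℝ) < M + 1 := by
    have := Real.nat_floor_real_sqrt_eq_nat_sqrt (a := Q)
    rw [hMdef, ← this]; exact Nat.lt_floor_add_one _
  have hMQ : M * M ≤ Q := Nat.sqrt_le Q
  by_cases hsmall : M < m + 5
  · have h1 : (S.card : ℝ) ≤ Q := by
      exact_mod_cast Finset.card_le_univ S
    have h2 : (M : ℝ) + 1 ≤ m + 5 := by exact_mod_cast hsmall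
    nlinarith
  push Not at hsmall
  set k := M / d + (m + 3) with hk
  have hk1 : M + 1 + d * (m + 2) ≤ d * k := by
    have := Nat.lt_mul_div_succ M hd
    rw [hk]
    nlinarith
  have hk2 : k ≤ M + (m + 3) := Nat.add_le_add_right (Nat.div_le_self _ _) _
  have hcount : M * (g + M * m + k) < d * k * g := by
    have h1 : (M + 1 + d * (m + 2)) * g ≤ d * k * g := Nat.mul_le_mul_right _ hk1
    have h2 : M * k ≤ M * M + M * (m + 3) := by rw [← mul_add]; exact Nat.mul_le_mul_left _ hk2
    have h3 : M * M * m ≤ Q * m := Nat.mul_le_mul_right _ hMQ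
    have h4 : M * (m + 5) ≤ M * M := Nat.mul_le_mul_left _ hsmall
    nlinarith
  have hMQ' : M ≤ Q := Nat.sqrt_le_self Q
  have hraw := stepanov_raw hX hQ hd hg hm hMQ' hcount a
  have hM0 : (0 : ℝ) < M := by
    have : 0 < M := by omega
    exact_mod_cast this
  have hM1 : (1 : ℝ) ≤ M := by exact_mod_cast (by omega : 1 ≤ M)
  have hrawR : (M : ℝ) * S.card ≤ M * m + g + g * d * m + Q * k := by exact_mod_cast hraw
  have hQR : (Q : ℝ) = g * d + 1 := by exact_mod_cast hQ
  have hkR : (k : ℝ) ≤ M / d + (m + 3) := by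
    rw [hk]; push_cast
    gcongr
    exact Nat.cast_div_le
  have hgQ : (g : ℝ) ≤ Q := by
    have h1 : (1 : ℝ) ≤ d := by exact_mod_cast hd
    have h2 : (0 : ℝ) ≤ g := Nat.cast_nonneg _
    rw [hQR]; nlinarith
  have h5 : (M : ℝ) * S.card ≤ M * (Q / d + m) + Q * (2 * m + 4) := by
    have h6 : (Q : ℝ) * k ≤ Q * (M / d + (m + 3)) := by gcongr
    have h7 : (g : ℝ) * d * m ≤ Q * m := by gcongr; linarith
    have h8 : (M : ℝ) * (Q / d) = Q * (M / d) := by ring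
    nlinarith
  have h6 : (Q : ℝ) ≤ M * (2 * √Q) := by nlinarith
  have h7 : (M : ℝ) * S.card ≤ M * (Q / d + m + (2 * √Q) * (2 * m + 4)) := by
    have : (Q : ℝ) * (2 * m + 4) ≤ M * (2 * √Q) * (2 * m + 4) := by gcongr
    nlinarith
  have h8 := le_of_mul_le_mul_left h7 hM0
  have h9 : 1 ≤ √(Q : ℝ) := by
    rw [Real.one_le_sqrt]; exact_mod_cast hQ1.le
  nlinarith

lemma card_filter_pow_eq {K : Type*} [Field K] [Fintype K] [DecidableEq K] {g d : ℕ}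
    (hQ : Fintype.card K = g * d + 1) (z : Kˣ) :
    (Finset.univ.filter fun y : Kˣ => z ^ g = y ^ g).card = g := by
  have h1 := IsCyclic.card_powMonoidHom_ker (G := Kˣ) g
  rw [Nat.card_eq_fintype_card, Nat.card_eq_fintype_card, Fintype.card_units, hQ,
    Nat.add_sub_cancel, Nat.gcd_mul_right_left] at h1
  rw [Fintype.card_subtype] at h1
  refine Eq.trans ?_ h1
  refine Finset.card_bij' (fun y _ => y * z⁻¹) (fun y _ => y * z) ?_ ?_ ?_ ?_
  · intro y hy
    simp only [Finset.mem_filter, Finset.mem_univ, true_and] at hy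
    simp [MonoidHom.mem_ker, mul_pow, ← hy]
  · intro y hy
    simp only [Finset.mem_filter, Finset.mem_univ, true_and, MonoidHom.mem_ker,
      powMonoidHom_apply] at hy
    simp [mul_pow, hy]
  · simp
  · simp

lemma mulChar_eq_of_pow_eq {K : Type*} [Field K] [Fintype K] {g d : ℕ}
    (hQ : Fintype.card K = g * d + 1) (hg : 0 < g) {θ : MulChar K ℂ} (hθ : θ ^ d = 1) {y z : Kˣ}
    (h : z ^ g = y ^ g) : θ (z : K) = θ (y : K) := by
  classical
  obtain ⟨ζ, hζ⟩ := IsCyclic.exists_generator (α := Kˣ)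
  obtain ⟨i, hi⟩ := Subgroup.mem_zpowers_iff.1 (hζ (z * y⁻¹))
  have h1 : ζ ^ (i * g) = 1 := by
    rw [zpow_mul, hi, zpow_natCast, mul_pow, h, inv_pow, mul_inv_cancel]
  have h2 : (orderOf ζ : ℤ) = g * d := by
    rw [orderOf_eq_card_of_forall_mem_zpowers hζ, Nat.card_eq_fintype_card, Fintype.card_units, hQ]
    simp
  have h3 := orderOf_dvd_iff_zpow_eq_one.2 h1
  rw [h2, mul_comm i] at h3
  obtain ⟨j, rfl⟩ := Int.dvd_of_mul_dvd_mul_left (by exact_mod_cast hg.ne') h3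
  have h4 : z = y * (ζ ^ j) ^ d := by
    rw [← zpow_natCast, ← zpow_mul, mul_comm j, hi, mul_comm, inv_mul_cancel_right]
  have h5 : θ (((ζ ^ j : Kˣ) : K)) ^ d = 1 := by
    rw [← MulChar.pow_apply_coe, hθ, MulChar.one_apply_coe]
  rw [h4, Units.val_mul, map_mul, Units.val_pow_eq_pow_val, map_pow, h5, mul_one]

lemma norm_mulChar_le_one {R : Type*} [CommRing R] [Finite R] (χ : MulChar R ℂ) (x : R) :
    ‖χ x‖ ≤ 1 := by
  by_cases hx : IsUnit x
  · obtain ⟨u, rfl⟩ := hx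
    obtain ⟨n, hn, h⟩ := (isOfFinOrder_of_finite u).exists_pow_eq_one
    have h2 : ‖χ (u : R)‖ ^ n = 1 := by
      rw [← norm_pow, ← map_pow, ← Units.val_pow_eq_pow_val, h]
      simp
    exact ((pow_eq_one_iff_of_nonneg (norm_nonneg _) hn.ne').1 h2).le
  · rw [MulChar.map_nonunit _ hx]; simp

/-- A bound of the right order of magnitude in the size of the field, for a fixed order `d` of the
character. -/
lemma norm_sum_mulChar_eval_le {K : Type*} [Field K] [Fintype K] {f₁ : K[X]}
    (hX : ¬ X ∣ f₁) {g d m : ℕ} (hQ : Fintype.card K = g * d + 1) (hd : 0 < d)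
    (hm : (X * f₁).natDegree = m) {θ : MulChar K ℂ} (hθ : θ ^ d = 1) (hθ1 : θ ≠ 1) :
    ‖∑ x : K, θ ((X * f₁).eval x)‖ ≤ (d * (5 * m + 8) + m) * √(Fintype.card K) := by
  classical
  set Q := Fintype.card K with hQdef
  set f := X * f₁
  have hf : f ≠ 0 := by
    refine mul_ne_zero X_ne_zero ?_
    rintro rfl; simp at hX
  have hQ1 : 1 < Q := Fintype.one_lt_card
  have hg : 0 < g := by
    rcases Nat.eq_zero_or_pos g with h | h
    · subst h; omega
    · exact h
  set B : ℝ := (Q : ℝ) / d + (5 * m + 8) * √Q with hB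
  let N : Kˣ → ℕ := fun y => (Finset.univ.filter fun x : K => f.eval x ^ g = (y : K) ^ g).card
  have hN : ∀ y, (N y : ℝ) ≤ B := fun y => stepanov_bound hX hQ hd hm _
  -- the number of zeros is small
  have hcount : ∀ x : K, (Finset.univ.filter fun y : Kˣ => f.eval x ^ g = (y : K) ^ g).card
      = if f.eval x = 0 then 0 else g := by
    intro x
    split_ifs with h
    · rw [Finset.card_eq_zero, Finset.filter_eq_empty_iff]
      intro y _ hy
      rw [h, zero_pow hg.ne'] at hy
      exact pow_ne_zero _ y.ne_zero hy.symm
    · refine Eq.trans ?_ (card_filter_pow_eq hQ (Units.mk0 _ h))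
      congr 1
      ext y
      simp [Units.ext_iff]
  have hsum : ∑ y : Kˣ, θ (y : K) * (N y : ℂ) = g * ∑ x : K, θ (f.eval x) := by
    simp only [N, Finset.card_filter, Nat.cast_sum, Finset.mul_sum]
    rw [Finset.sum_comm]
    refine Finset.sum_congr rfl fun x _ => ?_
    simp only [Nat.cast_ite, Nat.cast_one, Nat.cast_zero, mul_ite, mul_one, mul_zero]
    rw [← Finset.sum_filter]
    by_cases h : f.eval x = 0
    · have h1 := hcount x
      rw [if_pos h, Finset.card_eq_zero] at h1
      rw [h1, h, MulChar.map_zero]; simp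
    · rw [Finset.sum_congr rfl (g := fun _ => θ (f.eval x)), Finset.sum_const, hcount, if_neg h,
        nsmul_eq_mul]
      intro y hy
      refine (mulChar_eq_of_pow_eq (z := Units.mk0 _ h) hQ hg hθ ?_).symm
      simpa [Units.ext_iff] using hy
  have hθsum : ∑ y : Kˣ, θ (y : K) = 0 := by
    have h1 := MulChar.sum_eq_zero_of_ne_one hθ1
    rw [← h1]
    refine Finset.sum_of_injOn (fun y : Kˣ => (y : K)) (fun _ _ _ _ h => Units.ext h)
      (by simp) ?_ (by simp)
    intro x _ hx
    refine MulChar.map_nonunit _ fun hu => hx ?_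
    obtain ⟨u, rfl⟩ := hu
    exact ⟨u, by simp⟩
  have hNsum : (g : ℝ) * (Q - m) ≤ ∑ y : Kˣ, (N y : ℝ) := by
    have h1 : ∑ y : Kˣ, N y = ∑ x : K, if f.eval x = 0 then 0 else g := by
      simp only [N, ← hcount, Finset.card_filter]
      exact Finset.sum_comm
    have h2 : (Finset.univ.filter fun x : K => f.eval x = 0).card ≤ m := by
      rw [← hm]
      refine le_trans ?_ ((Multiset.toFinset_card_le f.roots).trans (card_roots' f))
      refine Finset.card_le_card fun x hx => ?_
      simp only [Finset.mem_filter, Finset.mem_univ, true_and] at hx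
      simp [hf, hx]
    have h3 : (Finset.univ.filter fun x : K => f.eval x = 0).card
        + (Finset.univ.filter fun x : K => ¬ f.eval x = 0).card = Q :=
      Finset.card_filter_add_card_filter_not _
    rw [← Nat.cast_sum, h1, Finset.sum_ite, Finset.sum_const_zero, zero_add, Finset.sum_const,
      smul_eq_mul, Nat.cast_mul, mul_comm]
    gcongr
    rw [sub_le_iff_le_add]
    exact_mod_cast (by omega)
  have hmain : (g : ℂ) * ∑ x : K, θ (f.eval x) = - ∑ y : Kˣ, θ (y : K) * ((B - N y : ℝ) : ℂ) := by
    push_cast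
    simp only [mul_sub, Finset.sum_sub_distrib, hsum, ← Finset.sum_mul, hθsum]
    simp
  have hle : (g : ℝ) * ‖∑ x : K, θ (f.eval x)‖ ≤ ∑ y : Kˣ, (B - N y) := by
    have := congrArg norm hmain
    rw [norm_mul, norm_neg, Complex.norm_natCast] at this
    rw [this]
    refine (norm_sum_le _ _).trans (Finset.sum_le_sum fun y _ => ?_)
    rw [norm_mul, Complex.norm_real, Real.norm_of_nonneg (sub_nonneg.2 (hN y))]
    exact mul_le_of_le_one_left (sub_nonneg.2 (hN y)) (norm_mulChar_le_one θ _)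
  have hunits : ((Fintype.card Kˣ : ℕ) : ℝ) = g * d := by
    rw [Fintype.card_units, ← hQdef, hQ]; simp
  rw [Finset.sum_sub_distrib, Finset.sum_const, Finset.card_univ, nsmul_eq_mul, hunits] at hle
  have hgR : (0 : ℝ) < g := by exact_mod_cast hg
  have hdR : (0 : ℝ) < d := by exact_mod_cast hd
  have h5 : (g : ℝ) * ‖∑ x : K, θ (f.eval x)‖ ≤ g * (d * ((5 * m + 8) * √Q) + m) := by
    have : (g : ℝ) * d * B = g * (Q + d * ((5 * m + 8) * √Q)) := by
      rw [hB]; field_simp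
    rw [this] at hle
    nlinarith
  have h6 := le_of_mul_le_mul_left h5 hgR
  have h9 : 1 ≤ √(Q : ℝ) := by
    rw [Real.one_le_sqrt]; exact_mod_cast hQ1.le
  have hm0 : (0 : ℝ) ≤ m := Nat.cast_nonneg _
  nlinarith

end Burgess

namespace Burgess
open Polynomial

section
variable (F : Type*) [Field F] [Fintype F]

lemma finite_monic_natDegree_le (n : ℕ) : {g : F[X] | g.Monic ∧ g.natDegree ≤ n}.Finite := by
  have : Finite (degreeLT F (n + 1)) := Finite.of_equiv _ (degreeLTEquiv F (n + 1)).symm.toEquiv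
  refine (Set.finite_range (fun p : degreeLT F (n + 1) => (p : F[X]))).subset ?_
  rintro g ⟨_, hg⟩
  refine ⟨⟨g, mem_degreeLT.2 ?_⟩, rfl⟩
  exact degree_le_natDegree.trans_lt (by exact_mod_cast Nat.lt_succ_of_le hg)

lemma finite_monics (n : ℕ) : {g : F[X] | g.Monic ∧ g.natDegree = n}.Finite :=
  (finite_monic_natDegree_le F n).subset fun _ h => And.intro h.1 h.2.le

lemma finite_primesUpTo (n : ℕ) :
    {g : F[X] | g.Monic ∧ Irreducible g ∧ g.natDegree ≤ n}.Finite :=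
  (finite_monic_natDegree_le F n).subset fun _ h => And.intro h.1 h.2.2

/-- The monic polynomials of degree `n`. -/
noncomputable def monics (n : ℕ) : Finset F[X] := (finite_monics F n).toFinset

/-- The monic irreducible polynomials of degree at most `n`. -/
noncomputable def primesUpTo (n : ℕ) : Finset F[X] := (finite_primesUpTo F n).toFinset

variable {F}

lemma mem_monics {n : ℕ} {g : F[X]} : g ∈ monics F n ↔ g.Monic ∧ g.natDegree = n := by
  simp [monics]

lemma mem_primesUpTo {n : ℕ} {g : F[X]} :
    g ∈ primesUpTo F n ↔ g.Monic ∧ Irreducible g ∧ g.natDegree ≤ n := by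
  simp [primesUpTo]

open scoped Classical in
lemma natDegree_eq_sum_primesUpTo {g : F[X]} (hg : g.Monic) {n : ℕ}
    (hn : g.natDegree = n) :
    n = ∑ P ∈ primesUpTo F n, P.natDegree *
      ((Finset.Icc 1 n).filter fun k => P ^ k ∣ g).card := by
  have hg0 : g ≠ 0 := hg.ne_zero
  have hcount : ∀ P ∈ primesUpTo F n, ((Finset.Icc 1 n).filter fun k => P ^ k ∣ g).card
      = (UniqueFactorizationMonoid.normalizedFactors g).count P := by
    intro P hP
    obtain ⟨hPm, hPi, -⟩ := mem_primesUpTo.1 hP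
    have h1 := UniqueFactorizationMonoid.emultiplicity_eq_count_normalizedFactors hPi hg0
    rw [hPm.normalize_eq_self] at h1
    set t := (UniqueFactorizationMonoid.normalizedFactors g).count P
    have h2 : ∀ k, P ^ k ∣ g ↔ k ≤ t := fun k => by
      rw [pow_dvd_iff_le_emultiplicity, h1]; exact Nat.cast_le
    have h3 : t ≤ n := by
      have h4 := natDegree_le_of_dvd ((h2 t).2 le_rfl) hg0
      rw [natDegree_pow, hn] at h4
      have := hPi.natDegree_pos
      nlinarith
    have h5 : (Finset.Icc 1 n).filter (fun k => P ^ k ∣ g) = Finset.Icc 1 t := by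
      ext k
      simp only [Finset.mem_filter, Finset.mem_Icc, h2]
      omega
    rw [h5]; simp
  rw [Finset.sum_congr rfl fun P hP => by rw [hcount P hP]]
  have h1 : (UniqueFactorizationMonoid.normalizedFactors g).prod = g := by
    rw [UniqueFactorizationMonoid.prod_normalizedFactors_eq hg0, hg.normalize_eq_self]
  have h2 : ((UniqueFactorizationMonoid.normalizedFactors g).map natDegree).sum = n := by
    rw [← hn, ← natDegree_multiset_prod _ (UniqueFactorizationMonoid.zero_notMem_normalizedFactors g), h1]
  conv_lhs => rw [← h2, Finset.sum_multiset_map_count]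
  simp only [smul_eq_mul, mul_comm]
  refine Finset.sum_subset ?_ ?_
  · intro P hP
    rw [Multiset.mem_toFinset] at hP
    have hi := UniqueFactorizationMonoid.irreducible_of_normalized_factor P hP
    refine mem_primesUpTo.2 ⟨?_, hi, ?_⟩
    · rw [← UniqueFactorizationMonoid.normalize_normalized_factor P hP]
      exact monic_normalize hi.ne_zero
    · rw [← hn]
      exact natDegree_le_of_dvd (UniqueFactorizationMonoid.dvd_of_mem_normalizedFactors hP) hg0
  · intro P _ hP
    rw [Multiset.mem_toFinset] at hP
    rw [Multiset.count_eq_zero_of_notMem hP, mul_zero]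

/-- Coefficients of the `L`-function of a completely multiplicative function. -/
noncomputable def lcoeff (X : F[X] →* ℂ) (n : ℕ) : ℂ := ∑ g ∈ monics F n, X g

/-- Power sums attached to the `L`-function of a completely multiplicative function. -/
noncomputable def lpow (X : F[X] →* ℂ) (j : ℕ) : ℂ :=
  ∑ P ∈ (primesUpTo F j).filter (fun P => P.natDegree ∣ j),
    (P.natDegree : ℂ) * X P ^ (j / P.natDegree)

lemma sum_monics_dvd (X : F[X] →* ℂ) {Q : F[X]} (hQ : Q.Monic) [DecidablePred fun g => Q ∣ g]
    (n : ℕ) : ∑ g ∈ (monics F n).filter (fun g => Q ∣ g), X g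
      = if Q.natDegree ≤ n then X Q * lcoeff X (n - Q.natDegree) else 0 := by
  split_ifs with h
  · rw [lcoeff, Finset.mul_sum]
    symm
    refine Finset.sum_bij (fun g _ => Q * g) ?_ ?_ ?_ ?_
    · intro g hg
      obtain ⟨h1, h2⟩ := mem_monics.1 hg
      refine Finset.mem_filter.2 ⟨mem_monics.2 ⟨hQ.mul h1, ?_⟩, Dvd.intro _ rfl⟩
      rw [hQ.natDegree_mul h1]; omega
    · intro g _ g' _ h
      exact mul_left_cancel₀ hQ.ne_zero h
    · intro g hg
      obtain ⟨hg, g', rfl⟩ := Finset.mem_filter.1 hg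
      obtain ⟨h1, h2⟩ := mem_monics.1 hg
      have h3 : g'.Monic := hQ.of_mul_monic_left h1
      rw [hQ.natDegree_mul h3] at h2
      exact ⟨g', mem_monics.2 ⟨h3, by omega⟩, rfl⟩
    · intro g _; rw [map_mul]
  · refine Finset.sum_eq_zero fun g hg => absurd ?_ h
    obtain ⟨hg, hd⟩ := Finset.mem_filter.1 hg
    obtain ⟨h1, h2⟩ := mem_monics.1 hg
    rw [← h2]; exact natDegree_le_of_dvd hd h1.ne_zero

/-- Newton's identities, from the Euler product. -/
lemma nat_mul_lcoeff (X : F[X] →* ℂ) (n : ℕ) :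
    (n : ℂ) * lcoeff X n = ∑ j ∈ Finset.Icc 1 n, lpow X j * lcoeff X (n - j) := by
  classical
  have h1 : (n : ℂ) * lcoeff X n = ∑ P ∈ primesUpTo F n, ∑ k ∈ Finset.Icc 1 n,
      (P.natDegree : ℂ) * ∑ g ∈ (monics F n).filter (fun g => P ^ k ∣ g), X g := by
    rw [lcoeff, Finset.mul_sum]
    have : ∀ g ∈ monics F n, (n : ℂ) * X g = ∑ P ∈ primesUpTo F n, ∑ k ∈ Finset.Icc 1 n,
        (P.natDegree : ℂ) * (if P ^ k ∣ g then X g else 0) := by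
      intro g hg
      obtain ⟨hg1, hg2⟩ := mem_monics.1 hg
      have h2 := natDegree_eq_sum_primesUpTo hg1 hg2
      conv_lhs => rw [h2]
      push_cast
      rw [Finset.sum_mul]
      refine Finset.sum_congr rfl fun P _ => ?_
      rw [← Finset.mul_sum, ← Finset.sum_filter, Finset.sum_const, nsmul_eq_mul, mul_assoc]
    rw [Finset.sum_congr rfl this, Finset.sum_comm]
    refine Finset.sum_congr rfl fun P _ => ?_
    rw [Finset.sum_comm]
    refine Finset.sum_congr rfl fun k _ => ?_
    rw [← Finset.mul_sum, ← Finset.sum_filter]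
  have h2 : ∑ j ∈ Finset.Icc 1 n, lpow X j * lcoeff X (n - j)
      = ∑ P ∈ primesUpTo F n, ∑ j ∈ (Finset.Icc 1 n).filter (fun j => P.natDegree ∣ j),
        (P.natDegree : ℂ) * (X P ^ (j / P.natDegree) * lcoeff X (n - j)) := by
    simp only [Finset.sum_filter]
    rw [Finset.sum_comm]
    refine Finset.sum_congr rfl fun j hj => ?_
    rw [← Finset.sum_filter, lpow, Finset.sum_mul]
    have hset : (primesUpTo F n).filter (fun P => P.natDegree ∣ j)
        = (primesUpTo F j).filter (fun P => P.natDegree ∣ j) := by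
      ext P
      simp only [Finset.mem_filter, mem_primesUpTo, Finset.mem_Icc] at hj ⊢
      constructor
      · rintro ⟨⟨h1, h2, _⟩, h4⟩
        exact ⟨⟨h1, h2, Nat.le_of_dvd (by omega) h4⟩, h4⟩
      · rintro ⟨⟨h1, h2, h3⟩, h4⟩
        exact ⟨⟨h1, h2, by omega⟩, h4⟩
    rw [hset]
    exact Finset.sum_congr rfl fun P _ => by ring
  rw [h1, h2]
  refine Finset.sum_congr rfl fun P hP => ?_
  obtain ⟨hPm, hPi, -⟩ := mem_primesUpTo.1 hP
  have he : 0 < P.natDegree := hPi.natDegree_pos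
  rw [← Finset.sum_filter_add_sum_filter_not (Finset.Icc 1 n) (fun k => k * P.natDegree ≤ n)]
  have hz : ∑ k ∈ (Finset.Icc 1 n).filter (fun k => ¬ k * P.natDegree ≤ n),
      (P.natDegree : ℂ) * ∑ g ∈ (monics F n).filter (fun g => P ^ k ∣ g), X g = 0 := by
    refine Finset.sum_eq_zero fun k hk => ?_
    rw [sum_monics_dvd X (hPm.pow k), if_neg, mul_zero]
    rw [natDegree_pow]; exact (Finset.mem_filter.1 hk).2
  rw [hz, add_zero]
  refine Finset.sum_bij' (fun k _ => k * P.natDegree) (fun j _ => j / P.natDegree) ?_ ?_ ?_ ?_ ?_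
  · intro k hk
    simp only [Finset.mem_filter, Finset.mem_Icc] at hk ⊢
    exact ⟨⟨by nlinarith, hk.2⟩, Dvd.intro_left _ rfl⟩
  · intro j hj
    simp only [Finset.mem_filter, Finset.mem_Icc] at hj ⊢
    rw [Nat.div_mul_cancel hj.2]
    refine ⟨⟨Nat.div_pos (Nat.le_of_dvd (by omega) hj.2) he, ?_⟩, hj.1.2⟩
    exact (Nat.div_le_self _ _).trans hj.1.2
  · intro k _; exact Nat.mul_div_cancel _ he
  · intro j hj; exact Nat.div_mul_cancel (Finset.mem_filter.1 hj).2
  · intro k hk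
    rw [sum_monics_dvd X (hPm.pow k), natDegree_pow, if_pos (Finset.mem_filter.1 hk).2,
      Nat.mul_div_cancel _ he, map_pow]

lemma card_filter_minpoly {K : Type*} [Field K] [Fintype K] [DecidableEq F[X]] [Algebra F K] {P : F[X]}
    (hP : P.Monic) (hPi : Irreducible P) (hd : P.natDegree ∣ Module.finrank F K) :
    (Finset.univ.filter fun x : K => minpoly F x = P).card = P.natDegree := by
  classical
  have h1 := hPi.natDegree_dvd_iff_dvd_X_pow_card_pow_sub_X.1 hd
  have h2 : (P.map (algebraMap F K)).Splits := by
    have h3 := map_dvd (mapRingHom (algebraMap F K)) h1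
    rw [coe_mapRingHom, ← Module.natCard_eq_pow_finrank] at h3
    have h4 : ((X ^ Nat.card K - X : F[X]).map (algebraMap F K)) = X ^ Fintype.card K - X := by
      simp
    rw [h4] at h3
    refine Splits.of_dvd ?_ (FiniteField.X_pow_card_sub_X_ne_zero K Fintype.one_lt_card) h3
    have h5 := Polynomial.splits_X_pow_nat_card_sub_X (K := K)
    rwa [Nat.card_eq_fintype_card] at h5
  have h3 := card_rootSet_eq_natDegree (K := K) (PerfectField.separable_of_irreducible hPi) h2
  rw [← h3, ← Set.toFinset_card]
  congr 1
  ext x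
  simp only [Finset.mem_filter, Finset.mem_univ, true_and, Set.mem_toFinset, mem_rootSet]
  constructor
  · rintro rfl
    exact ⟨hPi.ne_zero, minpoly.aeval _ _⟩
  · rintro ⟨_, h⟩
    exact (minpoly.eq_of_irreducible_of_monic hPi h hP).symm

lemma lpow_finrank (X : F[X] →* ℂ) {K : Type*} [Field K] [Fintype K] [Algebra F K] :
    lpow X (Module.finrank F K)
      = ∑ x : K, X (minpoly F x) ^ (Module.finrank F K / (minpoly F x).natDegree) := by
  classical
  have hfin : Module.finrank F K ≠ 0 := Module.finrank_pos.ne'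
  have hmem : ∀ x ∈ (Finset.univ : Finset K), minpoly F x ∈
      (primesUpTo F (Module.finrank F K)).filter
        (fun P => P.natDegree ∣ Module.finrank F K) := by
    intro x _
    have hx : IsIntegral F x := .of_finite F x
    have hd := minpoly.degree_dvd (K := F) hx
    exact Finset.mem_filter.2 ⟨mem_primesUpTo.2 ⟨minpoly.monic hx, minpoly.irreducible hx,
      Nat.le_of_dvd (Nat.pos_of_ne_zero hfin) hd⟩, hd⟩
  rw [← Finset.sum_fiberwise_of_maps_to hmem, lpow]
  refine Finset.sum_congr rfl fun P hP => ?_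
  rw [Finset.mem_filter, mem_primesUpTo] at hP
  rw [Finset.sum_congr rfl (g := fun _ => X P ^ (Module.finrank F K / P.natDegree)),
    Finset.sum_const, card_filter_minpoly hP.1.1 hP.1.2.1 hP.2, nsmul_eq_mul]
  intro x hx
  rw [(Finset.mem_filter.1 hx).2]

end

lemma norm_algebraMap_sub {F K : Type*} [Field F] [Field K] [Finite K] [Algebra F K] (a : F) (x : K) :
    Algebra.norm F (algebraMap F K a - x)
      = (minpoly F x).eval a ^ (Module.finrank F K / (minpoly F x).natDegree) := by
  have hx : IsIntegral F x := .of_finite F x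
  set E := IntermediateField.adjoin F {x}
  set pb := IntermediateField.adjoin.powerBasis hx
  have h0 : algebraMap F K a - x = algebraMap E K (algebraMap F E a - pb.gen) := by
    rw [map_sub, ← IsScalarTower.algebraMap_apply]
    congr 1
  have h1 : Module.finrank F K / (minpoly F x).natDegree = Module.finrank E K := by
    rw [← Module.finrank_mul_finrank F E K, IntermediateField.adjoin.finrank hx]
    exact Nat.mul_div_cancel_left _ (minpoly.natDegree_pos hx)
  rw [h1, h0, ← Algebra.norm_norm (R := F) (S := E), Algebra.norm_algebraMap, map_pow]
  congr 1
  rw [Algebra.norm_eq_matrix_det pb.basis, map_sub, AlgHom.commutes]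
  have h2 := charpoly_leftMulMatrix pb
  have h3 : minpoly F pb.gen = minpoly F x := by
    simp [pb, IntermediateField.adjoin.powerBasis_gen, IntermediateField.minpoly_gen]
  rw [← h3, ← h2, Matrix.eval_charpoly, Matrix.algebraMap_eq_diagonal]
  rfl

end Burgess

namespace Burgess
open Polynomial Filter Topology

/-- A power series quotient `T L' / L` with geometrically bounded coefficients forces the zeros
of the polynomial `L` to be large. -/
lemma inv_le_norm_of_root {L : ℂ[X]} {S : ℕ → ℂ} {C R : ℝ} (hR : 0 < R)
    (hS : ∀ n, ‖S n‖ ≤ C * R ^ n) (hL : L.eval 0 = 1)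
    (hrec : ∀ n : ℕ, (n : ℂ) * L.coeff n
      = ∑ ij ∈ Finset.HasAntidiagonal.antidiagonal n, S ij.1 * L.coeff ij.2) {z : ℂ} (hz : L.IsRoot z) :
    R⁻¹ ≤ ‖z‖ := by
  by_contra! hlt
  have hL0 : L ≠ 0 := by rintro rfl; simp at hL
  have hz0 : z ≠ 0 := by rintro rfl; rw [IsRoot.def, hL] at hz; exact one_ne_zero hz
  have hC : 0 ≤ C := by simpa using (norm_nonneg _).trans (hS 0)
  have hsum : ∀ t : ℂ, ‖t‖ < R⁻¹ → Summable fun n => ‖S n * t ^ n‖ := by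
    intro t ht
    have h1 : R * ‖t‖ < 1 := by
      have := mul_lt_mul_of_pos_left ht hR
      rwa [mul_inv_cancel₀ hR.ne'] at this
    refine Summable.of_nonneg_of_le (fun _ => norm_nonneg _) (fun n => ?_)
      ((summable_geometric_of_lt_one (by positivity) h1).mul_left C)
    rw [norm_mul, norm_pow, mul_pow, ← mul_assoc]
    exact mul_le_mul_of_nonneg_right (hS n) (by positivity)
  have hbd : ∀ t : ℂ, ‖t‖ ≤ ‖z‖ → ‖∑' n, S n * t ^ n‖ ≤ C * (1 - R * ‖z‖)⁻¹ := by
    intro t ht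
    have h1 : R * ‖z‖ < 1 := by
      have := mul_lt_mul_of_pos_left hlt hR
      rwa [mul_inv_cancel₀ hR.ne'] at this
    have h2 := (hasSum_geometric_of_lt_one (by positivity) h1).mul_left C
    refine tsum_of_norm_bounded h2 fun n => ?_
    rw [norm_mul, norm_pow, mul_pow, ← mul_assoc]
    gcongr
    exact hS n
  have hfun : ∀ t : ℂ, ‖t‖ < R⁻¹ →
      t * L.derivative.eval t = (∑' n, S n * t ^ n) * L.eval t := by
    intro t ht
    have hsL : ∀ a : ℕ → ℂ, (∀ n, L.natDegree < n → a n = 0) →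
        HasSum a (∑ n ∈ Finset.range (L.natDegree + 1), a n) := fun a ha =>
      hasSum_sum_of_ne_finset_zero fun n hn => ha n (by simpa using hn)
    have hL1 : HasSum (fun n => L.coeff n * t ^ n) (L.eval t) := by
      rw [eval_eq_sum_range]
      exact hsL _ fun n hn => by rw [coeff_eq_zero_of_natDegree_lt hn, zero_mul]
    have hL2 : HasSum (fun n : ℕ => (n : ℂ) * L.coeff n * t ^ n) (t * L.derivative.eval t) := by
      have : t * L.derivative.eval t
          = ∑ n ∈ Finset.range (L.natDegree + 1), (n : ℂ) * L.coeff n * t ^ n := by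
        rw [derivative_eval, sum_over_range' L _ (L.natDegree + 1) (Nat.lt_succ_self _),
          Finset.mul_sum]
        · refine Finset.sum_congr rfl fun n _ => ?_
          rcases n with _ | n
          · simp
          · rw [pow_succ]; push_cast; ring
        · intro n; simp
      rw [this]
      exact hsL _ fun n hn => by rw [coeff_eq_zero_of_natDegree_lt hn]; ring
    have h3 : Summable fun n => ‖L.coeff n * t ^ n‖ :=
      summable_of_ne_finset_zero (s := Finset.range (L.natDegree + 1)) fun n hn => by
        rw [coeff_eq_zero_of_natDegree_lt (by simpa using hn), zero_mul, norm_zero]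
    rw [← hL1.tsum_eq, tsum_mul_tsum_eq_tsum_sum_antidiagonal_of_summable_norm (hsum t ht) h3,
      ← hL2.tsum_eq]
    refine tsum_congr fun n => ?_
    rw [hrec, Finset.sum_mul]
    refine Finset.sum_congr rfl fun ij h => ?_
    rw [← Finset.HasAntidiagonal.mem_antidiagonal.1 h, pow_add]; ring
  obtain ⟨G, hG, hGz⟩ := exists_eq_pow_rootMultiplicity_mul_and_not_dvd L hL0 z
  set m := L.rootMultiplicity z
  have hm : 0 < m := (rootMultiplicity_pos hL0).2 hz
  obtain ⟨k, hk⟩ : ∃ k, m = k + 1 := ⟨m - 1, by omega⟩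
  have hGz' : G.eval z ≠ 0 := fun h => hGz (dvd_iff_isRoot.2 h)
  have hkey : ∀ t : ℂ, ‖t‖ < R⁻¹ → t ≠ z →
      t * (m * G.eval t + (t - z) * G.derivative.eval t)
        = (t - z) * G.eval t * ∑' n, S n * t ^ n := by
    intro t ht htz
    have h1 := hfun t ht
    have h2 : (t - z) ^ k ≠ 0 := pow_ne_zero _ (sub_ne_zero.2 htz)
    refine mul_left_cancel₀ h2 ?_
    rw [hG, hk] at h1
    simp only [derivative_mul, derivative_X_sub_C_pow, eval_add, eval_mul, eval_pow, eval_sub,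
      eval_X, eval_C, Nat.add_sub_cancel] at h1
    rw [hk]
    linear_combination h1
  set u : ℕ → ℂ := fun n => (1 - 1 / ((n : ℂ) + 1)) * z
  have hu : Tendsto u atTop (𝓝 z) := by
    have := (tendsto_one_div_add_atTop_nhds_zero_nat (𝕜 := ℂ)).const_sub 1 |>.mul_const z
    simpa [u] using this
  have hun : ∀ n, ‖u n‖ ≤ ‖z‖ := by
    intro n
    rw [norm_mul]
    have h1 : (1 - 1 / ((n : ℂ) + 1)) = ((1 - 1 / ((n : ℝ) + 1) : ℝ) : ℂ) := by push_cast; rfl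
    have h2 : 1 / ((n : ℝ) + 1) ≤ 1 := by
      rw [div_le_one (by positivity)]; linarith [n.cast_nonneg (α := ℝ)]
    have h3 : 0 ≤ 1 / ((n : ℝ) + 1) := by positivity
    rw [h1, Complex.norm_real, Real.norm_eq_abs, abs_of_nonneg (by linarith)]
    nlinarith [norm_nonneg z]
  have hne : ∀ n, u n ≠ z := by
    intro n h
    have h1 : (1 / ((n : ℂ) + 1)) * z = 0 := by linear_combination -h
    rcases mul_eq_zero.1 h1 with h | h
    · exact Nat.cast_add_one_ne_zero n (by simpa using h)
    · exact hz0 h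
  have hlim1 : Tendsto (fun n => u n * (m * G.eval (u n) + (u n - z) * G.derivative.eval (u n)))
      atTop (𝓝 (z * (m * G.eval z + (z - z) * G.derivative.eval z))) := by
    have hc : Continuous fun t : ℂ => t * (m * G.eval t + (t - z) * G.derivative.eval t) := by
      fun_prop
    exact (hc.tendsto z).comp hu
  have hlim2 : Tendsto (fun n => (u n - z) * G.eval (u n) * ∑' k, S k * u n ^ k)
      atTop (𝓝 0) := by
    have hc : Continuous fun t : ℂ => (t - z) * G.eval t := by fun_prop
    have h1 := (hc.tendsto z).comp hu
    simp only [sub_self, zero_mul] at h1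
    exact h1.zero_mul_isBoundedUnder_le
      ⟨C * (1 - R * ‖z‖)⁻¹, by
        rw [eventually_map]; exact Eventually.of_forall fun n => hbd _ (hun n)⟩
  have hlim3 := hlim2.congr fun n => (hkey (u n) ((hun n).trans_lt hlt) (hne n)).symm
  have := tendsto_nhds_unique hlim1 hlim3
  simp only [sub_self, zero_mul, add_zero, mul_eq_zero, hz0, Nat.cast_eq_zero, hm.ne', hGz',
    or_self] at this

/-- The Riemann hypothesis in terms of power sums, from Newton's identities. -/
lemma norm_powerSum_one_le {c S : ℕ → ℂ} {k : ℕ} {D R : ℝ} (hR : 0 < R) (hc0 : c 0 = 1)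
    (hc : ∀ n, k < n → c n = 0)
    (hrec : ∀ n : ℕ, (n : ℂ) * c n = ∑ j ∈ Finset.Icc 1 n, S j * c (n - j))
    (hS : ∀ n, 0 < n → ‖S n‖ ≤ D * R ^ n) : ‖S 1‖ ≤ k * R := by
  set L : ℂ[X] := ∑ i ∈ Finset.range (k + 1), C (c i) * X ^ i
  have hcoeff : ∀ n, L.coeff n = c n := by
    intro n
    simp only [L, finsetSum_coeff, coeff_C_mul_X_pow]
    rw [Finset.sum_ite_eq]
    split_ifs with h
    · rfl
    · exact (hc n (by simpa using h)).symm
  have hL : L.eval 0 = 1 := by rw [← coeff_zero_eq_eval_zero, hcoeff, hc0]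
  have hL0 : L ≠ 0 := by intro h; rw [h] at hL; simp at hL
  have hdeg : L.natDegree ≤ k := by
    rw [natDegree_le_iff_coeff_eq_zero]; intro n hn; rw [hcoeff, hc n hn]
  have hroot : ∀ z ∈ L.roots, ‖z⁻¹‖ ≤ R := by
    intro z hz
    have hC : 0 ≤ D := by
      have := (norm_nonneg _).trans (hS 1 one_pos)
      rw [pow_one] at this
      exact nonneg_of_mul_nonneg_left this hR
    have := inv_le_norm_of_root (S := fun n => if n = 0 then 0 else S n) (C := D) hR
      (fun n => by
        split_ifs with h
        · rw [norm_zero]; positivity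
        · exact hS n (Nat.pos_of_ne_zero h)) hL
      (fun n => by
        simp only [hcoeff]
        rw [hrec, Finset.Nat.sum_antidiagonal_eq_sum_range_succ
          (fun i j => (if i = 0 then 0 else S i) * c j), Finset.sum_range_succ']
        simp only [if_true, zero_mul, add_zero, Nat.add_eq_zero_iff, one_ne_zero, and_false,
          if_false]
        rw [Finset.range_eq_Ico, Finset.sum_Ico_add' (fun j => S j * c (n - j)) 0 n 1]
        rfl) (isRoot_of_mem_roots hz)
    rw [norm_inv]
    exact inv_le_of_inv_le₀ hR this
  have h1 : S 1 = L.derivative.eval 0 := by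
    rw [← coeff_zero_eq_eval_zero, coeff_derivative, hcoeff]
    have := hrec 1
    simp only [Finset.Icc_self, Finset.sum_singleton, Nat.sub_self, hc0] at this
    simp only [zero_add, Nat.cast_zero, mul_one]
    rw [← mul_one (S 1), ← this]; simp
  have h2 := (IsAlgClosed.splits L).eval_derivative_div_eval_of_ne_zero (x := 0)
    (by rw [hL]; exact one_ne_zero)
  rw [hL, div_one] at h2
  rw [h1, h2]
  refine (norm_multiset_sum_le _).trans ?_
  rw [Multiset.map_map]
  refine (Multiset.sum_le_card_nsmul _ R ?_).trans ?_
  · intro x hx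
    obtain ⟨z, hz, rfl⟩ := Multiset.mem_map.1 hx
    simpa using hroot z hz
  · rw [Multiset.card_map, nsmul_eq_mul]
    have : Multiset.card L.roots ≤ k := (card_roots' L).trans hdeg
    gcongr

end Burgess

namespace Burgess
open Polynomial

section
variable {F : Type*} [Field F] {ι : Type*} [Fintype ι]

/-- The multiplicative function `g ↦ ψ (∏ g(aᵢ) ^ eᵢ)` on polynomials. -/
noncomputable def evalChar (ψ : MulChar F ℂ) (a : ι → F) (e : ι → ℕ) : F[X] →* ℂ where
  toFun g := ψ (∏ i, g.eval (a i) ^ e i)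
  map_one' := by simp
  map_mul' g h := by simp [mul_pow, Finset.prod_mul_distrib]

lemma evalChar_apply (ψ : MulChar F ℂ) (a : ι → F) (e : ι → ℕ) (g : F[X]) :
    evalChar ψ a e g = ψ (∏ i, g.eval (a i) ^ e i) := rfl

/-- The composition of a multiplicative character with the norm. -/
noncomputable def normChar (ψ : MulChar F ℂ) (K : Type*) [Field K] [Finite K] [Algebra F K] :
    MulChar K ℂ where
  toFun x := ψ (Algebra.norm F x)
  map_one' := by simp
  map_mul' x y := by simp
  map_nonunit' x hx := by
    have : x = 0 := by by_contra h; exact hx (isUnit_iff_ne_zero.2 h)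
    have := Module.Finite.of_finite (R := F) (M := K)
    rw [‹x = 0›, Algebra.norm_zero, MulChar.map_zero]

lemma normChar_apply (ψ : MulChar F ℂ) {K : Type*} [Field K] [Finite K] [Algebra F K] (x : K) :
    normChar ψ K x = ψ (Algebra.norm F x) := rfl

variable [Fintype F]

lemma lcoeff_zero (X : F[X] →* ℂ) : lcoeff X 0 = 1 := by
  have : monics F 0 = {1} := by
    ext g
    rw [mem_monics, Finset.mem_singleton]
    exact ⟨fun h => h.1.natDegree_eq_zero.1 h.2, fun h => by simp [h]⟩
  rw [lcoeff, this, Finset.sum_singleton, map_one]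

lemma lcoeff_evalChar_eq_zero [DecidableEq ι] {ψ : MulChar F ℂ} (hψ : ψ ≠ 1) (a : ι → F)
    {e : ι → ℕ} {i₀ : ι} (he : e i₀ = 1) (ha : ∀ j, j ≠ i₀ → a j ≠ a i₀) {n : ℕ}
    (hn : Fintype.card ι ≤ n) : lcoeff (evalChar ψ a e) n = 0 := by
  set h : F[X] := ∏ j ∈ Finset.univ.erase i₀, (X - C (a j))
  have hdeg : h.degree < n := by
    rw [degree_prod_of_monic _ _ fun j _ => monic_X_sub_C _]
    simp only [degree_X_sub_C, Finset.sum_const, Finset.card_erase_of_mem (Finset.mem_univ i₀),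
      Finset.card_univ, nsmul_eq_mul, mul_one]
    have : 0 < Fintype.card ι := Fintype.card_pos_iff.2 ⟨i₀⟩
    exact_mod_cast (by omega : Fintype.card ι - 1 < n)
  have h0 : h.eval (a i₀) ≠ 0 := by
    rw [eval_prod]
    refine Finset.prod_ne_zero_iff.2 fun j hj => ?_
    rw [eval_sub, eval_X, eval_C]
    exact sub_ne_zero.2 (ha j (Finset.ne_of_mem_erase hj)).symm
  have h1 : ∀ j, j ≠ i₀ → h.eval (a j) = 0 := by
    intro j hj
    rw [eval_prod]
    exact Finset.prod_eq_zero (Finset.mem_erase.2 ⟨hj, Finset.mem_univ _⟩) (by simp)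
  have hmem : ∀ (t : F) (g : F[X]), g ∈ monics F n → g + C t * h ∈ monics F n := by
    intro t g hg
    obtain ⟨h2, h3⟩ := mem_monics.1 hg
    have h4 : (C t * h).degree < g.degree := by
      rw [degree_eq_natDegree h2.ne_zero, h3]
      refine lt_of_le_of_lt ?_ hdeg
      rw [degree_mul]
      calc (C t).degree + h.degree ≤ 0 + h.degree := by gcongr; exact degree_C_le
        _ = _ := zero_add _
    exact mem_monics.2 ⟨h2.add_of_left h4, by rw [natDegree_add_eq_left_of_degree_lt h4, h3]⟩
  have hshift : ∀ t : F, lcoeff (evalChar ψ a e) n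
      = ∑ g ∈ monics F n, evalChar ψ a e (g + C t * h) := by
    intro t
    refine Finset.sum_bij' (fun g _ => g + C (-t) * h) (fun g _ => g + C t * h)
      (fun g hg => hmem _ g hg) (fun g hg => hmem _ g hg) ?_ ?_ ?_
    · intro g _; rw [C_neg]; ring
    · intro g _; rw [C_neg]; ring
    · intro g _; congr 1; rw [C_neg]; ring
  have hzero : ∑ t : F, ∑ g ∈ monics F n, evalChar ψ a e (g + C t * h) = 0 := by
    rw [Finset.sum_comm]
    refine Finset.sum_eq_zero fun g _ => ?_
    have h2 : ∀ t : F, evalChar ψ a e (g + C t * h)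
        = ψ (g.eval (a i₀) + t * h.eval (a i₀))
          * ψ (∏ j ∈ Finset.univ.erase i₀, g.eval (a j) ^ e j) := by
      intro t
      rw [evalChar_apply, ← Finset.mul_prod_erase _ _ (Finset.mem_univ i₀), map_mul, he, pow_one]
      congr 2
      · simp
      · refine Finset.prod_congr rfl fun j hj => ?_
        rw [eval_add, eval_mul, h1 j (Finset.ne_of_mem_erase hj), mul_zero, add_zero]
    simp only [h2]
    rw [← Finset.sum_mul]
    have h3 : ∑ t : F, ψ (g.eval (a i₀) + t * h.eval (a i₀)) = ∑ x : F, ψ x :=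
      Fintype.sum_equiv ((Equiv.mulRight₀ _ h0).trans (Equiv.addLeft (g.eval (a i₀)))) _ _
        fun t => by simp
    rw [h3, MulChar.sum_eq_zero_of_ne_one hψ, zero_mul]
  rw [← Finset.sum_congr rfl fun t _ => hshift t, Finset.sum_const, Finset.card_univ,
    nsmul_eq_mul] at hzero
  exact (mul_eq_zero.1 hzero).resolve_left (Nat.cast_ne_zero.2 Fintype.card_ne_zero)

lemma lpow_evalChar (ψ : MulChar F ℂ) (a : ι → F) (e : ι → ℕ) (K : Type*) [Field K] [Fintype K]
    [Algebra F K] : lpow (evalChar ψ a e) (Module.finrank F K)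
      = ∑ x : K, normChar ψ K (∏ i, (algebraMap F K (a i) - x) ^ e i) := by
  rw [lpow_finrank (K := K)]
  refine Finset.sum_congr rfl fun x _ => ?_
  rw [evalChar_apply, ← map_pow, normChar_apply, map_prod]
  congr 1
  rw [← Finset.prod_pow]
  refine Finset.prod_congr rfl fun i _ => ?_
  rw [map_pow, norm_algebraMap_sub, ← pow_mul, ← pow_mul, mul_comm]

lemma norm_lpow_evalChar_le [DecidableEq ι] {ψ : MulChar F ℂ} (hψ : ψ ≠ 1) (a : ι → F)
    {e : ι → ℕ} {i₀ : ι} (he : e i₀ = 1) (ha : ∀ j, j ≠ i₀ → a j ≠ a i₀) :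
    ∃ D : ℝ, ∀ n, 0 < n → ‖lpow (evalChar ψ a e) n‖ ≤ D * √(Fintype.card F : ℝ) ^ n := by
  set m := ∑ i, e i
  set d := Fintype.card F - 1
  have hcard : 1 < Fintype.card F := Fintype.one_lt_card
  refine ⟨d * (5 * m + 8) + m, fun n hn => ?_⟩
  obtain ⟨p, hp⟩ := CharP.exists F
  have : Fact p.Prime := ⟨CharP.char_is_prime F p⟩
  have : NeZero n := ⟨hn.ne'⟩
  let K := FiniteField.Extension F p n
  have : Fintype K := Fintype.ofFinite K
  have hK : Fintype.card K = Fintype.card F ^ n := by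
    rw [← Nat.card_eq_fintype_card, ← Nat.card_eq_fintype_card]
    exact FiniteField.natCard_extension F p n
  obtain ⟨g, hg⟩ : d ∣ Fintype.card K - 1 := by
    rw [hK]; simpa using Nat.sub_dvd_pow_sub_pow (Fintype.card F) 1 n
  have hQ : Fintype.card K = g * d + 1 := by
    have : 0 < Fintype.card K := Fintype.card_pos
    rw [mul_comm]; omega
  have hθ : normChar ψ K ^ d = 1 := by
    ext x
    have h1 : Algebra.norm F (x : K) ≠ 0 := by
      rw [Algebra.norm_ne_zero_iff]; exact x.ne_zero
    rw [MulChar.pow_apply_coe, normChar_apply, ← map_pow, FiniteField.pow_card_sub_one_eq_one _ h1,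
      map_one, MulChar.one_apply_coe]
  have hθ1 : normChar ψ K ≠ 1 := by
    intro h
    apply hψ
    ext y
    obtain ⟨x, hx⟩ := FiniteField.norm_surjective (K := F) (K' := K) (y : F)
    have hx0 : x ≠ 0 := by
      rintro rfl
      rw [Algebra.norm_zero] at hx
      exact y.ne_zero hx.symm
    rw [MulChar.one_apply_coe, ← hx, ← normChar_apply, h, MulChar.one_apply hx0.isUnit]
  set b : ι → K := fun j => algebraMap F K (a j - a i₀)
  set f₁ : K[X] := ∏ j ∈ Finset.univ.erase i₀, (X + C (b j)) ^ e j
  have hf₁ : f₁.Monic := monic_prod_of_monic _ _ fun j _ => (monic_X_add_C _).pow _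
  have hX : ¬ X ∣ f₁ := by
    rw [X_dvd_iff, coeff_zero_eq_eval_zero, eval_prod]
    refine Finset.prod_ne_zero_iff.2 fun j hj => ?_
    rw [eval_pow, eval_add, eval_X, eval_C, zero_add]
    refine pow_ne_zero _ ?_
    rw [Ne, map_eq_zero]
    exact sub_ne_zero.2 (ha j (Finset.ne_of_mem_erase hj))
  have hdeg : (X * f₁).natDegree = m := by
    rw [monic_X.natDegree_mul hf₁, natDegree_X,
      natDegree_prod_of_monic _ _ fun j _ => (monic_X_add_C _).pow _]
    simp only [natDegree_pow, natDegree_X_add_C, mul_one]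
    rw [← he, Finset.add_sum_erase _ _ (Finset.mem_univ _)]
  have hmain := norm_sum_mulChar_eval_le hX hQ (by omega) hdeg hθ hθ1
  have hsum : lpow (evalChar ψ a e) n = ∑ x : K, normChar ψ K ((X * f₁).eval x) := by
    conv_lhs => rw [← FiniteField.finrank_extension F p n]
    rw [lpow_evalChar]
    refine Fintype.sum_equiv (Equiv.subLeft (algebraMap F K (a i₀))) _ _ fun x => ?_
    congr 1
    rw [eval_mul, eval_X, eval_prod, ← Finset.mul_prod_erase _ _ (Finset.mem_univ i₀), he, pow_one]
    congr 1
    refine Finset.prod_congr rfl fun j _ => ?_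
    simp [b]
    rfl
  rw [hsum]
  have hsq : √(Fintype.card K : ℝ) = √(Fintype.card F : ℝ) ^ n := by
    rw [hK, Nat.cast_pow, Real.sqrt_eq_iff_mul_self_eq (by positivity) (by positivity), ← mul_pow,
      Real.mul_self_sqrt (by positivity)]
  rwa [hsq] at hmain

/-- Weil's bound for sums of products of shifted powers of a character. -/
theorem norm_sum_prod_le [DecidableEq ι] {ψ : MulChar F ℂ} (hψ : ψ ≠ 1) (a : ι → F)
    {e : ι → ℕ} {i₀ : ι} (he : e i₀ = 1) (ha : ∀ j, j ≠ i₀ → a j ≠ a i₀) :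
    ‖∑ x, ∏ i, ψ (x + a i) ^ e i‖ ≤ Fintype.card ι * √(Fintype.card F : ℝ) := by
  obtain ⟨D, hD⟩ := norm_lpow_evalChar_le hψ a he ha
  have h0 : (0 : ℝ) < √(Fintype.card F : ℝ) :=
    Real.sqrt_pos.2 (Nat.cast_pos.2 Fintype.card_pos)
  have h1 := norm_powerSum_one_le h0 (lcoeff_zero (evalChar ψ a e))
    (fun n hn => lcoeff_evalChar_eq_zero hψ a he ha hn.le) (nat_mul_lcoeff _) hD
  have h2 : lpow (evalChar ψ a e) 1 = ∑ x, ∏ i, ψ (x + a i) ^ e i := by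
    conv_lhs => rw [← Module.finrank_self F]
    rw [lpow_evalChar]
    refine Fintype.sum_equiv (Equiv.neg F) _ _ fun x => ?_
    rw [normChar_apply, Algebra.norm_self, MonoidHom.id_apply, map_prod]
    refine Finset.prod_congr rfl fun i _ => ?_
    rw [map_pow, Algebra.algebraMap_self_apply, Equiv.neg_apply, neg_add_eq_sub]
  rwa [h2] at h1

end
end Burgess

namespace Burgess
open Polynomial

/-- A form of primitivity of a character mod `q` that localises well: the character is
nontrivial on the units congruent to `1` modulo `q / p`, for each prime `p ∣ q`. -/
def LocallyPrimitive (q : ℕ) (χ : DirichletCharacter ℂ q) : Prop :=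
  ∀ p : ℕ, p.Prime → p ∣ q → ∃ z : ℤ,
    IsUnit ((1 + (q / p : ℕ) * z : ℤ) : ZMod q) ∧ χ ((1 + (q / p : ℕ) * z : ℤ) : ZMod q) ≠ 1

lemma locallyPrimitive_of_isPrimitive {q : ℕ} (hq : 0 < q) {χ : DirichletCharacter ℂ q}
    (hχ : χ.IsPrimitive) : LocallyPrimitive q χ := by
  intro p hp hpq
  have : NeZero q := ⟨hq.ne'⟩
  by_contra! h
  have hd : q / p ∣ q := Nat.div_dvd_of_dvd hpq
  have h1 : χ.FactorsThrough (q / p) := by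
    rw [DirichletCharacter.factorsThrough_iff_ker_unitsMap hd]
    intro u hu
    have h2 : ZMod.castHom hd (ZMod (q / p)) (u : ZMod q) = 1 := by
      have := congrArg Units.val (MonoidHom.mem_ker.1 hu)
      simpa [ZMod.unitsMap] using this
    obtain ⟨a, ha⟩ := ZMod.intCast_surjective (u : ZMod q)
    rw [← ha, map_intCast] at h2
    have h3 : ((q / p : ℕ) : ℤ) ∣ a - 1 := by
      rw [← ZMod.intCast_zmod_eq_zero_iff_dvd]
      push_cast
      rw [h2, sub_self]
    obtain ⟨z, hz⟩ := h3
    have h4 : (1 + (q / p : ℕ) * z : ℤ) = a := by linear_combination -hz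
    have h5 := h z
    rw [h4, ha] at h5
    rw [MonoidHom.mem_ker]
    ext
    rw [MulChar.coe_toUnitHom]
    exact h5 u.isUnit
  have h2 : χ.conductor ≤ q / p := Nat.sInf_le h1
  rw [hχ] at h2
  exact absurd (Nat.div_lt_self hq hp.one_lt) (by omega)

/-- The complete sum of a character along a polynomial. -/
noncomputable def completeSum {q : ℕ} [NeZero q] (χ : DirichletCharacter ℂ q) (P : ℤ[X]) : ℂ :=
  ∑ x : ZMod q, χ (P.eval₂ (Int.castRingHom _) x)

lemma norm_completeSum_le {q : ℕ} [NeZero q] (χ : DirichletCharacter ℂ q) (P : ℤ[X]) :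
    ‖completeSum χ P‖ ≤ q := by
  refine (norm_sum_le _ _).trans ((Finset.sum_le_sum fun x _ => norm_mulChar_le_one χ _).trans ?_)
  simp [ZMod.card]

section shifts
variable {ι : Type*} [Fintype ι]

/-- The polynomial `∏ (X + mᵢ) ^ eᵢ`. -/
noncomputable def shiftPoly (m : ι → ℤ) (e : ι → ℕ) : ℤ[X] := ∏ i, (X + C (m i)) ^ e i

lemma eval₂_shiftPoly {R : Type*} [CommRing R] (m : ι → ℤ) (e : ι → ℕ) (x : R) :
    (shiftPoly m e).eval₂ (Int.castRingHom R) x = ∏ i, (x + m i) ^ e i := by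
  rw [shiftPoly, eval₂_finsetProd]
  refine Finset.prod_congr rfl fun i _ => ?_
  rw [eval₂_pow, eval₂_add, eval₂_X, eval₂_C, eq_intCast]

lemma norm_completeSum_shiftPoly_prime [DecidableEq ι] {p : ℕ} [Fact p.Prime]
    {χ : DirichletCharacter ℂ p} (hχ : χ ≠ 1) (m : ι → ℤ) {e : ι → ℕ} {i₀ : ι} (he : e i₀ = 1)
    (hm : ¬ (p : ℤ) ∣ ∏ j ∈ Finset.univ.erase i₀, (m i₀ - m j)) :
    ‖completeSum χ (shiftPoly m e)‖ ≤ Fintype.card ι * √p := by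
  have h := norm_sum_prod_le (ψ := χ) hχ (fun i => (m i : ZMod p)) he (fun j hj h => hm ?_)
  · rw [ZMod.card] at h
    simpa only [completeSum, eval₂_shiftPoly, map_prod, map_pow] using h
  · refine dvd_trans ?_ (Finset.dvd_prod_of_mem _ (Finset.mem_erase.2 ⟨hj, Finset.mem_univ _⟩))
    rw [← ZMod.intCast_zmod_eq_zero_iff_dvd]
    push_cast
    rw [h, sub_self]

lemma sum_one_add_mul_eq_zero {p : ℕ} [NeZero (p ^ 2)] {χ : DirichletCharacter ℂ (p ^ 2)} {z : ℤ}
    (hz : χ ((1 + p * z : ℤ) : ZMod (p ^ 2)) ≠ 1) : ∑ v : ZMod (p ^ 2), χ (1 + p * v) = 0 := by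
  have hp2 : (p : ZMod (p ^ 2)) * p = 0 := by
    rw [← Nat.cast_mul, ← pow_two, ZMod.natCast_self]
  refine eq_zero_of_mul_eq_self_right hz ?_
  rw [Finset.sum_mul]
  refine Fintype.sum_equiv (Equiv.addRight (z : ZMod (p ^ 2))) _ _ fun v => ?_
  rw [← map_mul]
  congr 1
  rw [Equiv.coe_addRight]
  push_cast
  linear_combination (v * z) * hp2

lemma card_filter_eval_castHom_le {p : ℕ} [Fact p.Prime] [NeZero (p ^ 2)] {f : (ZMod p)[X]}
    (hf : f ≠ 0) : ((Finset.univ : Finset (ZMod (p ^ 2))).filter fun x =>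
      f.eval (ZMod.castHom (dvd_pow_self p two_ne_zero) (ZMod p) x) = 0).card
      ≤ f.natDegree * p := by
  classical
  have hp : 0 < p := (Fact.out : p.Prime).pos
  have h1 : ((Finset.univ : Finset (ZMod (p ^ 2))).filter fun x =>
      f.eval (ZMod.castHom (dvd_pow_self p two_ne_zero) (ZMod p) x) = 0).card
      ≤ (f.roots.toFinset ×ˢ Finset.range p).card := by
    refine Finset.card_le_card_of_injOn
      (fun x => (ZMod.castHom (dvd_pow_self p two_ne_zero) (ZMod p) x, x.val / p)) ?_ ?_
    · intro x hx
      have hx := (Finset.mem_filter.1 hx).2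
      refine Finset.mem_coe.2 (Finset.mem_product.2 ⟨?_, ?_⟩)
      · rw [Multiset.mem_toFinset, mem_roots hf]; exact hx
      · rw [Finset.mem_range]
        refine Nat.div_lt_of_lt_mul ?_
        rw [← pow_two]; exact ZMod.val_lt x
    · intro x _ y _ hxy
      obtain ⟨h1, h2⟩ := Prod.ext_iff.1 hxy
      dsimp only at h1 h2
      rw [← ZMod.natCast_zmod_val x, ← ZMod.natCast_zmod_val y, map_natCast, map_natCast,
        ZMod.natCast_eq_natCast_iff'] at h1
      apply ZMod.val_injective
      rw [← Nat.div_add_mod x.val p, ← Nat.div_add_mod y.val p, h1, h2]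
  refine h1.trans ?_
  rw [Finset.card_product, Finset.card_range]
  exact Nat.mul_le_mul_right _ ((Multiset.toFinset_card_le _).trans (card_roots' f))

lemma norm_completeSum_shiftPoly_prime_sq [DecidableEq ι] {p : ℕ} [Fact p.Prime]
    [NeZero (p ^ 2)] {χ : DirichletCharacter ℂ (p ^ 2)} {z : ℤ}
    (hz : χ ((1 + p * z : ℤ) : ZMod (p ^ 2)) ≠ 1) (m : ι → ℤ) {e : ι → ℕ} {i₀ : ι}
    (he : e i₀ = 1) (he0 : ∀ i, e i ≠ 0)
    (hm : ¬ (p : ℤ) ∣ ∏ j ∈ Finset.univ.erase i₀, (m i₀ - m j)) :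
    ‖completeSum χ (shiftPoly m e)‖ ≤ Fintype.card ι * p := by
  have hp : p.Prime := Fact.out
  set R := ZMod (p ^ 2)
  set P := shiftPoly m e
  set cast := ZMod.castHom (dvd_pow_self p two_ne_zero) (ZMod p)
  have hp2 : (p : R) * p = 0 := by
    rw [← Nat.cast_mul, ← pow_two, ZMod.natCast_self]
  have hunit : ∀ x : R, IsUnit x ↔ cast x ≠ 0 := by
    intro x
    rw [← ZMod.natCast_zmod_val x, map_natCast, ZMod.isUnit_iff_coprime, Ne,
      ZMod.natCast_eq_zero_iff, Nat.coprime_pow_right_iff two_pos, Nat.coprime_comm,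
      hp.coprime_iff_not_dvd]
  set N : (ZMod p)[X] := ∑ i, C (e i : ZMod p) * ∏ j ∈ Finset.univ.erase i, (X + C (m j : ZMod p))
  have hN0 : N ≠ 0 := by
    intro h
    have h1 : N.eval (-(m i₀ : ZMod p)) = 0 := by rw [h, eval_zero]
    rw [eval_finsetSum, Finset.sum_eq_single i₀] at h1
    · rw [he, eval_mul, Nat.cast_one, eval_C, one_mul, eval_prod, Finset.prod_eq_zero_iff] at h1
      obtain ⟨j, hj, h2⟩ := h1
      refine hm (dvd_trans ?_ (Finset.dvd_prod_of_mem _ hj))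
      rw [← ZMod.intCast_zmod_eq_zero_iff_dvd]
      simp only [eval_add, eval_X, eval_C] at h2
      push_cast
      linear_combination -h2
    · intro i _ hi
      rw [eval_mul, eval_prod, Finset.prod_eq_zero (Finset.mem_erase.2 ⟨hi.symm, Finset.mem_univ _⟩),
        mul_zero]
      simp
    · intro h; exact absurd (Finset.mem_univ _) h
  have hNdeg : N.natDegree ≤ Fintype.card ι := by
    refine natDegree_sum_le_of_forall_le _ _ fun i _ => ?_
    refine (natDegree_C_mul_le _ _).trans ?_
    rw [natDegree_prod_of_monic _ _ fun j _ => monic_X_add_C _]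
    simp only [natDegree_X_add_C, Finset.sum_const, smul_eq_mul, mul_one]
    exact Finset.card_le_univ _
  have hderiv : ∀ x : R, cast (P.derivative.eval₂ (Int.castRingHom R) x)
      = (∏ i, (cast x + m i) ^ (e i - 1)) * N.eval (cast x) := by
    intro x
    rw [hom_eval₂, Subsingleton.elim (cast.comp (Int.castRingHom R)) (Int.castRingHom (ZMod p)),
      show P = ∏ i, (X + C (m i)) ^ e i from rfl, derivative_prod_finset, eval₂_finsetSum, eval_finsetSum, Finset.mul_sum]
    refine Finset.sum_congr rfl fun i _ => ?_
    rw [← Finset.mul_prod_erase _ _ (Finset.mem_univ i), eval_mul, eval_C, eval_prod, eval₂_mul,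
      eval₂_finsetProd, derivative_X_add_C_pow, eval₂_mul, eval₂_pow, eval₂_C]
    have h1 : ∏ j ∈ Finset.univ.erase i, eval₂ (Int.castRingHom (ZMod p)) (cast x)
        ((X + C (m j)) ^ e j) = (∏ j ∈ Finset.univ.erase i, (cast x + m j) ^ (e j - 1))
          * ∏ j ∈ Finset.univ.erase i, (X + C (m j : ZMod p)).eval (cast x) := by
      rw [← Finset.prod_mul_distrib]
      refine Finset.prod_congr rfl fun j _ => ?_
      rw [eval₂_pow, eval₂_add, eval₂_X, eval₂_C, eq_intCast, eval_add, eval_X, eval_C,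
        ← pow_succ, Nat.sub_add_cancel (Nat.pos_of_ne_zero (he0 j))]
    rw [h1, eval₂_add, eval₂_X, eval₂_C, eq_intCast, eq_intCast, Int.cast_natCast]
    ring
  have htaylor : ∀ x v : R, P.eval₂ (Int.castRingHom R) (x + p * v)
      = P.eval₂ (Int.castRingHom R) x + p * v * P.derivative.eval₂ (Int.castRingHom R) x := by
    intro x v
    simp only [← eval_map, ← derivative_map]
    obtain ⟨k, hk⟩ := (P.map (Int.castRingHom R)).binomExpansion x (p * v)
    rw [hk]
    linear_combination (k * v ^ 2) * hp2
  set bad := (Finset.univ : Finset R).filter fun x => N.eval (cast x) = 0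
  have hbad : bad.card ≤ Fintype.card ι * p :=
    (card_filter_eval_castHom_le hN0).trans (Nat.mul_le_mul_right _ hNdeg)
  have hinner : ∀ x : R, x ∉ bad →
      ∑ v : R, χ (P.eval₂ (Int.castRingHom R) (x + p * v)) = 0 := by
    intro x hx
    have hx : N.eval (cast x) ≠ 0 := fun h => hx (Finset.mem_filter.2 ⟨Finset.mem_univ _, h⟩)
    by_cases hu : IsUnit (P.eval₂ (Int.castRingHom R) x)
    · have hu' : IsUnit (P.derivative.eval₂ (Int.castRingHom R) x) := by
        rw [hunit, hderiv]
        refine mul_ne_zero (Finset.prod_ne_zero_iff.2 fun i _ => pow_ne_zero _ fun h => ?_) hx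
        rw [hunit, eval₂_shiftPoly, map_prod] at hu
        refine hu (Finset.prod_eq_zero (Finset.mem_univ i) ?_)
        rw [map_pow, map_add, map_intCast, h, zero_pow (he0 i)]
      obtain ⟨s, hs⟩ := hu
      obtain ⟨t, ht⟩ := hu'
      rw [← mul_zero (χ s), ← sum_one_add_mul_eq_zero hz, Finset.mul_sum]
      refine Fintype.sum_equiv (Units.mulRight (t * s⁻¹)) _ _ fun v => ?_
      rw [htaylor, ← hs, ← ht, ← map_mul]
      congr 1
      have h1 : (s : R) * ((s⁻¹ : Rˣ) : R) = 1 := s.mul_inv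
      simp only [Units.mulRight_apply, Units.val_mul]
      linear_combination (-(p * v * t : R)) * h1
    · refine Finset.sum_eq_zero fun v _ => MulChar.map_nonunit _ ?_
      rw [hunit] at hu ⊢
      push Not at hu ⊢
      rw [htaylor, map_add, hu, map_mul, map_mul, map_natCast, ZMod.natCast_self]
      ring
  have htotal : ((p ^ 2 : ℕ) : ℂ) * completeSum χ P
      = ∑ x : R, ∑ v : R, χ (P.eval₂ (Int.castRingHom R) (x + p * v)) := by
    rw [Finset.sum_comm]
    have : ∀ v : R, ∑ x : R, χ (P.eval₂ (Int.castRingHom R) (x + p * v)) = completeSum χ P :=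
      fun v => Fintype.sum_equiv (Equiv.addRight (p * v : R)) _ _ fun x => rfl
    rw [Finset.sum_congr rfl fun v _ => this v, Finset.sum_const, Finset.card_univ, ZMod.card,
      nsmul_eq_mul]
  rw [← Finset.sum_subset (Finset.subset_univ bad) fun x _ hx => hinner x hx] at htotal
  have hle : (p ^ 2 : ℕ) * ‖completeSum χ P‖ ≤ (p ^ 2 : ℕ) * (bad.card : ℝ) := by
    rw [← Complex.norm_natCast (p ^ 2), ← norm_mul, htotal, mul_comm, ← nsmul_eq_mul]
    refine (norm_sum_le _ _).trans (Finset.sum_le_card_nsmul _ _ _ fun x _ => ?_)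
    refine (norm_sum_le _ _).trans
      ((Finset.sum_le_sum fun v _ => norm_mulChar_le_one χ _).trans ?_)
    simp [ZMod.card, R]
  have h0 : (0 : ℝ) < (p ^ 2 : ℕ) := Nat.cast_pos.2 (pow_pos hp.pos 2)
  refine (le_of_mul_le_mul_left hle h0).trans ?_
  exact_mod_cast hbad

end shifts
end Burgess

namespace Burgess
open Polynomial

section crt
variable {a b : ℕ} (hab : a.Coprime b)

/-- The component mod `a` of a character mod `a * b`, for coprime `a` and `b`. -/
noncomputable def leftChar (χ : DirichletCharacter ℂ (a * b)) : DirichletCharacter ℂ a where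
  toFun y := χ ((ZMod.chineseRemainder hab).symm (y, 1))
  map_one' := by rw [← Prod.one_eq_mk, map_one, map_one]
  map_mul' x y := by rw [← map_mul, ← map_mul, Prod.mk_mul_mk, one_mul]
  map_nonunit' x hx := χ.map_nonunit fun h => hx <| by
    have := h.map (ZMod.chineseRemainder hab)
    rw [RingEquiv.apply_symm_apply] at this
    exact this.map (RingHom.fst _ _)

/-- The component mod `b` of a character mod `a * b`, for coprime `a` and `b`. -/
noncomputable def rightChar (χ : DirichletCharacter ℂ (a * b)) : DirichletCharacter ℂ b where
  toFun y := χ ((ZMod.chineseRemainder hab).symm (1, y))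
  map_one' := by rw [← Prod.one_eq_mk, map_one, map_one]
  map_mul' x y := by rw [← map_mul, ← map_mul, Prod.mk_mul_mk, one_mul]
  map_nonunit' x hx := χ.map_nonunit fun h => hx <| by
    have := h.map (ZMod.chineseRemainder hab)
    rw [RingEquiv.apply_symm_apply] at this
    exact this.map (RingHom.snd _ _)

lemma leftChar_apply (χ : DirichletCharacter ℂ (a * b)) (y : ZMod a) :
    leftChar hab χ y = χ ((ZMod.chineseRemainder hab).symm (y, 1)) := rfl

lemma rightChar_apply (χ : DirichletCharacter ℂ (a * b)) (y : ZMod b) :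
    rightChar hab χ y = χ ((ZMod.chineseRemainder hab).symm (1, y)) := rfl

lemma apply_eq_leftChar_mul_rightChar (χ : DirichletCharacter ℂ (a * b)) (x : ZMod (a * b)) :
    χ x = leftChar hab χ (ZMod.chineseRemainder hab x).1
      * rightChar hab χ (ZMod.chineseRemainder hab x).2 := by
  rw [leftChar_apply, rightChar_apply, ← map_mul, ← map_mul, Prod.mk_mul_mk, one_mul, mul_one,
    Prod.mk.eta, RingEquiv.symm_apply_apply]

lemma apply_intCast_eq (χ : DirichletCharacter ℂ (a * b)) (n : ℤ) :
    χ n = leftChar hab χ n * rightChar hab χ n := by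
  rw [apply_eq_leftChar_mul_rightChar hab, map_intCast, Prod.fst_intCast, Prod.snd_intCast]

lemma isUnit_intCast_mul_iff {a b : ℕ} (hab : a.Coprime b) (n : ℤ) :
    IsUnit (n : ZMod (a * b)) ↔ IsUnit (n : ZMod a) ∧ IsUnit (n : ZMod b) := by
  rw [← MulEquiv.isUnit_map (ZMod.chineseRemainder hab), map_intCast, Prod.isUnit_iff,
    Prod.fst_intCast, Prod.snd_intCast]

lemma locallyPrimitive_leftChar {χ : DirichletCharacter ℂ (a * b)}
    (hχ : LocallyPrimitive (a * b) χ) : LocallyPrimitive a (leftChar hab χ) := by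
  intro p hp hpa
  obtain ⟨z, hz1, hz2⟩ := hχ p hp (hpa.mul_right b)
  have h0 : (1 + (a * b / p : ℕ) * z : ℤ) = 1 + (a / p : ℕ) * (b * z) := by
    rw [mul_comm a b, Nat.mul_div_assoc _ hpa]; push_cast; ring
  rw [h0] at hz1 hz2
  refine ⟨b * z, ((isUnit_intCast_mul_iff hab _).1 hz1).1, fun h => hz2 ?_⟩
  rw [apply_intCast_eq hab, h, one_mul]
  have : ((1 + (a / p : ℕ) * (b * z) : ℤ) : ZMod b) = 1 := by
    push_cast; rw [ZMod.natCast_self]; ring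
  rw [this, map_one]

lemma locallyPrimitive_rightChar {χ : DirichletCharacter ℂ (a * b)}
    (hχ : LocallyPrimitive (a * b) χ) : LocallyPrimitive b (rightChar hab χ) := by
  intro p hp hpb
  obtain ⟨z, hz1, hz2⟩ := hχ p hp (hpb.mul_left a)
  have h0 : (1 + (a * b / p : ℕ) * z : ℤ) = 1 + (b / p : ℕ) * (a * z) := by
    rw [Nat.mul_div_assoc _ hpb]; push_cast; ring
  rw [h0] at hz1 hz2
  refine ⟨a * z, ((isUnit_intCast_mul_iff hab _).1 hz1).2, fun h => hz2 ?_⟩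
  rw [apply_intCast_eq hab, h, mul_one]
  have : ((1 + (b / p : ℕ) * (a * z) : ℤ) : ZMod a) = 1 := by
    push_cast; rw [ZMod.natCast_self]; ring
  rw [this, map_one]

lemma completeSum_mul [NeZero a] [NeZero b] [NeZero (a * b)]
    (χ : DirichletCharacter ℂ (a * b)) (P : ℤ[X]) :
    completeSum χ P = completeSum (leftChar hab χ) P * completeSum (rightChar hab χ) P := by
  rw [completeSum, completeSum, completeSum, Finset.sum_mul_sum, ← Fintype.sum_prod_type']
  refine Fintype.sum_equiv (ZMod.chineseRemainder hab).toEquiv _ _ fun x => ?_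
  rw [apply_eq_leftChar_mul_rightChar hab]
  congr 2
  · rw [← RingHom.coe_fst (R := ZMod a) (S := ZMod b), ← RingEquiv.coe_toRingHom,
      ← RingHom.comp_apply, hom_eval₂]
    congr 1
    exact Subsingleton.elim _ _
  · rw [← RingHom.coe_snd (R := ZMod a) (S := ZMod b), ← RingEquiv.coe_toRingHom,
      ← RingHom.comp_apply, hom_eval₂]
    congr 1
    exact Subsingleton.elim _ _

end crt

lemma norm_completeSum_shiftPoly_le {ι : Type*} [Fintype ι] [DecidableEq ι] (m : ι → ℤ)
    {e : ι → ℕ} {i₀ : ι} (he : e i₀ = 1) (he0 : ∀ i, e i ≠ 0) (q : ℕ) [NeZero q]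
    (hq : ∀ p : ℕ, p.Prime → ¬ p ^ 3 ∣ q) (χ : DirichletCharacter ℂ q)
    (hχ : LocallyPrimitive q χ) :
    ‖completeSum χ (shiftPoly m e)‖ ≤ (Fintype.card ι : ℝ) ^ q.primeFactors.card * √q
      * (q.gcd (∏ j ∈ Finset.univ.erase i₀, (m i₀ - m j)).natAbs : ℕ) := by
  set A := ∏ j ∈ Finset.univ.erase i₀, (m i₀ - m j)
  have hι : (1 : ℝ) ≤ Fintype.card ι := by
    have : 0 < Fintype.card ι := Fintype.card_pos_iff.2 ⟨i₀⟩
    exact_mod_cast this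
  revert χ
  rename_i hne
  revert hne
  induction q using Nat.recOnPosPrimePosCoprime with
  | zero => intro hne χ hχ; exact absurd rfl hne.ne
  | one =>
    intro hne χ hχ
    refine (norm_completeSum_le _ _).trans ?_
    simp
  | prime_pow p n hp hn =>
    intro hne χ hχ
    have := Fact.mk hp
    have hn2 : n = 1 ∨ n = 2 := by
      have : n < 3 := by
        by_contra! h
        exact hq p hp (pow_dvd_pow p h)
      omega
    rw [Nat.primeFactors_prime_pow hn.ne' hp, Finset.card_singleton, pow_one]
    have hz := hχ p hp (dvd_pow_self p hn.ne')
    have hp0 : (0 : ℝ) < p := Nat.cast_pos.2 hp.pos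
    by_cases hA : (p : ℤ) ∣ A
    · refine (norm_completeSum_le _ _).trans ?_
      have h1 : (p : ℝ) ≤ ((p ^ n).gcd A.natAbs : ℕ) := by
        refine Nat.cast_le.2 (Nat.le_of_dvd (Nat.gcd_pos_of_pos_left _ (pow_pos hp.pos n)) ?_)
        exact Nat.dvd_gcd (dvd_pow_self p hn.ne') (Int.natCast_dvd.1 hA)
      have h2 : ((p ^ n : ℕ) : ℝ) ≤ √((p ^ n : ℕ) : ℝ) * p := by
        conv_lhs => rw [← Real.mul_self_sqrt (Nat.cast_nonneg (p ^ n))]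
        refine mul_le_mul_of_nonneg_left ?_ (Real.sqrt_nonneg _)
        rw [Real.sqrt_le_left hp0.le]
        push_cast
        refine pow_le_pow_right₀ (by exact_mod_cast hp.one_le) (by omega)
      calc ((p ^ n : ℕ) : ℝ) ≤ 1 * √((p ^ n : ℕ) : ℝ) * p := by rwa [one_mul]
        _ ≤ _ := by gcongr
    · have h1 : (1 : ℝ) ≤ ((p ^ n).gcd A.natAbs : ℕ) :=
        Nat.one_le_cast.2 (Nat.gcd_pos_of_pos_left _ (pow_pos hp.pos n))
      refine le_trans ?_ (le_mul_of_one_le_right (by positivity) h1)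
      obtain ⟨z, hz1, hz2⟩ := hz
      rcases hn2 with rfl | rfl
      · have hQ := pow_one p
        generalize p ^ 1 = Q at *
        subst hQ
        refine norm_completeSum_shiftPoly_prime (fun h => hz2 ?_) m he hA
        rw [h]; exact MulChar.one_apply hz1
      · have h2 : √((p ^ 2 : ℕ) : ℝ) = p := by
          rw [Nat.cast_pow]; exact Real.sqrt_sq hp0.le
        rw [h2]
        have h3 : p ^ 2 / p = p := by rw [pow_two, Nat.mul_div_cancel _ hp.pos]
        rw [h3] at hz2
        exact norm_completeSum_shiftPoly_prime_sq hz2 m he he0 hA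
  | coprime a b ha hb hab iha ihb =>
    intro hne χ hχ
    have := NeZero.of_gt ha
    have := NeZero.of_gt hb
    have h1 := iha (fun p hp h => hq p hp (h.mul_right b)) _ (locallyPrimitive_leftChar hab hχ)
    have h2 := ihb (fun p hp h => hq p hp (h.mul_left a)) _ (locallyPrimitive_rightChar hab hχ)
    rw [completeSum_mul hab, norm_mul, hab.primeFactors_mul,
      Finset.card_union_of_disjoint hab.disjoint_primeFactors, pow_add, Nat.cast_mul,
      Real.sqrt_mul (Nat.cast_nonneg _), Nat.gcd_comm (a * b), hab.gcd_mul, Nat.cast_mul,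
      Nat.gcd_comm _ a, Nat.gcd_comm _ b]
    calc _ ≤ _ := mul_le_mul h1 h2 (norm_nonneg _) (by positivity)
      _ = _ := by ring

end Burgess

namespace Burgess
open Polynomial

section signed
variable {ι : Type*} [Fintype ι] [DecidableEq ι]

/-- `χ` or its complex conjugate, according to a sign. -/
noncomputable def signedChar {q : ℕ} (χ : DirichletCharacter ℂ q) (s : Bool) (x : ZMod q) : ℂ :=
  if s then χ x else (starRingEnd ℂ) (χ x)

lemma norm_signedChar_le {q : ℕ} [NeZero q] (χ : DirichletCharacter ℂ q) (s : Bool) (x : ZMod q) :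
    ‖signedChar χ s x‖ ≤ 1 := by
  rw [signedChar]
  split_ifs
  · exact norm_mulChar_le_one χ x
  · rw [RCLike.norm_conj]; exact norm_mulChar_le_one χ x

lemma exists_conj_eq_pow {q : ℕ} [NeZero q] (χ : DirichletCharacter ℂ q) :
    ∃ E : ℕ, E ≠ 0 ∧ ∀ x, (starRingEnd ℂ) (χ x) = χ x ^ E := by
  have hc : 0 < Fintype.card (ZMod q)ˣ := Fintype.card_pos
  refine ⟨2 * Fintype.card (ZMod q)ˣ - 1, by omega, fun x => ?_⟩
  by_cases hx : IsUnit x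
  · have h1 : χ x ^ Fintype.card (ZMod q)ˣ = 1 := by
      obtain ⟨u, rfl⟩ := hx
      rw [← map_pow, ← Units.val_pow_eq_pow_val, pow_card_eq_one, Units.val_one, map_one]
    have h2 : ‖χ x‖ = 1 := Complex.norm_eq_one_of_pow_eq_one h1 hc.ne'
    have h3 : χ x ≠ 0 := norm_ne_zero_iff.1 (by rw [h2]; exact one_ne_zero)
    refine mul_left_cancel₀ h3 ?_
    rw [Complex.mul_conj, Complex.normSq_eq_norm_sq, h2, ← pow_succ',
      Nat.sub_add_cancel (by omega), mul_comm, pow_mul, h1]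
    simp
  · rw [MulChar.map_nonunit χ hx, map_zero, zero_pow (by omega)]

lemma norm_sum_prod_signedChar_le {q : ℕ} [NeZero q]
    (hq : ∀ p : ℕ, p.Prime → ¬ p ^ 3 ∣ q) {χ : DirichletCharacter ℂ q}
    (hχ : LocallyPrimitive q χ) (s : ι → Bool) (m : ι → ℕ) (i₀ : ι) :
    ‖∑ x : ZMod q, ∏ i, signedChar χ (s i) (x + m i)‖ ≤
      (Fintype.card ι : ℝ) ^ q.primeFactors.card * √q
      * (q.gcd (∏ j ∈ Finset.univ.erase i₀, ((m i₀ : ℤ) - m j)).natAbs : ℕ) := by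
  wlog h : s i₀ = true generalizing s
  · have h1 := this (fun i => !s i) (by simpa using h)
    rw [← RCLike.norm_conj, map_sum] at h1
    refine le_of_eq_of_le ?_ h1
    congr 1
    refine Finset.sum_congr rfl fun x _ => ?_
    rw [map_prod]
    refine Finset.prod_congr rfl fun i _ => ?_
    cases hs : s i <;> simp [signedChar]
  · obtain ⟨E, hE0, hE⟩ := exists_conj_eq_pow χ
    have h1 := norm_completeSum_shiftPoly_le (fun i => (m i : ℤ))
      (e := fun i => if s i then 1 else E) (i₀ := i₀) (by simp [h])
      (fun i => by split_ifs <;> simp [hE0]) q hq χ hχ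
    refine le_of_eq_of_le ?_ h1
    congr 1
    refine Finset.sum_congr rfl fun x _ => ?_
    rw [eval₂_shiftPoly, map_prod]
    refine Finset.prod_congr rfl fun i _ => ?_
    rw [map_pow, signedChar, Int.cast_natCast]
    split_ifs
    · rw [pow_one]
    · rw [hE]

end signed

/-- Functions all of whose values are repeated are scarce. -/
lemma card_repeated_le {ι : Type*} [Fintype ι] {r B : ℕ} (hι : Fintype.card ι = 2 * r) [DecidableEq (ι → ℕ)]
    (S : Finset (ι → ℕ)) (hS : ∀ m ∈ S, ∀ i, m i < B ∧ ∃ j, j ≠ i ∧ m j = m i) :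
    S.card ≤ r ^ (2 * r) * B ^ r := by
  classical
  rcases Nat.eq_zero_or_pos r with rfl | hr
  · have : IsEmpty ι := Fintype.card_eq_zero_iff.1 (by simpa using hι)
    simpa using Finset.card_le_one_of_subsingleton S
  have hne : Nonempty ι := Fintype.card_pos_iff.1 (by omega)
  have : NeZero r := ⟨hr.ne'⟩
  have hsub : S ⊆ (Finset.univ : Finset ((ι → Fin r) × (Fin r → Fin B))).image
      (fun σf i => (σf.2 (σf.1 i) : ℕ)) := by
    intro m hm
    set I := Finset.univ.image m
    have hI : I.card ≤ r := by
      have h1 := Finset.card_eq_sum_card_image m Finset.univ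
      have h2 : ∑ b ∈ I, 2 ≤ ∑ b ∈ I, (Finset.univ.filter fun i => m i = b).card := by
        refine Finset.sum_le_sum fun b hb => ?_
        obtain ⟨i, -, rfl⟩ := Finset.mem_image.1 hb
        obtain ⟨-, j, hj, hji⟩ := hS m hm i
        exact Finset.one_lt_card.2 ⟨j, by simp [hji], i, by simp, hj⟩
      rw [← h1, Finset.sum_const, smul_eq_mul, Finset.card_univ, hι] at h2
      omega
    have hB : 0 < B := by
      obtain ⟨i⟩ := hne
      exact (Nat.zero_le _).trans_lt (hS m hm i).1
    obtain ⟨g⟩ : Nonempty (I ↪ Fin r) := by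
      rw [Function.Embedding.nonempty_iff_card_le]; simpa using hI
    have hmI : ∀ i, m i ∈ I := fun i => Finset.mem_image_of_mem _ (Finset.mem_univ i)
    have hIne : Nonempty I := hne.map fun i => ⟨m i, hmI i⟩
    have hIB : ∀ b ∈ I, b < B := by
      intro b hb
      obtain ⟨i, -, rfl⟩ := Finset.mem_image.1 hb
      exact (hS m hm i).1
    refine Finset.mem_image.2 ⟨(fun i => g ⟨m i, hmI i⟩, fun k =>
      ⟨(Function.invFun g k : I).1, hIB _ (Function.invFun g k : I).2⟩), Finset.mem_univ _, ?_⟩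
    funext i
    simp only
    rw [Function.leftInverse_invFun g.injective]
  refine (Finset.card_le_card hsub).trans (Finset.card_image_le.trans ?_)
  simp [Finset.card_univ, hι]

lemma sum_gcd_le (q B : ℕ) (hq : 0 < q) : ∑ u ∈ Finset.Icc 1 B, q.gcd u ≤ B * q.divisors.card := by
  calc ∑ u ∈ Finset.Icc 1 B, q.gcd u
      ≤ ∑ u ∈ Finset.Icc 1 B, ∑ d ∈ q.divisors, if d ∣ u then d else 0 := by
        refine Finset.sum_le_sum fun u _ => ?_
        have h : q.gcd u ∈ q.divisors := Nat.mem_divisors.2 ⟨Nat.gcd_dvd_left _ _, hq.ne'⟩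
        refine le_trans ?_ (Finset.single_le_sum (fun _ _ => Nat.zero_le _) h)
        rw [if_pos (Nat.gcd_dvd_right _ _)]
    _ = ∑ d ∈ q.divisors, ((Finset.Icc 1 B).filter (d ∣ ·)).card * d := by
        rw [Finset.sum_comm]
        refine Finset.sum_congr rfl fun d _ => ?_
        rw [← Finset.sum_filter, Finset.sum_const, smul_eq_mul]
    _ ≤ ∑ d ∈ q.divisors, B := by
        refine Finset.sum_le_sum fun d _ => ?_
        have : ((Finset.Icc 1 B).filter (d ∣ ·)).card = B / d := by
          rw [← Nat.Ioc_filter_dvd_card_eq_div]; rfl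
        rw [this]
        exact Nat.div_mul_le_self _ _
    _ = B * q.divisors.card := by rw [Finset.sum_const, smul_eq_mul, mul_comm]

lemma sum_gcd_sub_le {q B s : ℕ} (hq : 0 < q) (hs : s < B) :
    ∑ t ∈ Finset.range B, (if t = s then 0 else q.gcd ((s : ℤ) - t).natAbs)
      ≤ 2 * B * q.divisors.card := by
  have h1 : ∑ t ∈ Finset.range s, q.gcd ((s : ℤ) - t).natAbs ≤ B * q.divisors.card := by
    refine le_trans ?_ (sum_gcd_le q B hq)
    refine le_of_eq_of_le (Finset.sum_bij (t := Finset.Icc 1 s) (g := fun u => q.gcd u)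
      (fun t _ => s - t) ?_ ?_ ?_ ?_) (Finset.sum_le_sum_of_subset ?_)
    · intro t ht; simp only [Finset.mem_range, Finset.mem_Icc] at *; omega
    · intro t ht t' ht' h; simp only [Finset.mem_range] at *; omega
    · intro u hu; simp only [Finset.mem_Icc] at hu
      exact ⟨s - u, by simp only [Finset.mem_range]; omega, by omega⟩
    · intro t ht; simp only [Finset.mem_range] at ht; congr 1; omega
    · exact Finset.Icc_subset_Icc_right hs.le
  have h2 : ∑ t ∈ Finset.Ico (s + 1) B, q.gcd ((s : ℤ) - t).natAbs ≤ B * q.divisors.card := by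
    refine le_trans ?_ (sum_gcd_le q B hq)
    refine le_of_eq_of_le (Finset.sum_bij (t := Finset.Ico 1 (B - s)) (g := fun u => q.gcd u)
      (fun t _ => t - s) ?_ ?_ ?_ ?_) (Finset.sum_le_sum_of_subset ?_)
    · intro t ht; simp only [Finset.mem_Ico] at *; omega
    · intro t ht t' ht' h; simp only [Finset.mem_Ico] at *; omega
    · intro u hu; simp only [Finset.mem_Ico] at hu
      exact ⟨s + u, by simp only [Finset.mem_Ico]; omega, by omega⟩
    · intro t ht; simp only [Finset.mem_Ico] at ht; congr 1; omega
    · intro u hu; simp only [Finset.mem_Ico, Finset.mem_Icc] at *; omega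
  rw [← Finset.sum_range_add_sum_Ico _ (Nat.succ_le_of_lt hs), Finset.sum_range_succ]
  rw [if_pos rfl, add_zero, Finset.sum_congr rfl fun t ht => if_neg ?_,
    Finset.sum_congr (s₁ := Finset.Ico (s.succ) B) rfl fun t ht => if_neg ?_]
  · rw [two_mul, add_mul]; exact add_le_add h1 h2
  · have := (Finset.mem_Ico.1 ht).1; omega
  · exact (Finset.mem_range.1 ht).ne

lemma gcd_prod_le {ι : Type*} (q : ℕ) (hq : 0 < q) (s : Finset ι) (f : ι → ℤ) :
    q.gcd (∏ i ∈ s, f i).natAbs ≤ ∏ i ∈ s, q.gcd (f i).natAbs := by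
  classical
  induction s using Finset.induction_on with
  | empty => simp
  | insert a s ha ih =>
    rw [Finset.prod_insert ha, Finset.prod_insert ha, Int.natAbs_mul]
    refine (Nat.le_of_dvd ?_ (Nat.gcd_mul_right_dvd_mul_gcd q _ _)).trans (Nat.mul_le_mul_left _ ih)
    exact Nat.mul_pos (Nat.gcd_pos_of_pos_left _ hq) (Nat.gcd_pos_of_pos_left _ hq)

end Burgess

namespace Burgess

lemma sum_prod_gcd_le {ι : Type*} [Fintype ι] [DecidableEq ι] {q : ℕ} (B : ℕ) (hq : 0 < q)
    (i : ι) :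
    ∑ m ∈ Fintype.piFinset (fun _ : ι => Finset.range B),
      ∏ j ∈ Finset.univ.erase i, (if m j = m i then 0 else q.gcd ((m i : ℤ) - m j).natAbs)
      ≤ B * (2 * B * q.divisors.card) ^ (Fintype.card ι - 1) := by
  set F : ℕ → ℕ → ℕ := fun s t => if t = s then 0 else q.gcd ((s : ℤ) - t).natAbs
  have h1 : ∀ m ∈ Fintype.piFinset (fun _ : ι => Finset.range B),
      ∏ j ∈ Finset.univ.erase i, F (m i) (m j)
      = ∑ s ∈ Finset.range B, ∏ j, if j = i then (if m j = s then 1 else 0) else F s (m j) := by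
    intro m hm
    rw [Finset.sum_eq_single (m i)]
    · rw [← Finset.mul_prod_erase _ _ (Finset.mem_univ i), if_pos rfl, if_pos rfl, one_mul]
      refine Finset.prod_congr rfl fun j hj => ?_
      rw [if_neg (Finset.ne_of_mem_erase hj)]
    · intro s _ hs
      exact Finset.prod_eq_zero (Finset.mem_univ i) (by rw [if_pos rfl, if_neg hs.symm])
    · intro h
      exact absurd (Fintype.mem_piFinset.1 hm i) h
  rw [Finset.sum_congr rfl h1, Finset.sum_comm]
  calc _ ≤ ∑ s ∈ Finset.range B, (2 * B * q.divisors.card) ^ (Fintype.card ι - 1) := by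
        refine Finset.sum_le_sum fun s hs => ?_
        have h2 := Finset.prod_univ_sum (fun _ : ι => Finset.range B)
          (fun j t => if j = i then (if t = s then 1 else 0) else F s t)
        rw [← h2, ← Finset.mul_prod_erase _ _ (Finset.mem_univ i)]
        simp only [if_true, Finset.sum_ite_eq', hs, one_mul]
        refine (Finset.prod_le_pow_card _ _ (2 * B * q.divisors.card) fun j hj => ?_).trans_eq ?_
        · simp only [if_neg (Finset.ne_of_mem_erase hj)]
          exact sum_gcd_sub_le hq (Finset.mem_range.1 hs)
        · rw [Finset.card_erase_of_mem (Finset.mem_univ i), Finset.card_univ]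
    _ = _ := by rw [Finset.sum_const, smul_eq_mul, Finset.card_range]

lemma two_pow_card_primeFactors_le {q : ℕ} (hq : 0 < q) :
    2 ^ q.primeFactors.card ≤ q.divisors.card := by
  rw [Nat.card_divisors hq.ne']
  refine Finset.pow_card_le_prod _ _ _ fun p hp => ?_
  have := (Nat.prime_of_mem_primeFactors hp).factorization_pos_of_dvd hq.ne'
    (Nat.dvd_of_mem_primeFactors hp)
  omega

lemma pow_card_primeFactors_le (k : ℕ) {q : ℕ} (hq : 0 < q) :
    k ^ q.primeFactors.card ≤ q.divisors.card ^ k := by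
  calc k ^ q.primeFactors.card ≤ (2 ^ k) ^ q.primeFactors.card :=
        Nat.pow_le_pow_left Nat.lt_two_pow_self.le _
    _ = (2 ^ q.primeFactors.card) ^ k := by rw [← pow_mul, ← pow_mul, mul_comm]
    _ ≤ _ := Nat.pow_le_pow_left (two_pow_card_primeFactors_le hq) _

/-- The `2r`-th moment of short character sums. -/
lemma moment_le {q : ℕ} [NeZero q] (hq : ∀ p : ℕ, p.Prime → ¬ p ^ 3 ∣ q)
    {χ : DirichletCharacter ℂ q} (hχ : LocallyPrimitive q χ) {r : ℕ} (hr : 0 < r) (B : ℕ) :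
    ∑ x : ZMod q, ‖∑ b ∈ Finset.range B, χ (x + b)‖ ^ (2 * r)
      ≤ ((r : ℝ) ^ (2 * r) + 2 * r * 4 ^ r) * (q.divisors.card : ℝ) ^ (4 * r)
        * (q * (B : ℝ) ^ r + √q * (B : ℝ) ^ (2 * r)) := by
  classical
  have hq0 : 0 < q := NeZero.pos q
  set τ := q.divisors.card
  have hτ : 1 ≤ τ := Finset.card_pos.2 ⟨1, Nat.one_mem_divisors.2 hq0.ne'⟩
  set ι := Fin r ⊕ Fin r
  have hι : Fintype.card ι = 2 * r := by simp [ι, two_mul]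
  set s : ι → Bool := Sum.elim (fun _ => true) (fun _ => false)
  set M := Fintype.piFinset (fun _ : ι => Finset.range B)
  set W : (ι → ℕ) → ℂ := fun m => ∑ x : ZMod q, ∏ i, signedChar χ (s i) (x + m i)
  have hexp : ((∑ x : ZMod q, ‖∑ b ∈ Finset.range B, χ (x + b)‖ ^ (2 * r) : ℝ) : ℂ)
      = ∑ m ∈ M, W m := by
    rw [Finset.sum_comm]
    push_cast
    refine Finset.sum_congr rfl fun x _ => ?_
    rw [← Finset.prod_univ_sum (fun _ : ι => Finset.range B)
      (fun i b => signedChar χ (s i) (x + b)), Fintype.prod_sum_type]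
    simp only [s, Sum.elim_inl, Sum.elim_inr, signedChar, if_true, Bool.false_eq_true, if_false,
      Finset.prod_const, Finset.card_univ, Fintype.card_fin, ← map_sum]
    rw [← mul_pow, Complex.mul_conj, Complex.normSq_eq_norm_sq, pow_mul]
    push_cast
    rfl
  have hW1 : ∀ m, ‖W m‖ ≤ q := by
    intro m
    refine (norm_sum_le _ _).trans ((Finset.sum_le_sum fun x _ => ?_).trans (b := ∑ x : ZMod q, 1)
      ?_)
    · rw [norm_prod]
      exact Finset.prod_le_one (fun _ _ => norm_nonneg _) fun i _ => norm_signedChar_le χ _ _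
    · simp [ZMod.card]
  set bad := M.filter fun m => ∀ i, ∃ j, j ≠ i ∧ m j = m i
  have hbad : (bad.card : ℝ) ≤ (r : ℝ) ^ (2 * r) * (B : ℝ) ^ r := by
    exact_mod_cast card_repeated_le hι bad fun m hm i =>
      ⟨Finset.mem_range.1 (Fintype.mem_piFinset.1 (Finset.mem_filter.1 hm).1 i),
        (Finset.mem_filter.1 hm).2 i⟩
  set G : ι → (ι → ℕ) → ℕ := fun i m =>
    ∏ j ∈ Finset.univ.erase i, (if m j = m i then 0 else q.gcd ((m i : ℤ) - m j).natAbs)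
  have hW2 : ∀ m ∈ M, m ∉ bad → ‖W m‖ ≤ (τ : ℝ) ^ (2 * r) * √q * ∑ i, (G i m : ℝ) := by
    intro m hm hmb
    have h1 : ∃ i, ∀ j, j ≠ i → m j ≠ m i := by
      by_contra! h
      exact hmb (Finset.mem_filter.2 ⟨hm, h⟩)
    obtain ⟨i, hi⟩ := h1
    refine (norm_sum_prod_signedChar_le hq hχ s m i).trans ?_
    have h2 : ((Fintype.card ι : ℝ)) ^ q.primeFactors.card ≤ (τ : ℝ) ^ (2 * r) := by
      rw [hι]; exact_mod_cast pow_card_primeFactors_le (2 * r) hq0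
    have h3 : ((q.gcd (∏ j ∈ Finset.univ.erase i, ((m i : ℤ) - m j)).natAbs : ℕ) : ℝ)
        ≤ ∑ i, (G i m : ℝ) := by
      refine le_trans ?_ (Finset.single_le_sum (f := fun i => (G i m : ℝ))
        (fun _ _ => Nat.cast_nonneg _) (Finset.mem_univ i))
      refine Nat.cast_le.2 ((gcd_prod_le q hq0 _ _).trans_eq ?_)
      exact Finset.prod_congr rfl fun j hj => (if_neg (hi j (Finset.ne_of_mem_erase hj))).symm
    gcongr
  have hG : ∑ m ∈ M, ∑ i, (G i m : ℝ) ≤ 2 * r * ((B : ℝ) * (2 * B * τ) ^ (2 * r - 1)) := by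
    rw [Finset.sum_comm]
    refine (Finset.sum_le_card_nsmul _ _ ((B : ℝ) * (2 * B * τ) ^ (2 * r - 1))
      fun i _ => ?_).trans_eq ?_
    · have := sum_prod_gcd_le B hq0 i
      rw [hι] at this
      have h4 : ((∑ m ∈ M, G i m : ℕ) : ℝ) ≤ (B * (2 * B * τ) ^ (2 * r - 1) : ℕ) :=
        Nat.cast_le.2 this
      push_cast at h4
      exact h4
    · rw [Finset.card_univ, hι, nsmul_eq_mul]; push_cast; rfl
  have hmain : ∑ x : ZMod q, ‖∑ b ∈ Finset.range B, χ (x + b)‖ ^ (2 * r)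
      ≤ ∑ m ∈ M, ‖W m‖ := by
    refine le_trans ?_ (norm_sum_le _ _)
    rw [← hexp, Complex.norm_real]
    exact le_abs_self _
  refine hmain.trans ?_
  rw [← Finset.sum_filter_add_sum_filter_not M (fun m => ∀ i, ∃ j, j ≠ i ∧ m j = m i)]
  have hfirst : ∑ m ∈ bad, ‖W m‖ ≤ (r : ℝ) ^ (2 * r) * (q * (B : ℝ) ^ r) := by
    refine (Finset.sum_le_card_nsmul _ _ (q : ℝ) fun m _ => hW1 m).trans ?_
    rw [nsmul_eq_mul]
    calc (bad.card : ℝ) * q ≤ (r : ℝ) ^ (2 * r) * (B : ℝ) ^ r * q := by gcongr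
      _ = _ := by ring
  have hsecond : ∑ m ∈ M.filter (fun m => ¬ ∀ i, ∃ j, j ≠ i ∧ m j = m i), ‖W m‖
      ≤ 2 * r * 4 ^ r * (τ : ℝ) ^ (4 * r) * (√q * (B : ℝ) ^ (2 * r)) := by
    calc _ ≤ ∑ m ∈ M.filter (fun m => ¬ ∀ i, ∃ j, j ≠ i ∧ m j = m i),
          (τ : ℝ) ^ (2 * r) * √q * ∑ i, (G i m : ℝ) := by
          refine Finset.sum_le_sum fun m hm => ?_
          obtain ⟨hm, hm2⟩ := Finset.mem_filter.1 hm
          exact hW2 m hm fun h => hm2 (Finset.mem_filter.1 h).2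
      _ ≤ ∑ m ∈ M, (τ : ℝ) ^ (2 * r) * √q * ∑ i, (G i m : ℝ) :=
          Finset.sum_le_sum_of_subset_of_nonneg (Finset.filter_subset _ _)
            fun _ _ _ => by positivity
      _ ≤ (τ : ℝ) ^ (2 * r) * √q * (2 * r * ((B : ℝ) * (2 * B * τ) ^ (2 * r - 1))) := by
          rw [← Finset.mul_sum]; gcongr
      _ ≤ (τ : ℝ) ^ (2 * r) * √q * (2 * r * ((2 * B * τ) * (2 * B * τ) ^ (2 * r - 1))) := by
          gcongr
          have : (1 : ℝ) ≤ τ := by exact_mod_cast hτ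
          nlinarith [B.cast_nonneg (α := ℝ)]
      _ = _ := by
          rw [← pow_succ', Nat.sub_add_cancel (by omega), mul_pow, mul_pow, pow_mul (2 : ℝ)]
          ring
  have hτ1 : (1 : ℝ) ≤ (τ : ℝ) ^ (4 * r) := one_le_pow₀ (by exact_mod_cast hτ)
  calc _ ≤ (r : ℝ) ^ (2 * r) * (q * (B : ℝ) ^ r)
      + 2 * r * 4 ^ r * (τ : ℝ) ^ (4 * r) * (√q * (B : ℝ) ^ (2 * r)) := add_le_add hfirst hsecond
    _ ≤ (r : ℝ) ^ (2 * r) * (τ : ℝ) ^ (4 * r) * (q * (B : ℝ) ^ r)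
      + 2 * r * 4 ^ r * (τ : ℝ) ^ (4 * r) * (√q * (B : ℝ) ^ (2 * r))
      + ((r : ℝ) ^ (2 * r) * (τ : ℝ) ^ (4 * r) * (√q * (B : ℝ) ^ (2 * r))
      + 2 * r * 4 ^ r * (τ : ℝ) ^ (4 * r) * (q * (B : ℝ) ^ r)) := by
        have h1 : (r : ℝ) ^ (2 * r) * (q * (B : ℝ) ^ r)
            ≤ (r : ℝ) ^ (2 * r) * (τ : ℝ) ^ (4 * r) * (q * (B : ℝ) ^ r) := by
          gcongr
          exact le_mul_of_one_le_right (by positivity) hτ1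
        have h2 : 0 ≤ (r : ℝ) ^ (2 * r) * (τ : ℝ) ^ (4 * r) * (√q * (B : ℝ) ^ (2 * r))
            + 2 * r * 4 ^ r * (τ : ℝ) ^ (4 * r) * (q * (B : ℝ) ^ r) := by positivity
        linarith
    _ = _ := by ring

end Burgess

namespace Burgess

/-- The divisor bound. -/
lemma exists_card_divisors_le {ε : ℝ} (hε : 0 < ε) :
    ∃ C : ℝ, 1 ≤ C ∧ ∀ n : ℕ, 0 < n → (n.divisors.card : ℝ) ≤ C * (n : ℝ) ^ ε := by
  set D : ℝ := max 1 (1 / (ε * Real.log 2))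
  have hD : 1 ≤ D := le_max_left _ _
  have hl2 : 0 < Real.log 2 := Real.log_pos one_lt_two
  obtain ⟨P, hP⟩ := exists_nat_gt ((2 : ℝ) ^ (1 / ε))
  have hsmall : ∀ p a : ℕ, 2 ≤ p → ((a : ℝ) + 1) ≤ D * ((p : ℝ) ^ a) ^ ε := by
    intro p a hp
    have h1 : ((2 : ℝ) ^ a) ^ ε ≤ ((p : ℝ) ^ a) ^ ε := by
      have : (2 : ℝ) ≤ p := by exact_mod_cast hp
      gcongr
    have h2 : 1 + a * (ε * Real.log 2) ≤ ((2 : ℝ) ^ a) ^ ε := by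
      rw [← Real.rpow_natCast, ← Real.rpow_mul zero_le_two, Real.rpow_def_of_pos two_pos]
      have := Real.add_one_le_exp (Real.log 2 * (a * ε))
      linarith
    have h3 : (a : ℝ) ≤ D * (a * (ε * Real.log 2)) := by
      have h4 : 1 / (ε * Real.log 2) ≤ D := le_max_right _ _
      rw [div_le_iff₀ (by positivity)] at h4
      nlinarith [a.cast_nonneg (α := ℝ)]
    calc (a : ℝ) + 1 ≤ D * (1 + a * (ε * Real.log 2)) := by linarith
      _ ≤ D * ((p : ℝ) ^ a) ^ ε := by gcongr; exact h2.trans h1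
  have hlarge : ∀ p a : ℕ, P ≤ p → ((a : ℝ) + 1) ≤ ((p : ℝ) ^ a) ^ ε := by
    intro p a hp
    have h1 : (2 : ℝ) ≤ (p : ℝ) ^ ε := by
      have h2 : (2 : ℝ) ^ (1 / ε) ≤ p := hP.le.trans (Nat.cast_le.2 hp)
      calc (2 : ℝ) = ((2 : ℝ) ^ (1 / ε)) ^ ε := by
            rw [← Real.rpow_mul zero_le_two, one_div_mul_cancel hε.ne', Real.rpow_one]
        _ ≤ _ := by gcongr
    rw [← Real.rpow_natCast, ← Real.rpow_mul (Nat.cast_nonneg _), mul_comm,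
      Real.rpow_mul (Nat.cast_nonneg _), Real.rpow_natCast]
    have h3 : a + 1 ≤ 2 ^ a := Nat.lt_two_pow_self
    calc (a : ℝ) + 1 ≤ 2 ^ a := by exact_mod_cast h3
      _ ≤ _ := by gcongr
  refine ⟨D ^ P, one_le_pow₀ hD, fun n hn => ?_⟩
  rw [Nat.card_divisors hn.ne', Nat.cast_prod]
  have hn' : (n : ℝ) ^ ε = ∏ p ∈ n.primeFactors, ((p : ℝ) ^ n.factorization p) ^ ε := by
    conv_lhs => rw [← Nat.prod_factorization_pow_eq_self hn.ne']
    rw [Finsupp.prod, Nat.cast_prod, Nat.support_factorization,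
      Real.finsetProd_rpow _ _ fun p _ => by positivity]
    simp
  rw [hn']
  have h1 : ∏ p ∈ n.primeFactors, (if p < P then D else 1) ≤ D ^ P := by
    rw [← Finset.prod_filter, Finset.prod_const]
    refine pow_le_pow_right₀ hD ?_
    refine (Finset.card_le_card (t := Finset.range P) fun p hp => ?_).trans_eq
      (Finset.card_range P)
    exact Finset.mem_range.2 (Finset.mem_filter.1 hp).2
  refine le_trans ?_ (mul_le_mul_of_nonneg_right h1
    (Finset.prod_nonneg fun p _ => by positivity))
  rw [← Finset.prod_mul_distrib]
  refine Finset.prod_le_prod (fun p _ => by positivity) fun p hp => ?_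
  push_cast
  split_ifs with h
  · exact hsmall p _ (Nat.prime_of_mem_primeFactors hp).two_le
  · rw [one_mul]; exact hlarge p _ (not_lt.1 h)

lemma abs_card_sub_le (S : Finset ℕ) (hS : ∀ p ∈ S, p.Prime) (n : ℕ) :
    |(((Finset.Icc 1 n).filter fun a => ∀ p ∈ S, ¬ p ∣ a).card : ℝ)
      - n * ∏ p ∈ S, (1 - 1 / (p : ℝ))| ≤ 2 ^ S.card - 1 := by
  classical
  induction S using Finset.induction_on generalizing n with
  | empty => simp
  | insert p S hpS ih =>
    have hp : p.Prime := hS p (Finset.mem_insert_self _ _)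
    have hS' : ∀ p ∈ S, p.Prime := fun l hl => hS l (Finset.mem_insert_of_mem hl)
    have h1 := ih hS' n
    have h2 := ih hS' (n / p)
    set Φ : ℕ → ℕ := fun n => ((Finset.Icc 1 n).filter fun a => ∀ p ∈ S, ¬ p ∣ a).card
    set π := ∏ p ∈ S, (1 - 1 / (p : ℝ))
    have hπ0 : 0 ≤ π := Finset.prod_nonneg fun l hl => by
      have : (1 : ℝ) ≤ l := by exact_mod_cast (hS' l hl).one_le
      rw [sub_nonneg, div_le_one (by linarith)]; exact this
    have hπ1 : π ≤ 1 := Finset.prod_le_one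
      (fun l hl => by
        have : (1 : ℝ) ≤ l := by exact_mod_cast (hS' l hl).one_le
        rw [sub_nonneg, div_le_one (by linarith)]; exact this)
      fun l _ => by
        have : (0 : ℝ) ≤ 1 / l := by positivity
        linarith
    have hsplit : ((Finset.Icc 1 n).filter fun a => ∀ l ∈ insert p S, ¬ l ∣ a).card + Φ (n / p)
        = Φ n := by
      change _ + _ = ((Finset.Icc 1 n).filter fun a => ∀ p ∈ S, ¬ p ∣ a).card
      rw [← Finset.card_filter_add_card_filter_not (p := fun a => ¬ p ∣ a)
        (s := (Finset.Icc 1 n).filter fun a => ∀ l ∈ S, ¬ l ∣ a)]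
      congr 1
      · rw [Finset.filter_filter]
        congr 1
        ext a
        simp only [Finset.mem_filter, Finset.forall_mem_insert]
        tauto
      · refine Finset.card_bij (fun a _ => p * a) ?_ ?_ ?_
        · intro a ha
          simp only [Finset.mem_filter, Finset.mem_Icc, not_not] at ha ⊢
          refine ⟨⟨⟨Nat.mul_pos hp.pos ha.1.1, ?_⟩, fun l hl h => ?_⟩, dvd_mul_right _ _⟩
          · rw [mul_comm]; exact (Nat.le_div_iff_mul_le hp.pos).1 ha.1.2
          · rcases (hS' l hl).dvd_mul.1 h with h | h
            · rw [(Nat.prime_dvd_prime_iff_eq (hS' l hl) hp).1 h] at hl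
              exact hpS hl
            · exact ha.2 l hl h
        · intro a _ b _ h
          exact Nat.eq_of_mul_eq_mul_left hp.pos h
        · intro b hb
          simp only [Finset.mem_filter, Finset.mem_Icc, not_not] at hb
          obtain ⟨⟨⟨hb1, hb2⟩, hb3⟩, a, rfl⟩ := hb
          refine ⟨a, ?_, rfl⟩
          simp only [Finset.mem_filter, Finset.mem_Icc]
          refine ⟨⟨Nat.pos_of_mul_pos_left hb1, ?_⟩, fun l hl h => hb3 l hl (h.mul_left _)⟩
          rw [Nat.le_div_iff_mul_le hp.pos, mul_comm]; exact hb2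
    have hsplit' : (((Finset.Icc 1 n).filter fun a => ∀ l ∈ insert p S, ¬ l ∣ a).card : ℝ)
        = Φ n - Φ (n / p) := by
      rw [← hsplit]; push_cast; ring
    have hfloor1 : ((n / p : ℕ) : ℝ) ≤ n / p := Nat.cast_div_le
    have hfloor2 : (n : ℝ) / p ≤ (n / p : ℕ) + 1 := by
      have h3 := Nat.lt_div_mul_add hp.pos (a := n)
      have hp0 : (0 : ℝ) < p := Nat.cast_pos.2 hp.pos
      rw [div_le_iff₀ hp0]
      have : (n : ℝ) ≤ (n / p : ℕ) * p + p := by exact_mod_cast h3.le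
      linarith
    rw [Finset.prod_insert hpS, Finset.card_insert_of_notMem hpS, hsplit', pow_succ]
    have h4 : (n : ℝ) * ((1 - 1 / (p : ℝ)) * π) = n * π - n / p * π := by ring
    rw [h4]
    rw [abs_le] at h1 h2 ⊢
    have h5 : ((n / p : ℕ) : ℝ) * π ≤ n / p * π := by gcongr
    have h6 : (n : ℝ) / p * π ≤ (n / p : ℕ) * π + 1 := by nlinarith
    change -_ ≤ (Φ n : ℝ) - _ ∧ (Φ n : ℝ) - _ ≤ _ at h1
    change -_ ≤ (Φ (n / p) : ℝ) - _ ∧ (Φ (n / p) : ℝ) - _ ≤ _ at h2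
    constructor <;> linarith [h1.1, h1.2, h2.1, h2.2]

/-- A lower bound for the density of integers coprime to `q`. -/
lemma le_card_coprime {q A : ℕ} (hq : 0 < q) (hA : 2 * q.divisors.card ^ 2 ≤ A) :
    (A : ℝ) / (2 * q.divisors.card) ≤ ((Finset.Icc 1 A).filter fun a => a.Coprime q).card := by
  have h1 := (abs_le.1 (abs_card_sub_le q.primeFactors
    (fun p hp => Nat.prime_of_mem_primeFactors hp) A)).1
  have hset : (Finset.Icc 1 A).filter (fun a => a.Coprime q)
      = (Finset.Icc 1 A).filter fun a => ∀ p ∈ q.primeFactors, ¬ p ∣ a := by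
    refine Finset.filter_congr fun a _ => ?_
    rw [Nat.Coprime, ← Nat.coprime_iff_gcd_eq_one, Nat.coprime_comm]
    constructor
    · intro h p hp hpa
      exact (Nat.prime_of_mem_primeFactors hp).one_lt.ne'
        (Nat.dvd_one.1 (h ▸ Nat.dvd_gcd (Nat.dvd_of_mem_primeFactors hp) hpa))
    · intro h
      refine Nat.coprime_of_dvd fun p hp hpq hpa => h p ?_ hpa
      exact Nat.mem_primeFactors.2 ⟨hp, hpq, hq.ne'⟩
  rw [hset]
  set τ := q.divisors.card
  have hω := two_pow_card_primeFactors_le hq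
  have hω' : (2 : ℝ) ^ q.primeFactors.card ≤ τ := by exact_mod_cast hω
  have hτ : (0 : ℝ) < τ := lt_of_lt_of_le (by positivity) hω'
  have hprod : 1 / (τ : ℝ) ≤ ∏ p ∈ q.primeFactors, (1 - 1 / (p : ℝ)) := by
    calc 1 / (τ : ℝ) ≤ 1 / 2 ^ q.primeFactors.card := by gcongr
      _ = ∏ p ∈ q.primeFactors, (1 / 2 : ℝ) := by rw [Finset.prod_const, one_div_pow]
      _ ≤ _ := by
        refine Finset.prod_le_prod (fun _ _ => by norm_num) fun p hp => ?_
        have : (2 : ℝ) ≤ p := by exact_mod_cast (Nat.prime_of_mem_primeFactors hp).two_le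
        have : 1 / (p : ℝ) ≤ 1 / 2 := by gcongr
        linarith
  have hA' : 2 * (τ : ℝ) ^ 2 ≤ A := by exact_mod_cast hA
  have h2 : (A : ℝ) * (1 / τ) ≤ A * ∏ p ∈ q.primeFactors, (1 - 1 / (p : ℝ)) := by gcongr
  have h3 : (τ : ℝ) ≤ A / (2 * τ) := by
    rw [le_div_iff₀ (by positivity)]; nlinarith
  have h4 : (A : ℝ) * (1 / τ) = A / (2 * τ) + A / (2 * τ) := by field_simp; ring
  linarith

end Burgess

namespace Burgess

lemma card_filter_mul_eq_le {q A N a b : ℕ} (ha : a ∈ Finset.Icc 1 A) (hb : b ∈ Finset.Icc 1 A)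
    (hq : 2 * A * N ≤ q) (c : ZMod q) :
    (((Finset.range N ×ˢ Finset.range N).filter fun i : ℕ × ℕ =>
      (b : ZMod q) * (c + i.1) = a * (c + i.2)).card : ℝ) ≤ N * (a.gcd b / a) + 1 := by
  rw [Finset.mem_Icc] at ha hb
  set g := a.gcd b
  have hg : 0 < g := Nat.gcd_pos_of_pos_left _ ha.1
  obtain ⟨a', ha'⟩ : g ∣ a := Nat.gcd_dvd_left a b
  obtain ⟨b', hb'⟩ : g ∣ b := Nat.gcd_dvd_right a b
  have ha'0 : 0 < a' := Nat.pos_of_ne_zero fun h => by simp [h] at ha'; omega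
  have hcop : IsCoprime (a' : ℤ) b' := by
    rw [Nat.isCoprime_iff_coprime]
    have h1 := Nat.coprime_div_gcd_div_gcd (m := a) (n := b) hg
    change Nat.Coprime (a / g) (b / g) at h1
    rwa [show a / g = a' by rw [ha', Nat.mul_div_cancel_left _ hg],
      show b / g = b' by rw [hb', Nat.mul_div_cancel_left _ hg]] at h1
  have key : ∀ i ∈ ((Finset.range N ×ˢ Finset.range N).filter fun i : ℕ × ℕ =>
      (b : ZMod q) * (c + i.1) = a * (c + i.2)), ∀ j ∈ ((Finset.range N ×ˢ Finset.range N).filter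
      fun i : ℕ × ℕ => (b : ZMod q) * (c + i.1) = a * (c + i.2)),
      (b' : ℤ) * (i.1 - j.1) = a' * (i.2 - j.2) := by
    intro i hi j hj
    simp only [Finset.mem_filter, Finset.mem_product, Finset.mem_range] at hi hj
    have h1 : (q : ℤ) ∣ (b * (i.1 - j.1) - a * (i.2 - j.2) : ℤ) := by
      rw [← ZMod.intCast_zmod_eq_zero_iff_dvd]
      push_cast
      linear_combination hi.2 - hj.2
    have hb1 : ∀ x y : ℕ, 1 ≤ x → x ≤ A → y < N → x * y + A ≤ A * N := fun x y _ h h' => by nlinarith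
    have e1 := hb1 b i.1 hb.1 hb.2 hi.1.1
    have e2 := hb1 b j.1 hb.1 hb.2 hj.1.1
    have e3 := hb1 a i.2 ha.1 ha.2 hi.1.2
    have e4 := hb1 a j.2 ha.1 ha.2 hj.1.2
    have hA : 1 ≤ A := ha.1.trans ha.2
    have h2 : (b * (i.1 - j.1) - a * (i.2 - j.2) : ℤ) = 0 := by
      refine Int.eq_zero_of_abs_lt_dvd h1 ?_
      zify at e1 e2 e3 e4 hq hA
      rw [abs_lt]
      constructor <;> nlinarith
    have h3 : (g : ℤ) * (b' * (i.1 - j.1) - a' * (i.2 - j.2)) = 0 := by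
      rw [← h2, hb', ha']; push_cast; ring
    rcases mul_eq_zero.1 h3 with h | h
    · omega
    · linarith
  have hcard : ((Finset.range N ×ˢ Finset.range N).filter fun i : ℕ × ℕ =>
      (b : ZMod q) * (c + i.1) = a * (c + i.2)).card ≤ (Finset.range (N / a' + 1)).card := by
    refine Finset.card_le_card_of_injOn (fun i => i.1 / a') ?_ ?_
    · intro i hi
      have hi := Finset.mem_coe.1 hi
      simp only [Finset.mem_filter, Finset.mem_product, Finset.mem_range] at hi
      exact Finset.mem_coe.2 (Finset.mem_range.2 (Nat.lt_succ_of_le (Nat.div_le_div_right hi.1.1.le)))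
    · intro i hi j hj hij
      have h1 := key i hi j hj
      obtain ⟨k, hk⟩ : (a' : ℤ) ∣ i.1 - j.1 :=
        hcop.dvd_of_dvd_mul_left (Dvd.intro _ h1.symm)
      have h2 : i.1 = j.1 := by
        have e1 := Nat.div_add_mod i.1 a'
        have e2 := Nat.div_add_mod j.1 a'
        have e3 : i.1 % a' = j.1 % a' := by
          have : (i.1 : ℤ) % a' = j.1 % a' := by
            rw [show (i.1 : ℤ) = j.1 + a' * k by linarith, Int.add_mul_emod_self_left]
          exact_mod_cast this
        simp only at hij
        rw [← e1, ← e2, e3, hij]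
      rw [h2, sub_self, mul_zero] at h1
      have h3 : i.2 = j.2 := by
        rcases mul_eq_zero.1 h1.symm with h | h <;> omega
      exact Prod.ext h2 h3
  rw [Finset.card_range] at hcard
  calc _ ≤ ((N / a' + 1 : ℕ) : ℝ) := by exact_mod_cast hcard
    _ ≤ N / a' + 1 := by push_cast; gcongr; exact Nat.cast_div_le
    _ = _ := by
      have hg' : (g : ℝ) ≠ 0 := by positivity
      have : (a' : ℝ) ≠ 0 := by positivity
      rw [show (a : ℝ) = g * a' by exact_mod_cast ha']
      field_simp

/-- The number of coincidences among the fractions `(c + i) / a`. -/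
lemma card_coincidence_le {q A N : ℕ} {𝒜 : Finset ℕ} (h𝒜 : 𝒜 ⊆ Finset.Icc 1 A)
    (hcop : ∀ a ∈ 𝒜, a.Coprime q) (hAN : A ≤ N) (hq : 2 * A * N ≤ q) {L : ℝ}
    (hL : ∀ a ∈ Finset.Icc 1 A, (a.divisors.card : ℝ) ≤ L) (hL' : 1 + Real.log A ≤ L)
    (hL1 : 1 ≤ L) (c : ZMod q) :
    ((((𝒜 ×ˢ Finset.range N) ×ˢ (𝒜 ×ˢ Finset.range N)).filter
      fun p : (ℕ × ℕ) × (ℕ × ℕ) => (p.1.1 : ZMod q)⁻¹ * (c + p.1.2) = (p.2.1 : ZMod q)⁻¹ * (c + p.2.2)).card : ℝ)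
      ≤ 2 * A * N * L ^ 2 := by
  classical
  have h1 : (((𝒜 ×ˢ Finset.range N) ×ˢ (𝒜 ×ˢ Finset.range N)).filter
      fun p : (ℕ × ℕ) × (ℕ × ℕ) => (p.1.1 : ZMod q)⁻¹ * (c + p.1.2) = (p.2.1 : ZMod q)⁻¹ * (c + p.2.2)).card
      ≤ ∑ a ∈ Finset.Icc 1 A, ∑ b ∈ Finset.Icc 1 A,
        ((Finset.range N ×ˢ Finset.range N).filter fun i : ℕ × ℕ =>
          (b : ZMod q) * (c + i.1) = a * (c + i.2)).card := by
    rw [← Finset.sum_product', ← Finset.card_sigma]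
    refine Finset.card_le_card_of_injOn
      (fun p => ⟨(p.1.1, p.2.1), (p.1.2, p.2.2)⟩) ?_ ?_
    · intro p hp
      have hp := Finset.mem_coe.1 hp
      simp only [Finset.mem_filter, Finset.mem_product] at hp
      refine Finset.mem_coe.2 (Finset.mem_sigma.2 ⟨Finset.mem_product.2
        ⟨h𝒜 hp.1.1.1, h𝒜 hp.1.2.1⟩, Finset.mem_filter.2 ⟨Finset.mem_product.2
        ⟨hp.1.1.2, hp.1.2.2⟩, ?_⟩⟩)
      have e1 := ZMod.coe_mul_inv_eq_one p.1.1 (hcop _ hp.1.1.1)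
      have e2 := ZMod.coe_mul_inv_eq_one p.2.1 (hcop _ hp.1.2.1)
      simp only
      linear_combination (p.1.1 : ZMod q) * p.2.1 * hp.2 - p.2.1 * (c + p.1.2) * e1
        + p.1.1 * (c + p.2.2) * e2
    · rintro ⟨⟨a, i⟩, ⟨b, j⟩⟩ _ ⟨⟨a', i'⟩, ⟨b', j'⟩⟩ _ h
      simp only [Sigma.mk.injEq, Prod.mk.injEq, heq_eq_eq] at h
      simp [h]
  have hA0 : (0 : ℝ) ≤ A := Nat.cast_nonneg _
  have hN0 : (0 : ℝ) ≤ N := Nat.cast_nonneg _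
  calc _ ≤ ∑ a ∈ Finset.Icc 1 A, ∑ b ∈ Finset.Icc 1 A,
        (((Finset.range N ×ˢ Finset.range N).filter fun i : ℕ × ℕ =>
          (b : ZMod q) * (c + i.1) = a * (c + i.2)).card : ℝ) := by exact_mod_cast h1
    _ ≤ ∑ a ∈ Finset.Icc 1 A, ∑ b ∈ Finset.Icc 1 A, ((N : ℝ) * (a.gcd b / a) + 1) :=
      Finset.sum_le_sum fun a ha => Finset.sum_le_sum fun b hb =>
        card_filter_mul_eq_le ha hb hq c
    _ = ∑ a ∈ Finset.Icc 1 A, ((N : ℝ) / a * (∑ b ∈ Finset.Icc 1 A, a.gcd b : ℕ) + A) := by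
      refine Finset.sum_congr rfl fun a _ => ?_
      rw [Finset.sum_add_distrib]
      push_cast
      rw [Finset.mul_sum]
      simp only [Finset.sum_const, Nat.card_Icc, add_tsub_cancel_right, nsmul_eq_mul, mul_one]
      congr 1
      exact Finset.sum_congr rfl fun b _ => by ring
    _ ≤ ∑ a ∈ Finset.Icc 1 A, ((N : ℝ) / a * (A * L) + A) := by
      refine Finset.sum_le_sum fun a ha => ?_
      have h2 := sum_gcd_le a A (Finset.mem_Icc.1 ha).1
      have h3 : ((∑ b ∈ Finset.Icc 1 A, a.gcd b : ℕ) : ℝ) ≤ A * a.divisors.card := by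
        exact_mod_cast h2
      have := hL a ha
      gcongr
      exact h3.trans (by gcongr)
    _ = N * A * L * (harmonic A : ℚ) + A * A := by
      rw [Finset.sum_add_distrib, harmonic_eq_sum_Icc]
      push_cast
      rw [Finset.mul_sum]
      simp only [Finset.sum_const, Nat.card_Icc, add_tsub_cancel_right, nsmul_eq_mul]
      congr 1
      exact Finset.sum_congr rfl fun b _ => by ring
    _ ≤ N * A * L * L + A * N * L ^ 2 := by
      have h4 := (harmonic_le_one_add_log A).trans hL'
      have h5 : (A : ℝ) ≤ N := by exact_mod_cast hAN
      have h6 : 1 ≤ L ^ 2 := one_le_pow₀ hL1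
      have h7 : (A : ℝ) * A ≤ A * N * L ^ 2 := by
        calc (A : ℝ) * A ≤ A * N * 1 := by rw [mul_one]; gcongr
          _ ≤ _ := by gcongr
      have h8 : N * A * L * ((harmonic A : ℚ) : ℝ) ≤ N * A * L * L := by gcongr
      linarith
    _ = _ := by ring

/-- Hölder's inequality for a sum over the image of a map. -/
lemma sum_comp_pow_le {α X : Type*} [Fintype X] [DecidableEq X] (P : Finset α) (f : α → X)
    (g : X → ℝ) (hg : ∀ x, 0 ≤ g x) {r : ℕ} (hr : 0 < r) :
    (∑ p ∈ P, g (f p)) ^ (2 * r) ≤ (P.card : ℝ) ^ (2 * r - 2)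
      * ((P ×ˢ P).filter fun p => f p.1 = f p.2).card * ∑ x, g x ^ (2 * r) := by
  obtain ⟨s, rfl⟩ : ∃ s, r = s + 1 := ⟨r - 1, by omega⟩
  have h1 : (∑ p ∈ P, g (f p)) ^ (s + 1) ≤ (P.card : ℝ) ^ s * ∑ p ∈ P, g (f p) ^ (s + 1) := by
    rcases P.eq_empty_or_nonempty with rfl | hP
    · simp
    have := pow_sum_div_card_le_sum_pow (s := P) (f := fun p => g (f p)) (fun p _ => hg _) s
    rw [div_le_iff₀ (by have := hP.card_pos; positivity)] at this
    linarith
  set ν : X → ℝ := fun x => ((P.filter fun p => f p = x).card : ℝ)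
  have h2 : ∑ p ∈ P, g (f p) ^ (s + 1) = ∑ x, ν x * g x ^ (s + 1) := by
    rw [← Finset.sum_fiberwise P f]
    refine Finset.sum_congr rfl fun x _ => ?_
    rw [Finset.sum_congr rfl fun p hp => by rw [(Finset.mem_filter.1 hp).2], Finset.sum_const,
      nsmul_eq_mul]
  have h3 : (((P ×ˢ P).filter fun p => f p.1 = f p.2).card : ℝ) = ∑ x, ν x ^ 2 := by
    have : ((P ×ˢ P).filter fun p => f p.1 = f p.2).card
        = ∑ x, (P.filter fun p => f p = x).card ^ 2 := by
      rw [Finset.card_eq_sum_card_fiberwise (f := fun p => f p.1) (t := Finset.univ)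
        (fun _ _ => Finset.mem_coe.2 (Finset.mem_univ _))]
      refine Finset.sum_congr rfl fun x _ => ?_
      rw [sq, ← Finset.card_product]
      congr 1
      ext p
      simp only [Finset.mem_filter, Finset.mem_product]
      constructor
      · rintro ⟨⟨⟨a, b⟩, c⟩, d⟩
        exact ⟨⟨a, d⟩, b, c ▸ d⟩
      · rintro ⟨⟨a, b⟩, c, d⟩
        exact ⟨⟨⟨a, c⟩, b.trans d.symm⟩, b⟩
    rw [this]; push_cast; rfl
  have h4 := Finset.sum_mul_sq_le_sq_mul_sq Finset.univ ν (fun x => g x ^ (s + 1))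
  have hpos : 0 ≤ ∑ p ∈ P, g (f p) := Finset.sum_nonneg fun p _ => hg _
  calc (∑ p ∈ P, g (f p)) ^ (2 * (s + 1)) = ((∑ p ∈ P, g (f p)) ^ (s + 1)) ^ 2 := by
        rw [← pow_mul, mul_comm]
    _ ≤ ((P.card : ℝ) ^ s * ∑ p ∈ P, g (f p) ^ (s + 1)) ^ 2 := by gcongr
    _ = (P.card : ℝ) ^ (2 * (s + 1) - 2) * (∑ x, ν x * g x ^ (s + 1)) ^ 2 := by
        rw [h2, mul_pow, ← pow_mul]; congr 2; omega
    _ ≤ (P.card : ℝ) ^ (2 * (s + 1) - 2) * ((∑ x, ν x ^ 2) * ∑ x, (g x ^ (s + 1)) ^ 2) := by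
        gcongr
    _ = _ := by
        rw [h3, mul_assoc]
        congr 3
        exact funext fun x => by rw [← pow_mul, mul_comm]

end Burgess

namespace Burgess

lemma LocallyPrimitive.isPrimitive {q : ℕ} [NeZero q] {χ : DirichletCharacter ℂ q}
    (hχ : LocallyPrimitive q χ) : χ.IsPrimitive := by
  by_contra h
  have hd := χ.conductor_dvd_level
  obtain ⟨m, hm⟩ := hd
  have hm1 : m ≠ 1 := by
    rintro rfl
    exact h (by rw [DirichletCharacter.isPrimitive_def]; omega)
  obtain ⟨p, hp, k, rfl⟩ := Nat.exists_prime_and_dvd hm1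
  obtain ⟨z, hz, hz'⟩ := hχ p hp (by rw [hm]; exact ⟨χ.conductor * k, by ring⟩)
  refine hz' ?_
  have hdiv : q / p = χ.conductor * k := by
    conv_lhs => rw [hm]
    rw [show χ.conductor * (p * k) = p * (χ.conductor * k) by ring, Nat.mul_div_cancel_left _ hp.pos]
  rw [← χ.changeLevel_primitiveCharacter]
  rw [hdiv] at hz ⊢
  have hcop : IsCoprime (1 + (χ.conductor * k : ℕ) * z : ℤ) q := by
    rw [isCoprime_comm]
    exact (ZMod.coe_int_isUnit_iff_isCoprime _ _).1 hz
  rw [DirichletCharacter.changeLevel_eq_cast_of_dvd' _ _ hcop]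
  push_cast
  simp

open ZMod in
lemma norm_gaussSum_eq_sqrt {q : ℕ} [NeZero q] {χ : DirichletCharacter ℂ q}
    (hχ : χ.IsPrimitive) : ‖gaussSum χ ZMod.stdAddChar‖ = √q := by
  have hχ' : (χ⁻¹).IsPrimitive := by
    rw [DirichletCharacter.isPrimitive_def, DirichletCharacter.conductor_inv]; exact hχ
  set G := gaussSum χ ZMod.stdAddChar
  set G' := gaussSum χ⁻¹ ZMod.stdAddChar
  have h1 : 𝓕 χ = fun k => χ⁻¹ (-k) * G := funext hχ.fourierTransform_eq_inv_mul_gaussSum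
  have h2 := congrFun (dft_dft (χ : ZMod q → ℂ)) (-1)
  rw [h1] at h2
  rw [dft_mul_const, dft_comp_neg] at h2
  simp only [neg_neg, map_one, smul_eq_mul, mul_one] at h2
  rw [hχ'.fourierTransform_eq_inv_mul_gaussSum, inv_inv] at h2
  have h9 : ‖χ (-1)‖ = 1 := by
    have := DirichletCharacter.unit_norm_eq_one χ (-1)
    rwa [Units.val_neg, Units.val_one] at this
  have h3 : ‖G'‖ = ‖G‖ := by
    have h4 : star G = χ (-1) * G' := by
      have h5 := hχ'.fourierTransform_eq_inv_mul_gaussSum 1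
      rw [inv_inv] at h5
      have h7 : star G = 𝓕 ((χ⁻¹ : DirichletCharacter ℂ q) : ZMod q → ℂ) 1 := by
        rw [dft_apply, show G = ∑ x : ZMod q, χ x * ZMod.stdAddChar x from rfl, star_sum]
        refine Finset.sum_congr rfl fun x _ => ?_
        rw [star_mul', MulChar.star_apply', mul_one, smul_eq_mul, mul_comm, AddChar.map_neg_eq_conj]
        rfl
      rw [h7, h5]
    rw [← norm_star G, h4, norm_mul, h9, one_mul]
  have h4 : ‖G‖ ^ 2 = q := by
    have := congrArg norm h2
    rw [norm_mul, norm_mul, h9, one_mul, norm_natCast] at this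
    change ‖G'‖ * ‖G‖ = q at this
    rwa [h3, ← sq] at this
  rw [← h4, Real.sqrt_sq (norm_nonneg _)]

lemma mul_one_sub_le_sin {t : ℝ} (h0 : 0 ≤ t) (h1 : t ≤ 1) :
    2 * t * (1 - t) ≤ Real.sin (Real.pi * t) := by
  wlog h : t ≤ 1 / 2 generalizing t
  · have := this (t := 1 - t) (by linarith) (by linarith) (by linarith)
    rw [show Real.pi * (1 - t) = Real.pi - Real.pi * t by ring, Real.sin_pi_sub] at this
    linarith
  have h2 := Real.mul_le_sin (x := Real.pi * t) (by positivity) (by nlinarith [Real.pi_pos])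
  rw [show 2 / Real.pi * (Real.pi * t) = 2 * t by field_simp] at h2
  nlinarith

lemma norm_geom_sum_stdAddChar_le {q : ℕ} [NeZero q] {k : ℕ} (hk0 : 0 < k) (hk : k < q) (N : ℕ) :
    ‖∑ i ∈ Finset.range N, ZMod.stdAddChar ((k : ZMod q)) ^ i‖
      ≤ q / 2 * (1 / (k : ℝ) + 1 / ((q - k : ℕ) : ℝ)) := by
  set w := ZMod.stdAddChar (k : ZMod q)
  have hq : (0 : ℝ) < q := by exact_mod_cast hk0.trans hk
  have hk' : (0 : ℝ) < k := by exact_mod_cast hk0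
  have hkq : (k : ℝ) < q := by exact_mod_cast hk
  have hw : ‖w‖ = 1 := AddChar.norm_apply _ _
  have hw1 : 2 * (2 * (k / q : ℝ) * (1 - k / q)) ≤ ‖w - 1‖ := by
    have h1 := ZMod.stdAddChar_coe (N := q) (k : ℤ)
    rw [Int.cast_natCast] at h1
    have h2 := mul_one_sub_le_sin (t := k / q) (by positivity) (by rw [div_le_one hq]; exact hkq.le)
    have h3 := Complex.norm_exp_I_mul_ofReal_sub_one (2 * (Real.pi * (k / q)))
    rw [show w = Complex.exp (Complex.I * (2 * (Real.pi * (k / q)) : ℝ)) by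
      refine Eq.trans h1 ?_; congr 1; push_cast; ring, h3, Real.norm_eq_abs]
    refine le_trans ?_ (le_abs_self _)
    rw [show 2 * (Real.pi * (k / q : ℝ)) / 2 = Real.pi * (k / q) by ring]
    linarith
  have hpos : 0 < 2 * (2 * (k / q : ℝ) * (1 - k / q)) := by
    have : (k / q : ℝ) < 1 := by rw [div_lt_one hq]; exact hkq
    have : 0 < (1 - k / q : ℝ) := by linarith
    positivity
  have hw2 : w ≠ 1 := fun h => by rw [h, sub_self, norm_zero] at hw1; linarith
  rw [geom_sum_eq hw2, norm_div]
  have h4 : ‖w ^ N - 1‖ ≤ 2 := by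
    refine (norm_sub_le _ _).trans ?_
    rw [norm_pow, hw, one_pow, norm_one]; norm_num
  calc _ ≤ 2 / (2 * (2 * (k / q : ℝ) * (1 - k / q))) := by gcongr
    _ = _ := by
      rw [Nat.cast_sub hk.le]
      have : (q - k : ℝ) ≠ 0 := by linarith
      field_simp
      ring

/-- The Pólya–Vinogradov inequality. -/
lemma norm_sum_range_le_sqrt_mul_log {q : ℕ} [NeZero q] (hq : 1 < q)
    {χ : DirichletCharacter ℂ q} (hχ : χ.IsPrimitive) (c : ZMod q) (N : ℕ) :
    ‖∑ i ∈ Finset.range N, χ (c + i)‖ ≤ √q * (1 + Real.log q) := by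
  set G := gaussSum χ ZMod.stdAddChar
  have hq0 : (0 : ℝ) < q := by exact_mod_cast NeZero.pos q
  have h1 : ∀ x : ZMod q, χ x
      = (q : ℂ)⁻¹ * ∑ k : ZMod q, ZMod.stdAddChar (k * x) * (χ⁻¹ (-k) * G) := by
    intro x
    have := congrFun (ZMod.dft.symm_apply_apply (χ : ZMod q → ℂ)) x
    rw [ZMod.invDFT_apply] at this
    rw [← this, smul_eq_mul]
    congr 1
    refine Finset.sum_congr rfl fun k _ => ?_
    rw [hχ.fourierTransform_eq_inv_mul_gaussSum, smul_eq_mul]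
  have h2 : ∑ i ∈ Finset.range N, χ (c + i) = (q : ℂ)⁻¹ * ∑ k : ZMod q,
      (ZMod.stdAddChar (k * c) * (χ⁻¹ (-k) * G))
        * ∑ i ∈ Finset.range N, ZMod.stdAddChar k ^ i := by
    simp_rw [h1, ← Finset.mul_sum]
    rw [Finset.sum_comm]
    congr 1
    refine Finset.sum_congr rfl fun k _ => ?_
    rw [Finset.mul_sum]
    refine Finset.sum_congr rfl fun i _ => ?_
    rw [mul_add, AddChar.map_add_eq_mul, mul_comm k (i : ZMod q), ← nsmul_eq_mul,
      AddChar.map_nsmul_eq_pow]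
    ring
  have h3 : ∀ k : ZMod q, ‖(ZMod.stdAddChar (k * c) * (χ⁻¹ (-k) * G))
        * ∑ i ∈ Finset.range N, ZMod.stdAddChar k ^ i‖
      ≤ if k = 0 then 0 else √q * ‖∑ i ∈ Finset.range N, ZMod.stdAddChar k ^ i‖ := by
    intro k
    split_ifs with hk
    · have : Fact (1 < q) := ⟨hq⟩
      rw [hk, neg_zero, MulChar.map_zero]; simp
    · rw [norm_mul, norm_mul, norm_mul, AddChar.norm_apply, one_mul, norm_gaussSum_eq_sqrt hχ]
      gcongr
      exact mul_le_of_le_one_left (Real.sqrt_nonneg _) (norm_mulChar_le_one _ _)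
  have h4 : ∑ k : ZMod q, (if k = 0 then 0 else
      √q * ‖∑ i ∈ Finset.range N, ZMod.stdAddChar k ^ i‖)
      = ∑ k ∈ Finset.Icc 1 (q - 1), √q * ‖∑ i ∈ Finset.range N, ZMod.stdAddChar (k : ZMod q) ^ i‖ := by
    rw [Finset.sum_ite, Finset.sum_const_zero, zero_add]
    refine Finset.sum_nbij' ZMod.val (fun k => (k : ZMod q)) ?_ ?_ ?_ ?_ ?_
    · intro k hk
      have h5 := (ZMod.val_ne_zero k).2 (Finset.mem_filter.1 hk).2
      have h6 := ZMod.val_lt k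
      rw [Finset.mem_Icc]
      omega
    · intro k hk
      rw [Finset.mem_Icc] at hk
      refine Finset.mem_filter.2 ⟨Finset.mem_univ _, fun h => ?_⟩
      have := Nat.le_of_dvd hk.1 ((ZMod.natCast_eq_zero_iff k q).1 h)
      omega
    · intro k _
      exact ZMod.natCast_zmod_val k
    · intro k hk
      rw [Finset.mem_Icc] at hk
      exact ZMod.val_cast_of_lt (by omega)
    · intro k _
      rw [ZMod.natCast_zmod_val k]
  have h5 : ∑ k ∈ Finset.Icc 1 (q - 1), (1 / (k : ℝ) + 1 / ((q - k : ℕ) : ℝ))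
      ≤ 2 * (1 + Real.log q) := by
    have h6 : ∑ k ∈ Finset.Icc 1 (q - 1), 1 / (k : ℝ) ≤ 1 + Real.log q := by
      have h7 := harmonic_le_one_add_log (q - 1)
      rw [harmonic_eq_sum_Icc] at h7
      push_cast at h7
      simp only [one_div]
      refine h7.trans ?_
      have : (0 : ℝ) < (q - 1 : ℕ) := by
        have : 0 < q - 1 := by omega
        exact_mod_cast this
      gcongr
      exact Nat.sub_le _ _
    have h7 : ∑ k ∈ Finset.Icc 1 (q - 1), 1 / ((q - k : ℕ) : ℝ)
        = ∑ k ∈ Finset.Icc 1 (q - 1), 1 / (k : ℝ) := by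
      refine Finset.sum_nbij' (fun k => q - k) (fun k => q - k) ?_ ?_ ?_ ?_ ?_ <;>
      · intro k hk
        simp only [Finset.mem_Icc] at hk ⊢
        first | done | rfl | omega
    rw [Finset.sum_add_distrib, h7]
    linarith
  rw [h2, norm_mul, norm_inv, Complex.norm_natCast]
  calc (q : ℝ)⁻¹ * _ ≤ (q : ℝ)⁻¹ * ∑ k ∈ Finset.Icc 1 (q - 1),
        √q * ‖∑ i ∈ Finset.range N, ZMod.stdAddChar (k : ZMod q) ^ i‖ := by
        gcongr
        exact (norm_sum_le _ _).trans ((Finset.sum_le_sum fun k _ => h3 k).trans_eq h4)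
    _ ≤ (q : ℝ)⁻¹ * ∑ k ∈ Finset.Icc 1 (q - 1),
        √q * (q / 2 * (1 / (k : ℝ) + 1 / ((q - k : ℕ) : ℝ))) := by
        gcongr with k hk
        rw [Finset.mem_Icc] at hk
        exact norm_geom_sum_stdAddChar_le (by omega) (by omega) N
    _ = √q / 2 * ∑ k ∈ Finset.Icc 1 (q - 1), (1 / (k : ℝ) + 1 / ((q - k : ℕ) : ℝ)) := by
        rw [← Finset.mul_sum, ← Finset.mul_sum]
        field_simp
    _ ≤ √q / 2 * (2 * (1 + Real.log q)) := by gcongr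
    _ = _ := by ring

end Burgess

namespace Burgess

/-- The sum of `χ` over `N` consecutive residues. -/
noncomputable def intervalSum {q : ℕ} (χ : DirichletCharacter ℂ q) (c : ZMod q) (N : ℕ) : ℂ :=
  ∑ i ∈ Finset.range N, χ (c + i)

lemma norm_intervalSum_le {q : ℕ} [NeZero q] (χ : DirichletCharacter ℂ q) (c : ZMod q) (N : ℕ) :
    ‖intervalSum χ c N‖ ≤ N := by
  refine (norm_sum_le _ _).trans ((Finset.sum_le_sum fun x _ => norm_mulChar_le_one χ _).trans ?_)
  simp

lemma intervalSum_add {q : ℕ} (χ : DirichletCharacter ℂ q) (c : ZMod q) (N h : ℕ) :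
    intervalSum χ c (N + h) = intervalSum χ c N + intervalSum χ (c + N) h := by
  rw [intervalSum, Finset.sum_range_add]
  simp only [intervalSum, Nat.cast_add, add_assoc]

lemma intervalSum_shift {q : ℕ} (χ : DirichletCharacter ℂ q) (c : ZMod q) (N h : ℕ) :
    intervalSum χ c N
      = intervalSum χ (c + h) N + (intervalSum χ c h - intervalSum χ (c + N) h) := by
  have h1 := intervalSum_add χ c N h
  have h2 := intervalSum_add χ c h N
  rw [add_comm h N] at h2
  linear_combination h2 - h1

/-- Averaging an interval sum over multiplicative shifts `a * b`. -/
lemma card_mul_norm_intervalSum_le {q : ℕ} [NeZero q] (χ : DirichletCharacter ℂ q)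
    (𝒜 : Finset ℕ) (hcop : ∀ a ∈ 𝒜, a.Coprime q) (A B N : ℕ) (h𝒜 : 𝒜 ⊆ Finset.Icc 1 A)
    (c : ZMod q) {E : ℝ} (hE : ∀ c' : ZMod q, ∀ h ≤ A * B, ‖intervalSum χ c' h‖ ≤ E) :
    (𝒜.card * B : ℝ) * (‖intervalSum χ c N‖ - 2 * E) ≤
      ∑ p ∈ 𝒜 ×ˢ Finset.range N,
        ‖∑ b ∈ Finset.range B, χ ((p.1 : ZMod q)⁻¹ * (c + p.2) + b)‖ := by
  have h1 : (𝒜.card * B : ℂ) * intervalSum χ c N = ∑ a ∈ 𝒜, ∑ b ∈ Finset.range B,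
      (intervalSum χ (c + (a * b : ℕ)) N
        + (intervalSum χ c (a * b) - intervalSum χ (c + N) (a * b))) := by
    simp_rw [← intervalSum_shift]
    simp only [Finset.sum_const, Finset.card_range, nsmul_eq_mul]
    ring
  have h2 : ∑ a ∈ 𝒜, ∑ b ∈ Finset.range B, intervalSum χ (c + (a * b : ℕ)) N
      = ∑ p ∈ 𝒜 ×ˢ Finset.range N, χ p.1 *
        ∑ b ∈ Finset.range B, χ ((p.1 : ZMod q)⁻¹ * (c + p.2) + b) := by
    rw [Finset.sum_product]
    refine Finset.sum_congr rfl fun a ha => ?_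
    simp only [intervalSum]
    rw [Finset.sum_comm]
    refine Finset.sum_congr rfl fun i _ => ?_
    rw [Finset.mul_sum]
    refine Finset.sum_congr rfl fun b _ => ?_
    rw [← map_mul]
    congr 1
    have := ZMod.coe_mul_inv_eq_one a (hcop _ ha)
    push_cast
    linear_combination -(c + i) * this
  have h3 : ‖(𝒜.card * B : ℂ) * intervalSum χ c N‖ ≤
      ∑ p ∈ 𝒜 ×ˢ Finset.range N, ‖∑ b ∈ Finset.range B, χ ((p.1 : ZMod q)⁻¹ * (c + p.2) + b)‖
      + 𝒜.card * B * (2 * E) := by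
    rw [h1]
    simp_rw [Finset.sum_add_distrib]
    rw [h2]
    refine (norm_add_le _ _).trans (add_le_add ?_ ?_)
    · refine (norm_sum_le _ _).trans (Finset.sum_le_sum fun p _ => ?_)
      rw [norm_mul]
      exact mul_le_of_le_one_left (norm_nonneg _) (norm_mulChar_le_one _ _)
    · refine (norm_sum_le _ _).trans ((Finset.sum_le_sum (g := fun _ => B * (2 * E)) fun a ha =>
        (norm_sum_le _ _).trans ((Finset.sum_le_sum (g := fun _ => 2 * E) fun b hb => ?_).trans_eq
          ?_)).trans_eq ?_)
      · have h4 : a * b ≤ A * B := Nat.mul_le_mul (Finset.mem_Icc.1 (h𝒜 ha)).2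
          (Finset.mem_range.1 hb).le
        refine (norm_sub_le _ _).trans ?_
        linarith [hE c _ h4, hE (c + N) _ h4]
      · simp
      · simp [mul_assoc]
  rw [norm_mul, norm_mul, Complex.norm_natCast, Complex.norm_natCast] at h3
  linarith

/-- The constant of the moment estimate. -/
noncomputable def momentConst (r : ℕ) : ℝ := (r : ℝ) ^ (2 * r) + 2 * r * 4 ^ r

lemma one_le_momentConst {r : ℕ} (hr : 0 < r) : 1 ≤ momentConst r := by
  have h1 : (1 : ℝ) ≤ r := by exact_mod_cast hr
  have h2 : (1 : ℝ) ≤ (r : ℝ) ^ (2 * r) := one_le_pow₀ h1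
  have : (0 : ℝ) ≤ 2 * r * 4 ^ r := by positivity
  rw [momentConst]; linarith

/-- One step of Burgess' method: a bound for an interval sum, given one for shorter sums. -/
lemma exists_intervalSum_moment_le {q : ℕ} [NeZero q] (hq : ∀ p : ℕ, p.Prime → ¬ p ^ 3 ∣ q)
    {χ : DirichletCharacter ℂ q} (hχ : LocallyPrimitive q χ) {r : ℕ} (hr : 0 < r) {A B N : ℕ}
    (hAN : A ≤ N) (hANq : 2 * A * N ≤ q) (hAq : A ≤ q) (hτ : 2 * q.divisors.card ^ 2 ≤ A) {L : ℝ}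
    (hL : ∀ a ∈ Finset.Icc 1 q, (a.divisors.card : ℝ) ≤ L) (hL' : 1 + Real.log q ≤ L)
    (c : ZMod q) {E : ℝ} (hE : ∀ c' : ZMod q, ∀ h ≤ A * B, ‖intervalSum χ c' h‖ ≤ E) :
    ∃ s m : ℝ, A / (2 * L) ≤ s ∧ 0 ≤ m ∧ s * B * (‖intervalSum χ c N‖ - 2 * E) ≤ m ∧
      m ^ (2 * r) ≤ (s * N) ^ (2 * r - 2) * (2 * A * N * L ^ 2) *
        (momentConst r * L ^ (4 * r) * (q * (B : ℝ) ^ r + √q * (B : ℝ) ^ (2 * r))) := by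
  have hq0 : 0 < q := NeZero.pos q
  have hlogq : 0 ≤ Real.log q := Real.log_natCast_nonneg q
  have hτL : (q.divisors.card : ℝ) ≤ L := hL q (Finset.mem_Icc.2 ⟨hq0, le_rfl⟩)
  have hτ0 : 0 < q.divisors.card := Finset.card_pos.2 ⟨1, Nat.one_mem_divisors.2 hq0.ne'⟩
  have hA : 0 < A := lt_of_lt_of_le (by positivity) hτ
  set 𝒜 := (Finset.Icc 1 A).filter fun a => a.Coprime q
  have h𝒜 : 𝒜 ⊆ Finset.Icc 1 A := Finset.filter_subset _ _
  have hcop : ∀ a ∈ 𝒜, a.Coprime q := fun a ha => (Finset.mem_filter.1 ha).2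
  refine ⟨𝒜.card, _, ?_, ?_, card_mul_norm_intervalSum_le χ 𝒜 hcop A B N h𝒜 c hE, ?_⟩
  · refine le_trans ?_ (le_card_coprime hq0 hτ)
    gcongr
  · exact Finset.sum_nonneg fun _ _ => norm_nonneg _
  · refine (sum_comp_pow_le (𝒜 ×ˢ Finset.range N)
      (fun p : ℕ × ℕ => (p.1 : ZMod q)⁻¹ * (c + p.2))
      (fun x => ‖∑ b ∈ Finset.range B, χ (x + b)‖) (fun _ => norm_nonneg _) hr).trans ?_
    have h1 := card_coincidence_le h𝒜 hcop hAN hANq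
      (fun a ha => hL a (Finset.Icc_subset_Icc_right hAq ha))
      (le_trans (by gcongr) hL') (by linarith) c
    have h2 := moment_le hq hχ hr B
    have h3 : ∑ x : ZMod q, ‖∑ b ∈ Finset.range B, χ (x + b)‖ ^ (2 * r) ≤
        momentConst r * L ^ (4 * r) * (q * (B : ℝ) ^ r + √q * (B : ℝ) ^ (2 * r)) := by
      refine h2.trans ?_
      have := one_le_momentConst hr
      rw [← momentConst]
      gcongr
    rw [Finset.card_product, Finset.card_range, Nat.cast_mul]
    gcongr

end Burgess

namespace Burgess

lemma burgess_numeric {r : ℕ} (hr : 0 < r) {y B s A N L C : ℝ} (hB : 0 < B) (hBy : B ≤ y)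
    (hyB : y ≤ 2 * B) (hs : A / (2 * L) ≤ s) (hA : N / (32 * B) ≤ A) (hN : 0 < N) (hL : 1 ≤ L)
    (hC : 1 ≤ C) :
    (s * N) ^ (2 * r - 2) * (2 * A * N * L ^ 2) *
      (C * L ^ (4 * r) * (y ^ (2 * r) * B ^ r + y ^ r * B ^ (2 * r))) ≤
    (s * B) ^ (2 * r) * (256 * C * (2 ^ r + 1)) ^ (2 * r) * L ^ (8 * r) * y ^ (r + 1)
      * N ^ (2 * r - 2) := by
  obtain ⟨t, rfl⟩ : ∃ t, r = t + 1 := ⟨r - 1, by omega⟩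
  have hy : 0 < y := hB.trans_le hBy
  have hL0 : 0 < L := by linarith
  have hA0 : 0 < A := lt_of_lt_of_le (by positivity) hA
  have hs0 : 0 < s := lt_of_lt_of_le (by positivity) hs
  rw [show 2 * (t + 1) - 2 = 2 * t by omega]
  set D : ℝ := 256 * C * (2 ^ (t + 1) + 1)
  have hD1 : 1 ≤ D := by
    have : (0 : ℝ) ≤ 2 ^ (t + 1) := by positivity
    nlinarith
  have h1 : y ^ (2 * (t + 1)) * B ^ (t + 1) + y ^ (t + 1) * B ^ (2 * (t + 1))
      ≤ (2 ^ (t + 1) + 1) * (y ^ (t + 1) * B ^ (2 * (t + 1))) := by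
    have h2 : y ^ (t + 1) ≤ 2 ^ (t + 1) * B ^ (t + 1) := by
      rw [← mul_pow]; gcongr
    have h3 : y ^ (2 * (t + 1)) * B ^ (t + 1) ≤ 2 ^ (t + 1) * (y ^ (t + 1) * B ^ (2 * (t + 1))) := by
      calc y ^ (2 * (t + 1)) * B ^ (t + 1) = y ^ (t + 1) * y ^ (t + 1) * B ^ (t + 1) := by ring
        _ ≤ y ^ (t + 1) * (2 ^ (t + 1) * B ^ (t + 1)) * B ^ (t + 1) := by gcongr
        _ = _ := by ring
    linarith
  have h4 : N ≤ 32 * A * y := by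
    rw [div_le_iff₀ (by positivity)] at hA
    nlinarith
  have h5 : A ^ 2 ≤ 4 * L ^ 2 * s ^ 2 := by
    rw [div_le_iff₀ (by positivity)] at hs
    calc A ^ 2 ≤ (s * (2 * L)) ^ 2 := by gcongr
      _ = _ := by ring
  calc (s * N) ^ (2 * t) * (2 * A * N * L ^ 2) * (C * L ^ (4 * (t + 1)) *
        (y ^ (2 * (t + 1)) * B ^ (t + 1) + y ^ (t + 1) * B ^ (2 * (t + 1))))
      ≤ (s * N) ^ (2 * t) * (2 * A * (32 * A * y) * L ^ 2) * (C * L ^ (4 * (t + 1)) *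
        ((2 ^ (t + 1) + 1) * (y ^ (t + 1) * B ^ (2 * (t + 1))))) := by gcongr
    _ = (s * N) ^ (2 * t) * (64 * A ^ 2 * y * L ^ 2) * (C * L ^ (4 * (t + 1)) *
        ((2 ^ (t + 1) + 1) * (y ^ (t + 1) * B ^ (2 * (t + 1))))) := by ring
    _ ≤ (s * N) ^ (2 * t) * (64 * (4 * L ^ 2 * s ^ 2) * y * L ^ 2) * (C * L ^ (4 * (t + 1)) *
        ((2 ^ (t + 1) + 1) * (y ^ (t + 1) * B ^ (2 * (t + 1))))) := by gcongr
    _ = (s * B) ^ (2 * (t + 1)) * D * L ^ (4 * t + 8) * y ^ (t + 1 + 1) * N ^ (2 * t) := by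
      simp only [D]; ring
    _ ≤ _ := by
      gcongr
      · exact le_self_pow₀ hD1 (by omega)
      · omega

set_option maxHeartbeats 1000000 in
/-- Burgess' bound for primitive characters to cubefree moduli. -/
lemma norm_intervalSum_le_burgess {r : ℕ} (hr : 0 < r) {q : ℕ} [NeZero q] (hq1 : 1 < q)
    (hq : ∀ p : ℕ, p.Prime → ¬ p ^ 3 ∣ q) {χ : DirichletCharacter ℂ q}
    (hχ : LocallyPrimitive q χ) {L : ℝ}
    (hL : ∀ a ∈ Finset.Icc 1 q, (a.divisors.card : ℝ) ≤ L) (hL' : 1 + Real.log q ≤ L)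
    (c : ZMod q) (N : ℕ) :
    ‖intervalSum χ c N‖ ≤ 512 * momentConst r * (2 ^ r + 1) * L ^ 4 *
      (q : ℝ) ^ (((r : ℝ) + 1) / (4 * (r : ℝ) ^ 2)) * (N : ℝ) ^ (1 - (r : ℝ)⁻¹) := by
  have hC := one_le_momentConst hr
  set D : ℝ := 256 * momentConst r * (2 ^ r + 1)
  have h2r : (0 : ℝ) ≤ 2 ^ r := by positivity
  have hD : 256 ≤ D := by nlinarith
  have hq0 : (1 : ℝ) ≤ q := by exact_mod_cast hq1.le
  have hq0' : (0 : ℝ) < q := by linarith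
  have hlogq : 0 ≤ Real.log q := Real.log_natCast_nonneg q
  have hL1 : 1 ≤ L := by linarith
  have hL0 : 0 < L := by linarith
  have hτL : (q.divisors.card : ℝ) ≤ L := hL q (Finset.mem_Icc.2 ⟨by omega, le_rfl⟩)
  have hr0 : (0 : ℝ) < r := by exact_mod_cast hr
  have hr1 : (1 : ℝ) ≤ r := by exact_mod_cast hr
  have hrinv : (r : ℝ)⁻¹ ≤ 1 := inv_le_one_of_one_le₀ hr1
  set α : ℝ := ((r : ℝ) + 1) / (4 * (r : ℝ) ^ 2)
  set Q : ℝ := 512 * momentConst r * (2 ^ r + 1) * L ^ 4 * (q : ℝ) ^ α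
  have hQ : Q = 2 * D * L ^ 4 * (q : ℝ) ^ α := by simp only [Q, D]; ring
  have hQ0 : 0 < Q := by rw [hQ]; positivity
  have hPV : ∀ c N, ‖intervalSum χ c N‖ ≤ √q * L := fun c N =>
    (norm_sum_range_le_sqrt_mul_log hq1 hχ.isPrimitive c N).trans (by gcongr)
  set y : ℝ := (q : ℝ) ^ (1 / (2 * r) : ℝ)
  have hy1 : 1 ≤ y := Real.one_le_rpow hq0 (by positivity)
  have hyr : y ^ r = √q := by
    rw [← Real.rpow_natCast, ← Real.rpow_mul hq0'.le, Real.sqrt_eq_rpow]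
    congr 1; field_simp
  have hy2r : y ^ (2 * r) = q := by
    rw [mul_comm, pow_mul, hyr, Real.sq_sqrt hq0'.le]
  have hαy : ((q : ℝ) ^ α) ^ (2 * r) = y ^ (r + 1) := by
    rw [← Real.rpow_natCast, ← Real.rpow_mul hq0'.le, ← Real.rpow_natCast,
      ← Real.rpow_mul hq0'.le]
    congr 1
    push_cast
    simp only [α]
    field_simp
    norm_num
  induction N using Nat.strong_induction_on generalizing c with
  | _ N ih =>
  rcases Nat.eq_zero_or_pos N with rfl | hN
  · simp only [intervalSum, Finset.range_zero, Finset.sum_empty, norm_zero]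
    positivity
  have hN0 : (0 : ℝ) < N := by exact_mod_cast hN
  rcases le_or_gt (N : ℝ) (Q ^ r) with hNQ | hNQ
  · calc ‖intervalSum χ c N‖ ≤ N := norm_intervalSum_le χ c N
      _ = (N : ℝ) ^ ((r : ℝ)⁻¹) * (N : ℝ) ^ (1 - (r : ℝ)⁻¹) := by
        rw [← Real.rpow_add hN0]; simp
      _ ≤ Q * (N : ℝ) ^ (1 - (r : ℝ)⁻¹) := by
        gcongr
        calc (N : ℝ) ^ ((r : ℝ)⁻¹) ≤ (Q ^ r) ^ ((r : ℝ)⁻¹) := by gcongr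
          _ = Q := Real.pow_rpow_inv_natCast hQ0.le hr.ne'
  have hPVQ : √q ≤ (q : ℝ) ^ α * (N : ℝ) ^ (1 - (r : ℝ)⁻¹) →
      ‖intervalSum χ c N‖ ≤ Q * (N : ℝ) ^ (1 - (r : ℝ)⁻¹) := by
    intro h
    calc _ ≤ √q * L := hPV c N
      _ ≤ (q : ℝ) ^ α * (N : ℝ) ^ (1 - (r : ℝ)⁻¹) * (2 * D * L ^ 4) := by
        gcongr
        have h4 : L ≤ L ^ 4 := le_self_pow₀ hL1 (by norm_num)
        nlinarith
      _ = _ := by rw [hQ]; ring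
  rcases Nat.lt_or_ge r 2 with hr2 | hr2
  · obtain rfl : r = 1 := by omega
    refine hPVQ (le_of_eq ?_)
    rw [Real.sqrt_eq_rpow]
    simp only [α]
    norm_num
  rcases le_or_gt ((q : ℝ) ^ (1 / 2 + 1 / (4 * r) : ℝ)) N with hNq | hNq
  · refine hPVQ ?_
    calc √q = (q : ℝ) ^ α * ((q : ℝ) ^ (1 / 2 + 1 / (4 * r) : ℝ)) ^ (1 - (r : ℝ)⁻¹) := by
          rw [← Real.rpow_mul hq0'.le, ← Real.rpow_add hq0', Real.sqrt_eq_rpow]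
          congr 1
          simp only [α]
          field_simp
          ring
      _ ≤ _ := by
        have : 0 ≤ 1 - (r : ℝ)⁻¹ := by linarith
        gcongr
  set B := ⌊y⌋₊
  have hB1 : 1 ≤ B := (Nat.one_le_floor_iff y).2 hy1
  have hB0 : (1 : ℝ) ≤ B := by exact_mod_cast hB1
  have hBy : (B : ℝ) ≤ y := Nat.floor_le (by linarith)
  have hyB : y ≤ 2 * B := by
    have := Nat.lt_floor_add_one y
    change y < B + 1 at this
    linarith
  have hNB : 48 * L ^ 2 * (B : ℝ) ≤ (N : ℝ) := by
    have h1 : Q ^ r = (2 * D * L ^ 4) ^ r * ((q : ℝ) ^ α) ^ r := by rw [hQ, mul_pow]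
    have h2 : 48 * L ^ 2 ≤ (2 * D * L ^ 4) ^ r := by
      have h3 : 48 * L ^ 2 ≤ 2 * D * L ^ 4 := by
        have h4 : L ^ 2 ≤ L ^ 4 := pow_le_pow_right₀ hL1 (by norm_num)
        have : 0 ≤ L ^ 2 := by positivity
        nlinarith
      have h5 : 1 ≤ L ^ 2 := one_le_pow₀ hL1
      exact h3.trans (le_self_pow₀ (by linarith) hr.ne')
    have h3 : y ≤ ((q : ℝ) ^ α) ^ r := by
      rw [← Real.rpow_natCast, ← Real.rpow_mul hq0'.le]
      refine Real.rpow_le_rpow_of_exponent_le hq0 ?_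
      simp only [α]
      rw [div_mul_eq_mul_div, div_le_div_iff₀ (by positivity) (by positivity)]
      nlinarith
    calc 48 * L ^ 2 * (B : ℝ) ≤ (2 * D * L ^ 4) ^ r * ((q : ℝ) ^ α) ^ r := by
          gcongr; exact hBy.trans h3
      _ ≤ (N : ℝ) := by rw [← h1]; exact hNQ.le
  set A := N / (16 * B)
  have hA1 : (A : ℝ) ≤ N / (16 * B) := by
    have := Nat.cast_div_le (α := ℝ) (m := N) (n := 16 * B)
    push_cast at this
    exact this
  have hA2 : (N : ℝ) / (16 * B) - 1 ≤ A := by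
    have := Nat.lt_div_mul_add (a := N) (b := 16 * B) (by omega)
    have h1 : (N : ℝ) ≤ A * (16 * B) + 16 * B := by exact_mod_cast this.le
    rw [sub_le_iff_le_add, div_le_iff₀ (by positivity)]
    linarith
  have hNB' : 3 * L ^ 2 ≤ N / (16 * B) := by
    rw [le_div_iff₀ (by positivity)]; linarith
  have hL2 : 1 ≤ L ^ 2 := one_le_pow₀ hL1
  have hA3 : (N : ℝ) / (32 * B) ≤ A := by
    have : (N : ℝ) / (32 * B) = N / (16 * B) / 2 := by field_simp; norm_num
    rw [this]; linarith
  have hτA : 2 * q.divisors.card ^ 2 ≤ A := by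
    have : (2 * (q.divisors.card : ℝ) ^ 2) ≤ A := by
      have : (q.divisors.card : ℝ) ^ 2 ≤ L ^ 2 := by gcongr
      linarith
    exact_mod_cast this
  have hN2 : (N : ℝ) * N ≤ q * y := by
    calc (N : ℝ) * N ≤ (q : ℝ) ^ (1 / 2 + 1 / (4 * r) : ℝ) * (q : ℝ) ^ (1 / 2 + 1 / (4 * r) : ℝ) := by
          gcongr
      _ = (q : ℝ) ^ (1 + 1 / (2 * r) : ℝ) := by
        rw [← Real.rpow_add hq0']; congr 1; field_simp; ring
      _ = _ := by rw [Real.rpow_add hq0', Real.rpow_one]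
  have hANq : 2 * A * N ≤ q := by
    have : 2 * (A : ℝ) * N ≤ q := by
      calc 2 * (A : ℝ) * N ≤ 2 * (N / (16 * B)) * N := by gcongr
        _ = N * N / (8 * B) := by field_simp; norm_num
        _ ≤ q * (2 * B) / (8 * B) := by
          have hN3 : (N : ℝ) * N ≤ q * (2 * B) := hN2.trans (by gcongr)
          gcongr
        _ = q / 4 := by field_simp; norm_num
        _ ≤ q := by linarith
    exact_mod_cast this
  have hAN : A ≤ N := Nat.div_le_self _ _
  have hAq : A ≤ q := by
    have := Nat.le_mul_of_pos_right A hN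
    rw [mul_assoc] at hANq
    omega
  have hAB : A * B ≤ N / 16 := by
    rw [Nat.le_div_iff_mul_le (by norm_num)]
    calc A * B * 16 = A * (16 * B) := by ring
      _ ≤ N := Nat.div_mul_le_self _ _
  have hE : ∀ c' : ZMod q, ∀ h ≤ A * B,
      ‖intervalSum χ c' h‖ ≤ Q * (N : ℝ) ^ (1 - (r : ℝ)⁻¹) / 4 := by
    intro c' h hh
    refine (ih h (by omega) c').trans ?_
    have hh' : (h : ℝ) ≤ N / 16 := by
      have : h * 16 ≤ N := by omega
      have : (h : ℝ) * 16 ≤ N := by exact_mod_cast this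
      linarith
    have hr2' : (2 : ℝ) ≤ r := by exact_mod_cast hr2
    have he : (1 / 2 : ℝ) ≤ 1 - (r : ℝ)⁻¹ := by
      have : (r : ℝ)⁻¹ ≤ 2⁻¹ := by gcongr
      linarith
    have h16 : (4 : ℝ) ≤ (16 : ℝ) ^ (1 - (r : ℝ)⁻¹) := by
      calc (4 : ℝ) = (16 : ℝ) ^ (1 / 2 : ℝ) := by
            rw [show (16 : ℝ) = 4 ^ (2 : ℝ) by norm_num, ← Real.rpow_mul (by norm_num)]; norm_num
        _ ≤ _ := Real.rpow_le_rpow_of_exponent_le (by norm_num) he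
    calc Q * (h : ℝ) ^ (1 - (r : ℝ)⁻¹) ≤ Q * ((N : ℝ) / 16) ^ (1 - (r : ℝ)⁻¹) := by gcongr
      _ = Q * (N : ℝ) ^ (1 - (r : ℝ)⁻¹) / (16 : ℝ) ^ (1 - (r : ℝ)⁻¹) := by
        rw [Real.div_rpow hN0.le (by norm_num)]; ring
      _ ≤ _ := by gcongr
  obtain ⟨s, m, hs, hm0, hm, hm2⟩ :=
    exists_intervalSum_moment_le hq hχ hr hAN hANq hAq hτA hL hL' c hE
  have hs0 : 0 < s := lt_of_lt_of_le (by
    have : 0 < A := lt_of_lt_of_le (by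
      have := Finset.card_pos.2 ⟨1, Nat.one_mem_divisors.2 (NeZero.ne q)⟩
      positivity) hτA
    positivity) hs
  rw [← hyr, ← hy2r] at hm2
  have hm3 := hm2.trans (burgess_numeric hr (by linarith) hBy hyB hs hA3 hN0 hL1 hC)
  have hNe : ((N : ℝ) ^ (1 - (r : ℝ)⁻¹)) ^ (2 * r) = (N : ℝ) ^ (2 * r - 2) := by
    rw [← Real.rpow_natCast, ← Real.rpow_mul hN0.le, ← Real.rpow_natCast (N : ℝ) (2 * r - 2)]
    congr 1
    rw [Nat.cast_sub (by omega)]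
    push_cast
    field_simp
  have hm4 : m ≤ s * B * (Q / 2 * (N : ℝ) ^ (1 - (r : ℝ)⁻¹)) := by
    refine (pow_le_pow_iff_left₀ hm0 (by positivity) (by omega : 2 * r ≠ 0)).1 (hm3.trans_eq ?_)
    rw [mul_pow _ (Q / 2 * _), mul_pow (Q / 2), hNe, show Q / 2 = D * L ^ 4 * (q : ℝ) ^ α by
      rw [hQ]; ring, mul_pow _ ((q : ℝ) ^ α), hαy, mul_pow D, ← pow_mul L,
      show 4 * (2 * r) = 8 * r by ring]
    ring
  have h5 := hm.trans hm4
  have h6 := le_of_mul_le_mul_left h5 (by positivity)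
  linarith

end Burgess

namespace Burgess

lemma exists_norm_intervalSum_le_burgess {r : ℕ} (hr : 0 < r) {ε : ℝ} (hε : 0 < ε) :
    ∃ K : ℝ, 1 ≤ K ∧ ∀ (q : ℕ) [NeZero q], 1 < q → (∀ p : ℕ, p.Prime → ¬ p ^ 3 ∣ q) →
      ∀ χ : DirichletCharacter ℂ q, LocallyPrimitive q χ → ∀ (c : ZMod q) (N : ℕ),
      ‖intervalSum χ c N‖ ≤ K *
        (q : ℝ) ^ (((r : ℝ) + 1) / (4 * (r : ℝ) ^ 2) + ε) * (N : ℝ) ^ (1 - (r : ℝ)⁻¹) := by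
  have hε4 : 0 < ε / 4 := by positivity
  obtain ⟨C, hC1, hC⟩ := exists_card_divisors_le hε4
  set D : ℝ := C + 1 + 1 / (ε / 4)
  have hεi : 0 < 1 / (ε / 4) := by positivity
  have hD : 1 ≤ D := by simp only [D]; linarith
  have hm := one_le_momentConst hr
  refine ⟨512 * momentConst r * (2 ^ r + 1) * D ^ 4, ?_, ?_⟩
  · have h1 : (1 : ℝ) ≤ 2 ^ r := one_le_pow₀ one_le_two
    refine one_le_mul_of_one_le_of_one_le ?_ (one_le_pow₀ hD)
    nlinarith
  intro q _ hq1 hq χ hχ c N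
  have hq0 : (1 : ℝ) ≤ q := by exact_mod_cast hq1.le
  have hq0' : (0 : ℝ) < q := by linarith
  have hqε : 1 ≤ (q : ℝ) ^ (ε / 4) := Real.one_le_rpow hq0 hε4.le
  refine (norm_intervalSum_le_burgess hr hq1 hq hχ (L := D * (q : ℝ) ^ (ε / 4)) ?_ ?_ c N).trans
    (le_of_eq ?_)
  · intro a ha
    rw [Finset.mem_Icc] at ha
    calc (a.divisors.card : ℝ) ≤ C * (a : ℝ) ^ (ε / 4) := hC a ha.1
      _ ≤ D * (q : ℝ) ^ (ε / 4) := by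
        have : (a : ℝ) ≤ q := by exact_mod_cast ha.2
        gcongr
        simp only [D]; linarith
  · have h1 := Real.log_le_rpow_div hq0'.le hε4
    have h2 : D * (q : ℝ) ^ (ε / 4) = C * (q : ℝ) ^ (ε / 4) + (q : ℝ) ^ (ε / 4)
      + (q : ℝ) ^ (ε / 4) / (ε / 4) := by simp only [D]; ring
    rw [h2]
    have : 0 ≤ C * (q : ℝ) ^ (ε / 4) := by positivity
    linarith
  · rw [Real.rpow_add hq0', mul_pow D, ← Real.rpow_natCast ((q : ℝ) ^ (ε / 4)),
      ← Real.rpow_mul hq0'.le]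
    rw [show ε / 4 * (4 : ℕ) = ε by push_cast; ring]
    ring

lemma norm_intervalSum_le_modulus {q : ℕ} [NeZero q] {χ : DirichletCharacter ℂ q} (hχ : χ ≠ 1)
    (c : ZMod q) (N : ℕ) : ‖intervalSum χ c N‖ ≤ q := by
  induction N using Nat.strong_induction_on generalizing c with
  | _ N ih =>
  rcases lt_or_ge N q with h | h
  · exact (norm_intervalSum_le χ c N).trans (by exact_mod_cast h.le)
  · obtain ⟨k, rfl⟩ := Nat.exists_eq_add_of_le h
    have h0 : intervalSum χ c q = 0 := by
      rw [← MulChar.sum_eq_zero_of_ne_one hχ, intervalSum]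
      rw [← Equiv.sum_comp (Equiv.addLeft c) (fun x => χ x)]
      refine Finset.sum_nbij' (fun i => (i : ZMod q)) ZMod.val ?_ ?_ ?_ ?_ ?_
      · intro _ _; exact Finset.mem_univ _
      · intro x _; exact Finset.mem_range.2 (ZMod.val_lt x)
      · intro i hi; exact ZMod.val_cast_of_lt (Finset.mem_range.1 hi)
      · intro x _; exact ZMod.natCast_zmod_val x
      · intro _ _; rfl
    rw [intervalSum_add, h0, zero_add]
    exact ih k (by have := NeZero.pos q; omega) _

lemma sum_range_eq_sum_residues (f : ℕ → ℂ) {d : ℕ} (hd : 0 < d) (N : ℕ) :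
    ∑ i ∈ Finset.range N, f i
      = ∑ a ∈ Finset.range d, ∑ m ∈ Finset.range ((N - a + d - 1) / d), f (a + d * m) := by
  rw [Finset.sum_sigma']
  have hiff : ∀ a m : ℕ, m < (N - a + d - 1) / d ↔ a + d * m < N := by
    intro a m
    rw [Nat.lt_iff_add_one_le, Nat.le_div_iff_mul_le hd, add_mul, one_mul, mul_comm m d]
    omega
  refine Finset.sum_nbij' (fun i => ⟨i % d, i / d⟩) (fun x => x.1 + d * x.2) ?_ ?_ ?_ ?_ ?_
  · intro i hi
    simp only [Finset.mem_sigma, Finset.mem_range] at hi ⊢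
    refine ⟨Nat.mod_lt _ hd, (hiff _ _).2 ?_⟩
    rwa [Nat.mod_add_div]
  · rintro ⟨a, m⟩ h
    simp only [Finset.mem_sigma, Finset.mem_range] at h ⊢
    exact (hiff _ _).1 h.2
  · intro i _
    exact Nat.mod_add_div i d
  · rintro ⟨a, m⟩ h
    simp only [Finset.mem_sigma, Finset.mem_range] at h
    simp only [Nat.add_mul_mod_self_left, Nat.mod_eq_of_lt h.1, Nat.add_mul_div_left _ _ hd,
      Nat.div_eq_of_lt h.1, zero_add]
  · intro i _
    simp only [Nat.mod_add_div]

/-- Splitting an interval sum into progressions modulo a coprime factor of the modulus. -/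
lemma norm_intervalSum_le_of_coprime {a b : ℕ} [NeZero a] [NeZero b] (hab : a.Coprime b)
    (χ : DirichletCharacter ℂ (a * b)) (c : ℕ) {N : ℕ} (hN : b ≤ N) {X : ℝ}
    (hX : ∀ (c : ZMod a) (n : ℕ), n * b ≤ 2 * N → ‖intervalSum (leftChar hab χ) c n‖ ≤ X) :
    ‖intervalSum χ (c : ZMod (a * b)) N‖ ≤ b * X := by
  have hb := NeZero.pos b
  rw [intervalSum, sum_range_eq_sum_residues _ hb]
  refine (norm_sum_le _ _).trans ((Finset.sum_le_sum (g := fun _ => X) fun i hi => ?_).trans_eq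
    (by simp))
  have h1 : ∑ m ∈ Finset.range ((N - i + b - 1) / b), χ (c + (i + b * m : ℕ))
      = leftChar hab χ b * rightChar hab χ (c + i) *
        intervalSum (leftChar hab χ) ((b : ZMod a)⁻¹ * (c + i)) ((N - i + b - 1) / b) := by
    rw [intervalSum, Finset.mul_sum]
    refine Finset.sum_congr rfl fun m _ => ?_
    have h2 := apply_intCast_eq hab χ (c + (i + b * m) : ℕ)
    push_cast at h2 ⊢
    rw [h2, ZMod.natCast_self, zero_mul, add_zero, mul_right_comm, ← map_mul]
    congr 2
    have := ZMod.coe_mul_inv_eq_one b hab.symm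
    linear_combination -(c + i : ZMod a) * this
  rw [h1, norm_mul, norm_mul]
  have hX' := hX ((b : ZMod a)⁻¹ * (c + i)) ((N - i + b - 1) / b) ?_
  · refine (mul_le_of_le_one_left (norm_nonneg _) ?_).trans hX'
    exact mul_le_one₀ (norm_mulChar_le_one _ _) (norm_nonneg _) (norm_mulChar_le_one _ _)
  · have := Nat.div_mul_le_self (N - i + b - 1) b
    omega

lemma exists_norm_intervalSum_le_of_isPrimitive {r : ℕ} (hr : 0 < r) {ε : ℝ} (hε : 0 < ε) :
    ∃ K : ℝ, 1 ≤ K ∧ ∀ (q a b : ℕ), 1 < q → q = a * b → a.Coprime b →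
      (∀ p : ℕ, p.Prime → ¬ p ^ 3 ∣ a) →
      ∀ χ : DirichletCharacter ℂ q, χ.IsPrimitive → ∀ (c N : ℕ),
      ‖intervalSum χ (c : ZMod q) N‖ ≤ K *
        (a : ℝ) ^ (((r : ℝ) + 1) / (4 * (r : ℝ) ^ 2) + ε) * (b : ℝ) ^ (r : ℝ)⁻¹
          * (N : ℝ) ^ (1 - (r : ℝ)⁻¹) := by
  obtain ⟨K, hK1, hK⟩ := exists_norm_intervalSum_le_burgess hr hε
  refine ⟨2 * K, by linarith, ?_⟩
  rintro _ a b hq rfl hab ha χ hχ c N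
  have ha0 : 0 < a := Nat.pos_of_ne_zero fun h => by simp [h] at hq
  have hb0 : 0 < b := Nat.pos_of_ne_zero fun h => by simp [h] at hq
  have : NeZero a := ⟨ha0.ne'⟩
  have : NeZero b := ⟨hb0.ne'⟩
  set β : ℝ := ((r : ℝ) + 1) / (4 * (r : ℝ) ^ 2) + ε
  have hr1 : (1 : ℝ) ≤ r := by exact_mod_cast hr
  have hβ : 0 ≤ β := by positivity
  have hri : (r : ℝ)⁻¹ ≤ 1 := inv_le_one_of_one_le₀ hr1
  have hri0 : 0 ≤ (r : ℝ)⁻¹ := by positivity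
  have ha1 : (1 : ℝ) ≤ a := by exact_mod_cast ha0
  have hb1 : (1 : ℝ) ≤ b := by exact_mod_cast hb0
  have haβ : 1 ≤ (a : ℝ) ^ β := Real.one_le_rpow ha1 hβ
  rcases Nat.eq_zero_or_pos N with rfl | hN
  · simp only [intervalSum, Finset.range_zero, Finset.sum_empty, norm_zero]
    positivity
  have hN0 : (0 : ℝ) < N := by exact_mod_cast hN
  have hχ1 : χ ≠ 1 := by
    rintro rfl
    rw [DirichletCharacter.isPrimitive_def, DirichletCharacter.conductor_one] at hχ
    omega
  have htriv : ∀ x : ℝ, 0 ≤ x → x ≤ b → x ≤ N → x ≤ 2 * K * (a : ℝ) ^ β * (b : ℝ) ^ (r : ℝ)⁻¹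
      * (N : ℝ) ^ (1 - (r : ℝ)⁻¹) := by
    intro x hx hxb hxN
    rcases hx.eq_or_lt with rfl | hx
    · positivity
    have h1 : 1 ≤ 2 * K * (a : ℝ) ^ β := by nlinarith
    calc x = 1 * (x ^ (r : ℝ)⁻¹ * x ^ (1 - (r : ℝ)⁻¹)) := by
          rw [← Real.rpow_add hx]; simp
      _ ≤ 2 * K * (a : ℝ) ^ β * ((b : ℝ) ^ (r : ℝ)⁻¹ * (N : ℝ) ^ (1 - (r : ℝ)⁻¹)) := by
          have : 0 ≤ 1 - (r : ℝ)⁻¹ := by linarith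
          gcongr
      _ = _ := by ring
  rcases Nat.lt_or_ge N b with hNb | hNb
  · exact htriv _ (norm_nonneg _)
      ((norm_intervalSum_le χ _ N).trans (by exact_mod_cast hNb.le)) (norm_intervalSum_le χ _ N)
  rcases Nat.lt_or_ge 1 a with ha2 | ha2
  · have hloc : LocallyPrimitive a (leftChar hab χ) :=
      locallyPrimitive_leftChar hab (locallyPrimitive_of_isPrimitive (by omega) hχ)
    have h1 := norm_intervalSum_le_of_coprime hab χ c hNb
      (X := K * (a : ℝ) ^ β * (2 * (N / b : ℝ) ^ (1 - (r : ℝ)⁻¹))) ?_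
    · refine h1.trans (le_of_eq ?_)
      rw [Real.div_rpow hN0.le (by linarith)]
      have hb' : (b : ℝ) = (b : ℝ) ^ (r : ℝ)⁻¹ * (b : ℝ) ^ (1 - (r : ℝ)⁻¹) := by
        rw [← Real.rpow_add (by linarith)]; simp
      have : (b : ℝ) ^ (1 - (r : ℝ)⁻¹) ≠ 0 := by positivity
      conv_lhs => rw [hb', ← hb']
      conv_lhs => enter [1]; rw [hb']
      field_simp
    · intro c' n hn
      refine (hK a ha2 ha _ hloc c' n).trans ?_
      have hn' : (n : ℝ) ≤ 2 * (N / b) := by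
        rw [← mul_div_assoc, le_div_iff₀ (by linarith)]
        exact_mod_cast hn
      have he : 0 ≤ 1 - (r : ℝ)⁻¹ := by linarith
      gcongr
      calc (n : ℝ) ^ (1 - (r : ℝ)⁻¹) ≤ (2 * (N / b : ℝ)) ^ (1 - (r : ℝ)⁻¹) := by gcongr
        _ = (2 : ℝ) ^ (1 - (r : ℝ)⁻¹) * (N / b : ℝ) ^ (1 - (r : ℝ)⁻¹) :=
          Real.mul_rpow zero_le_two (by positivity)
        _ ≤ 2 * (N / b : ℝ) ^ (1 - (r : ℝ)⁻¹) := by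
          gcongr
          calc (2 : ℝ) ^ (1 - (r : ℝ)⁻¹) ≤ (2 : ℝ) ^ (1 : ℝ) :=
                Real.rpow_le_rpow_of_exponent_le one_le_two (by linarith)
            _ = 2 := Real.rpow_one 2
  · obtain rfl : a = 1 := by omega
    refine htriv _ (norm_nonneg _) ?_ (norm_intervalSum_le χ _ N)
    simpa using norm_intervalSum_le_modulus hχ1 (c : ZMod (1 * b)) N

end Burgess

namespace Burgess

lemma norm_sum_filter_primes_le {ψ : ℕ → ℂ} (hmul : ∀ m n, ψ (m * n) = ψ m * ψ n)
    (hψ : ∀ n, ‖ψ n‖ ≤ 1) {F : ℕ → ℝ} (hF : Monotone F)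
    (h : ∀ M M' : ℕ, M ≤ M' → ‖∑ n ∈ Finset.Ioc M M', ψ n‖ ≤ F (M' - M))
    (S : Finset ℕ) (hS : ∀ p ∈ S, p.Prime) {M M' : ℕ} (hM : M ≤ M') :
    ‖∑ n ∈ (Finset.Ioc M M').filter (fun n => ∀ p ∈ S, ¬ p ∣ n), ψ n‖
      ≤ 2 ^ S.card * F (M' - M) := by
  classical
  induction S using Finset.induction_on generalizing M M' with
  | empty => simpa using h M M' hM
  | insert p S hpS ih =>
    have hp : p.Prime := hS p (Finset.mem_insert_self _ _)
    have hS' : ∀ p ∈ S, p.Prime := fun l hl => hS l (Finset.mem_insert_of_mem hl)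
    have hsplit := Finset.sum_filter_add_sum_filter_not
      ((Finset.Ioc M M').filter fun n => ∀ l ∈ S, ¬ l ∣ n) (fun n => ¬ p ∣ n) ψ
    have h1 : ((Finset.Ioc M M').filter fun n => ∀ l ∈ S, ¬ l ∣ n).filter (fun n => ¬ p ∣ n)
        = (Finset.Ioc M M').filter fun n => ∀ l ∈ insert p S, ¬ l ∣ n := by
      rw [Finset.filter_filter]
      refine Finset.filter_congr fun n _ => ?_
      rw [Finset.forall_mem_insert, and_comm]
    have h2 : ∑ n ∈ ((Finset.Ioc M M').filter fun n => ∀ l ∈ S, ¬ l ∣ n).filter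
        (fun n => ¬ ¬ p ∣ n), ψ n
        = ψ p * ∑ n ∈ (Finset.Ioc (M / p) (M' / p)).filter (fun n => ∀ l ∈ S, ¬ l ∣ n), ψ n := by
      rw [Finset.mul_sum]
      have hmem : ∀ n, p * n ∈ Finset.Ioc M M' ↔ n ∈ Finset.Ioc (M / p) (M' / p) := by
        intro n
        rw [Finset.mem_Ioc, Finset.mem_Ioc, Nat.div_lt_iff_lt_mul hp.pos,
          Nat.le_div_iff_mul_le hp.pos, mul_comm n p]
      have hdvd : ∀ n, (∀ l ∈ S, ¬ l ∣ p * n) ↔ ∀ l ∈ S, ¬ l ∣ n := by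
        intro n
        refine forall₂_congr fun l hl => not_congr ?_
        have hlp : l ≠ p := fun e => hpS (e ▸ hl)
        exact (((Nat.coprime_primes (hS' l hl) hp).2 hlp).dvd_mul_left)
      symm
      refine Finset.sum_bij (fun n _ => p * n) ?_ ?_ ?_ ?_
      · intro n hn
        rw [Finset.mem_filter] at hn
        rw [Finset.mem_filter, Finset.mem_filter, hmem, hdvd, not_not]
        exact ⟨hn, dvd_mul_right _ _⟩
      · intro a _ b _ e
        exact Nat.eq_of_mul_eq_mul_left hp.pos e
      · intro b hb
        rw [Finset.mem_filter, Finset.mem_filter, not_not] at hb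
        obtain ⟨⟨hb1, hb2⟩, n, rfl⟩ := hb
        exact ⟨n, Finset.mem_filter.2 ⟨(hmem n).1 hb1, (hdvd n).1 hb2⟩, rfl⟩
      · intro n _
        rw [hmul]
    rw [h1, h2] at hsplit
    rw [eq_sub_of_add_eq hsplit, Finset.card_insert_of_notMem hpS, pow_succ]
    have h3 := ih hS' hM
    have h4 := ih hS' (Nat.div_le_div_right hM : M / p ≤ M' / p)
    have h5 : F (M' / p - M / p) ≤ F (M' - M) := by
      refine hF ?_
      obtain ⟨d, rfl⟩ := Nat.exists_eq_add_of_le hM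
      have : (M + d) / p ≤ M / p + d := by
        calc (M + d) / p ≤ (M + p * d) / p :=
              Nat.div_le_div_right (Nat.add_le_add_left (Nat.le_mul_of_pos_left d hp.pos) M)
          _ = _ := Nat.add_mul_div_left _ _ hp.pos
      omega
    have h6 : (2 : ℝ) ^ S.card * F (M' / p - M / p) ≤ 2 ^ S.card * F (M' - M) := by gcongr
    refine (norm_sub_le _ _).trans ?_
    rw [norm_mul]
    have h7 := mul_le_of_le_one_left (norm_nonneg (∑ n ∈ (Finset.Ioc (M / p) (M' / p)).filter
      (fun n => ∀ l ∈ S, ¬ l ∣ n), ψ n)) (hψ p)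
    linarith

lemma apply_natCast_eq_ite {q : ℕ} (hq : 0 < q) (χ : DirichletCharacter ℂ q) (n : ℕ) :
    χ (n : ZMod q) = if ∀ p ∈ q.primeFactors \ χ.conductor.primeFactors, ¬ p ∣ n
      then χ.primitiveCharacter (n : ZMod χ.conductor) else 0 := by
  have : NeZero q := ⟨hq.ne'⟩
  have hzero : ∀ {m p : ℕ} (ψ : DirichletCharacter ℂ m), p.Prime → p ∣ m → p ∣ n →
      ψ (n : ZMod m) = 0 := by
    intro m p ψ hp hm hn
    refine MulChar.map_nonunit ψ fun hu => ?_
    rw [ZMod.isUnit_iff_coprime] at hu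
    exact hp.one_lt.ne' (Nat.dvd_one.1 (hu ▸ Nat.dvd_gcd hn hm))
  split_ifs with h
  · by_cases hc : n.Coprime q
    · have := χ.primitiveCharacter_apply_of_isCoprime
        (Nat.isCoprime_iff_coprime.2 hc : IsCoprime (n : ℤ) q)
      simpa using this.symm
    · obtain ⟨p, hp, hpn, hpq⟩ := Nat.Prime.not_coprime_iff_dvd.1 hc
      have hpc : p ∣ χ.conductor := by
        by_contra hpc
        refine h p (Finset.mem_sdiff.2 ⟨Nat.mem_primeFactors.2 ⟨hp, hpq, hq.ne'⟩, fun h' => ?_⟩) hpn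
        exact hpc (Nat.dvd_of_mem_primeFactors h')
      rw [hzero χ hp hpq hpn, hzero χ.primitiveCharacter hp hpc hpn]
  · push Not at h
    obtain ⟨p, hp, hpn⟩ := h
    have hp' := (Finset.mem_sdiff.1 hp).1
    exact hzero χ (Nat.prime_of_mem_primeFactors hp') (Nat.dvd_of_mem_primeFactors hp') hpn

lemma sum_Ioc_eq_intervalSum {q : ℕ} (χ : DirichletCharacter ℂ q) {M M' : ℕ} (hM : M ≤ M') :
    ∑ n ∈ Finset.Ioc M M', χ (n : ZMod q) = intervalSum χ ((M + 1 : ℕ) : ZMod q) (M' - M) := by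
  rw [intervalSum, show Finset.Ioc M M' = Finset.Ico (M + 1) (M' + 1) by
    ext; simp [Finset.mem_Ioc, Finset.mem_Ico], Finset.sum_Ico_eq_sum_range]
  rw [show M' + 1 - (M + 1) = M' - M by omega]
  simp

end Burgess

/-- Burgess' bound for short sums of an arbitrary (possibly imprimitive) non-principal
Dirichlet character: writing `q*` for the conductor, `q₁` for the maximal cubefree unitary
divisor of `q*`, `q₂ = q*/q₁` and `q₀` for the product of the primes dividing `q` but not
`q*`, we have `|∑_{n=M+1}^{M+N} χ(n)| ≤ C(r,ε) q₀^ε q₁^{(r+1)/(4r²)+ε} q₂^{1/r} N^{1-1/r}`. -/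
theorem burgess_imprimitive (r : ℕ) (hr : 0 < r) (ε : ℝ) (hε : 0 < ε) :
    ∃ C : ℝ, 0 < C ∧
      ∀ (q : ℕ), 0 < q → ∀ (χ : DirichletCharacter ℂ q), 1 < χ.conductor →
        ∀ q₁ : ℕ, q₁ ∣ χ.conductor →
          (∀ p : ℕ, p.Prime → ¬ p ^ 3 ∣ q₁) →
          Nat.Coprime q₁ (χ.conductor / q₁) →
          (∀ d : ℕ, d ∣ χ.conductor → (∀ p : ℕ, p.Prime → ¬ p ^ 3 ∣ d) →
            Nat.Coprime d (χ.conductor / d) → d ≤ q₁) →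
          ∀ M N : ℕ, 0 < N →
            ‖∑ n ∈ Finset.Icc (M + 1) (M + N), χ (n : ZMod q)‖ ≤
              C * ((∏ p ∈ q.primeFactors \ χ.conductor.primeFactors, p : ℕ) : ℝ) ^ ε *
                (q₁ : ℝ) ^ (((r : ℝ) + 1) / (4 * (r : ℝ) ^ 2) + ε) *
                ((χ.conductor / q₁ : ℕ) : ℝ) ^ ((r : ℝ)⁻¹) *
                (N : ℝ) ^ (1 - (r : ℝ)⁻¹) := by
  obtain ⟨K, hK1, hK⟩ := Burgess.exists_norm_intervalSum_le_of_isPrimitive hr hε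
  obtain ⟨D, hD1, hD⟩ := Burgess.exists_card_divisors_le hε
  refine ⟨D * K, by positivity, ?_⟩
  intro q hq χ hχ q₁ hdvd hcube hcop _ M N _
  have : NeZero χ.conductor := ⟨by omega⟩
  set S := q.primeFactors \ χ.conductor.primeFactors
  have hS : ∀ p ∈ S, p.Prime := fun p hp =>
    Nat.prime_of_mem_primeFactors (Finset.mem_sdiff.1 hp).1
  have hr1 : (1 : ℝ) ≤ r := by exact_mod_cast hr
  have he : 0 ≤ 1 - (r : ℝ)⁻¹ := by
    have := inv_le_one_of_one_le₀ hr1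
    linarith
  set X : ℝ := K * (q₁ : ℝ) ^ (((r : ℝ) + 1) / (4 * (r : ℝ) ^ 2) + ε) *
    ((χ.conductor / q₁ : ℕ) : ℝ) ^ ((r : ℝ)⁻¹)
  have hX : 0 ≤ X := by positivity
  have hF : Monotone fun n : ℕ => X * (n : ℝ) ^ (1 - (r : ℝ)⁻¹) := by
    intro m n hmn
    have : (m : ℝ) ≤ n := by exact_mod_cast hmn
    simp only
    gcongr
  have h1 := Burgess.norm_sum_filter_primes_le
    (ψ := fun n : ℕ => χ.primitiveCharacter (n : ZMod χ.conductor))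
    (fun m n => by push_cast; rw [map_mul]) (fun n => Burgess.norm_mulChar_le_one _ _) hF
    (fun M M' hM => by
      rw [Burgess.sum_Ioc_eq_intervalSum _ hM]
      exact hK χ.conductor q₁ (χ.conductor / q₁) hχ (Nat.mul_div_cancel' hdvd).symm hcop hcube
        _ χ.primitiveCharacter_isPrimitive _ _)
    S hS (Nat.le_add_right M N)
  have h2 : ∑ n ∈ Finset.Icc (M + 1) (M + N), χ (n : ZMod q)
      = ∑ n ∈ (Finset.Ioc M (M + N)).filter (fun n => ∀ p ∈ S, ¬ p ∣ n),
        χ.primitiveCharacter (n : ZMod χ.conductor) := by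
    rw [Finset.sum_filter]
    refine Finset.sum_congr ?_ fun n _ => Burgess.apply_natCast_eq_ite hq χ n
    ext
    simp [Finset.mem_Ioc, Finset.mem_Icc]
  have h3 : (2 : ℝ) ^ S.card ≤ D * ((∏ p ∈ S, p : ℕ) : ℝ) ^ ε := by
    have hpos : 0 < ∏ p ∈ S, p := Finset.prod_pos fun p hp => (hS p hp).pos
    refine le_trans ?_ (hD _ hpos)
    have := Burgess.two_pow_card_primeFactors_le hpos
    rw [Nat.primeFactors_prod hS] at this
    exact_mod_cast this
  rw [h2]
  refine h1.trans ?_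
  rw [Nat.add_sub_cancel_left]
  calc _ ≤ D * ((∏ p ∈ S, p : ℕ) : ℝ) ^ ε * (X * (N : ℝ) ^ (1 - (r : ℝ)⁻¹)) := by gcongr
    _ = _ := by simp only [X]; ring
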